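/- arXiv:1306.0254 — 4 statements merged into one kernel-verified Lean document; each statement's English description precedes it below -/
import Mathlib

section
/- Let p = p_n be a sequence of positive integers with n > 1 + p_n for all n ≥ 3 and p_n/n → y ∈ (0, 1] as n → ∞. For each n, let x_1, …, x_n be i.i.d. ℝ^p-valued random vectors with independent standard normal coordinates, and set x̄ = (1/n)Σ_{i=1}^n x_i, A = Σ_{i=1}^n (x_i − x̄)(x_i − x̄)ᵀ, and Λ_n = (e/n)^{np/2} · det(A)^{n/2} · exp(−tr(A)/2) · exp(−n·x̄ᵀx̄/2). Define μ_n = −(1/4)[ n(2n − 2p − 3)·log(1 − p/(n−1)) + 2(n+1)p ] and σ_n² = −(1/2)( p/(n−1) + log(1 − p/(n−1)) ), which is strictly positive. Then (log Λ_n − μ_n)/(n σ_n) converges in distribution to the standard normal distribution N(0,1) as n → ∞. -/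
open Filter Topology MeasureTheory ProbabilityTheory Matrix

/-- The logarithm of the likelihood ratio statistic for testing `H₀ : μ = 0, Σ = I_p`
from a sample of `n` `p`-variate observations `ω (i, ·)`:
`Λ = (e/n)^{np/2} · det(A)^{n/2} · exp(−tr(A)/2) · exp(−n x̄ᵀx̄/2)`,
where `x̄` is the sample mean and `A = Σ_i (x_i − x̄)(x_i − x̄)ᵀ`. -/
noncomputable def logSpecifiedStat (n p : ℕ) (ω : Fin n × Fin p → ℝ) : ℝ :=
  let xbar : Fin p → ℝ := fun c => (∑ i, ω (i, c)) / n
  let A : Matrix (Fin p) (Fin p) ℝ :=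
    ∑ i, Matrix.vecMulVec (fun c => ω (i, c) - xbar c) (fun c => ω (i, c) - xbar c)
  Real.log ((Real.exp 1 / n) ^ ((n : ℝ) * p / 2) * A.det ^ ((n : ℝ) / 2)
    * Real.exp (-A.trace / 2) * Real.exp (-(n : ℝ) * (∑ c, xbar c ^ 2) / 2))


/-- truncated exponential as a bounded continuous function -/
noncomputable def truncExp (t : ℝ) (K : ℕ) : BoundedContinuousFunction ℝ NNReal :=
  BoundedContinuousFunction.mkOfBound
    ⟨fun x => min (Real.toNNReal (Real.exp (t * x))) (K : NNReal), by fun_prop⟩ (K : ℝ) (by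
      intro x y
      rw [NNReal.dist_eq, abs_le]
      have h1 : ((min (Real.toNNReal (Real.exp (t * x))) (K : NNReal) : NNReal) : ℝ) ≤ K := by
        exact_mod_cast min_le_right _ _
      have h2 : ((min (Real.toNNReal (Real.exp (t * y))) (K : NNReal) : NNReal) : ℝ) ≤ K := by
        exact_mod_cast min_le_right _ _
      have h3 := NNReal.coe_nonneg (min (Real.toNNReal (Real.exp (t * x))) (K : NNReal))
      have h4 := NNReal.coe_nonneg (min (Real.toNNReal (Real.exp (t * y))) (K : NNReal))
      simp only [ContinuousMap.coe_mk]
      constructor <;> linarith)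

lemma truncExp_coe (t : ℝ) (K : ℕ) (x : ℝ) :
    ((truncExp t K x : NNReal) : ENNReal) = min (ENNReal.ofReal (Real.exp (t * x))) (K : ENNReal) := by
  have : truncExp t K x = min (Real.toNNReal (Real.exp (t * x))) (K : NNReal) := rfl
  rw [this]; simp [ENNReal.ofReal]

lemma mgf_limit (U : Filter ℕ) [U.NeBot] (ν : ℕ → ProbabilityMeasure ℝ) (μ' : ProbabilityMeasure ℝ)
    (hU : Tendsto ν U (𝓝 μ'))
    (hL : ∀ t : ℝ, Tendsto (fun n => ∫⁻ x, ENNReal.ofReal (Real.exp (t * x)) ∂(ν n : Measure ℝ)) U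
      (𝓝 (ENNReal.ofReal (Real.exp (t ^ 2 / 2))))) (t : ℝ) :
    ∫⁻ x, ENNReal.ofReal (Real.exp (t * x)) ∂(μ' : Measure ℝ) = ENNReal.ofReal (Real.exp (t ^ 2 / 2)) := by
  rw [ProbabilityMeasure.tendsto_iff_forall_lintegral_tendsto] at hU
  have hT : ∀ K : ℕ, Tendsto (fun n => ∫⁻ x, min (ENNReal.ofReal (Real.exp (t * x))) (K : ENNReal) ∂(ν n : Measure ℝ)) U
      (𝓝 (∫⁻ x, min (ENNReal.ofReal (Real.exp (t * x))) (K : ENNReal) ∂(μ' : Measure ℝ))) := by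
    intro K
    have := hU (truncExp t K)
    simpa only [truncExp_coe] using this
  apply le_antisymm
  · have hmono : Tendsto (fun K : ℕ => ∫⁻ x, min (ENNReal.ofReal (Real.exp (t * x))) (K : ENNReal) ∂(μ' : Measure ℝ)) atTop
        (𝓝 (∫⁻ x, ENNReal.ofReal (Real.exp (t * x)) ∂(μ' : Measure ℝ))) := by
      apply lintegral_tendsto_of_tendsto_of_monotone
      · intro n; fun_prop
      · refine ae_of_all _ fun x a b hab => ?_
        dsimp only
        gcongr
      · refine ae_of_all _ fun x => ?_
        apply tendsto_const_nhds.congr'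
        obtain ⟨N, hN⟩ := exists_nat_gt (Real.exp (t * x))
        filter_upwards [eventually_ge_atTop N] with n hn
        rw [min_eq_left]
        rw [← ENNReal.ofReal_natCast]
        apply ENNReal.ofReal_le_ofReal
        have : (N : ℝ) ≤ n := by exact_mod_cast hn
        linarith
    refine le_of_tendsto' hmono fun K => ?_
    refine le_of_tendsto_of_tendsto' (hT K) (hL t) fun n => ?_
    exact lintegral_mono fun x => min_le_left _ _
  · have key : ∀ K : ℕ, 1 ≤ K → ENNReal.ofReal (Real.exp (t ^ 2 / 2)) ≤
        (∫⁻ x, ENNReal.ofReal (Real.exp (t * x)) ∂(μ' : Measure ℝ))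
          + (K : ENNReal)⁻¹ * ENNReal.ofReal (Real.exp ((2 * t) ^ 2 / 2)) := by
      intro K hK
      have hKne : (K : ENNReal)⁻¹ ≠ ⊤ := by simp; omega
      have h1 : ENNReal.ofReal (Real.exp (t ^ 2 / 2)) ≤
        (∫⁻ x, min (ENNReal.ofReal (Real.exp (t * x))) (K : ENNReal) ∂(μ' : Measure ℝ))
          + (K : ENNReal)⁻¹ * ENNReal.ofReal (Real.exp ((2 * t) ^ 2 / 2)) := by
        refine le_of_tendsto_of_tendsto' (hL t)
          ((hT K).add (ENNReal.Tendsto.const_mul (hL (2 * t)) (Or.inr hKne))) fun n => ?_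
        rw [← lintegral_const_mul _ (by fun_prop), ← lintegral_add_left (by fun_prop)]
        refine lintegral_mono fun x => ?_
        dsimp only
        rcases le_total (Real.exp (t * x)) (K : ℝ) with h | h
        · rw [min_eq_left (by rw [← ENNReal.ofReal_natCast]; exact ENNReal.ofReal_le_ofReal h)]
          exact le_self_add
        · refine le_trans ?_ le_add_self
          have hKpos : (0 : ℝ) < K := by exact_mod_cast hK
          rw [← ENNReal.ofReal_natCast, ← ENNReal.ofReal_inv_of_pos hKpos,
            ← ENNReal.ofReal_mul (by positivity)]
          apply ENNReal.ofReal_le_ofReal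
          rw [show 2 * t * x = t * x + t * x by ring, Real.exp_add, ← mul_assoc]
          have : 1 ≤ (K : ℝ)⁻¹ * Real.exp (t * x) := by
            rw [inv_mul_eq_div, le_div_iff₀ hKpos]; linarith
          nlinarith [Real.exp_pos (t * x)]
      refine h1.trans ?_
      gcongr
      exact min_le_left _ _
    have hlim : Tendsto (fun K : ℕ => (∫⁻ x, ENNReal.ofReal (Real.exp (t * x)) ∂(μ' : Measure ℝ))
          + (K : ENNReal)⁻¹ * ENNReal.ofReal (Real.exp ((2 * t) ^ 2 / 2))) atTop
        (𝓝 ((∫⁻ x, ENNReal.ofReal (Real.exp (t * x)) ∂(μ' : Measure ℝ)) + 0 * ENNReal.ofReal (Real.exp ((2 * t) ^ 2 / 2)))) := by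
      refine tendsto_const_nhds.add ?_
      exact ENNReal.Tendsto.mul_const ENNReal.tendsto_inv_nat_nhds_zero (Or.inr ENNReal.ofReal_ne_top)
    rw [zero_mul, add_zero] at hlim
    refine ge_of_tendsto hlim ?_
    filter_upwards [eventually_ge_atTop 1] with K hK using key K hK

lemma mgf_unique (μ' : ProbabilityMeasure ℝ)
    (h : ∀ t : ℝ, ∫⁻ x, ENNReal.ofReal (Real.exp (t * x)) ∂(μ' : Measure ℝ) = ENNReal.ofReal (Real.exp (t ^ 2 / 2))) :
    (μ' : Measure ℝ) = gaussianReal 0 1 := by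
  have hmgf : mgf id (gaussianReal 0 1) = mgf id (μ' : Measure ℝ) := by
    rw [mgf_id_gaussianReal]
    ext t
    rw [mgf, integral_eq_lintegral_of_nonneg_ae (ae_of_all _ fun x => (Real.exp_pos _).le) (by fun_prop)]
    simp only [id]
    rw [h, ENNReal.toReal_ofReal (Real.exp_pos _).le]
    simp
  have := eqOn_complexMGF_of_mgf hmgf
  simp only [integrableExpSet_id_gaussianReal, interior_univ, Set.mem_univ, Set.ofPred_true] at this
  refine (Measure.ext_of_complexMGF_id_eq ?_).symm
  ext z
  exact this (Set.mem_univ z)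

lemma weak_of_mgf (ν : ℕ → ProbabilityMeasure ℝ)
    (hL : ∀ t : ℝ, Tendsto (fun n => ∫⁻ x, ENNReal.ofReal (Real.exp (t * x)) ∂(ν n : Measure ℝ)) atTop
      (𝓝 (ENNReal.ofReal (Real.exp (t ^ 2 / 2))))) :
    Tendsto ν atTop (𝓝 ⟨gaussianReal 0 1, inferInstance⟩) := by
  -- shift
  obtain ⟨N, hN⟩ : ∃ N : ℕ, ∀ n ≥ N,
      (∫⁻ x, ENNReal.ofReal (Real.exp (1 * x)) ∂(ν n : Measure ℝ)) ≤ ENNReal.ofReal (Real.exp 1) ∧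
      (∫⁻ x, ENNReal.ofReal (Real.exp (-1 * x)) ∂(ν n : Measure ℝ)) ≤ ENNReal.ofReal (Real.exp 1) := by
    have h1 : ENNReal.ofReal (Real.exp ((1 : ℝ) ^ 2 / 2)) < ENNReal.ofReal (Real.exp 1) := by
      rw [ENNReal.ofReal_lt_ofReal_iff (Real.exp_pos _)]
      apply Real.exp_lt_exp.2; norm_num
    have h2 : ENNReal.ofReal (Real.exp ((-1 : ℝ) ^ 2 / 2)) < ENNReal.ofReal (Real.exp 1) := by
      rw [ENNReal.ofReal_lt_ofReal_iff (Real.exp_pos _)]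
      apply Real.exp_lt_exp.2; norm_num
    have := ((hL 1).eventually (gt_mem_nhds h1)).and ((hL (-1)).eventually (gt_mem_nhds h2))
    obtain ⟨N, hN⟩ := eventually_atTop.1 this
    exact ⟨N, fun n hn => ⟨(hN n hn).1.le, (hN n hn).2.le⟩⟩
  rw [← tendsto_add_atTop_iff_nat N]
  have hL' : ∀ t : ℝ, Tendsto (fun n => ∫⁻ x, ENNReal.ofReal (Real.exp (t * x)) ∂(ν (n + N) : Measure ℝ)) atTop
      (𝓝 (ENNReal.ofReal (Real.exp (t ^ 2 / 2)))) := fun t =>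
    (hL t).comp (tendsto_add_atTop_nat N)
  have hN' : ∀ n : ℕ, _ := fun n => hN (n + N) (by omega)
  clear hN hL
  set ν' : ℕ → ProbabilityMeasure ℝ := fun n => ν (n + N) with hν'
  have h_tight : IsTightMeasureSet {((μ : ProbabilityMeasure ℝ) : Measure ℝ) | μ ∈ Set.range ν'} := by
    rw [isTightMeasureSet_iff_exists_isCompact_measure_compl_le]
    intro ε hε
    have hlim : Tendsto (fun M : ℝ => ENNReal.ofReal (2 * Real.exp 1 * Real.exp (-M))) atTop (𝓝 0) := by
      rw [← ENNReal.ofReal_zero]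
      apply ENNReal.tendsto_ofReal
      rw [show (0 : ℝ) = 2 * Real.exp 1 * 0 by ring]
      exact (Real.tendsto_exp_neg_atTop_nhds_zero).const_mul _
    obtain ⟨M, hM⟩ := (hlim.eventually (gt_mem_nhds hε)).exists
    refine ⟨Set.Icc (-M) M, isCompact_Icc, ?_⟩
    rintro _ ⟨_, ⟨n, rfl⟩, rfl⟩
    have mk : ∀ s : ℝ, (∫⁻ x, ENNReal.ofReal (Real.exp (s * x)) ∂(ν' n : Measure ℝ)) ≤ ENNReal.ofReal (Real.exp 1) →
        (ν' n : Measure ℝ) {x | ENNReal.ofReal (Real.exp M) ≤ ENNReal.ofReal (Real.exp (s * x))} ≤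
          ENNReal.ofReal (Real.exp 1 * Real.exp (-M)) := by
      intro s hs
      refine (meas_ge_le_lintegral_div (by fun_prop) (by simp [Real.exp_pos]) ENNReal.ofReal_ne_top).trans ?_
      rw [Real.exp_neg, ← div_eq_mul_inv, ENNReal.ofReal_div_of_pos (Real.exp_pos _)]
      gcongr
    calc (ν' n : Measure ℝ) (Set.Icc (-M) M)ᶜ
        ≤ (ν' n : Measure ℝ) ({x | ENNReal.ofReal (Real.exp M) ≤ ENNReal.ofReal (Real.exp (1 * x))}
            ∪ {x | ENNReal.ofReal (Real.exp M) ≤ ENNReal.ofReal (Real.exp (-1 * x))}) := by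
          apply measure_mono
          intro x hx
          simp only [Set.mem_compl_iff, Set.mem_Icc, not_and_or, not_le] at hx
          rcases hx with hx | hx
          · right
            exact ENNReal.ofReal_le_ofReal (Real.exp_le_exp.2 (by linarith))
          · left
            exact ENNReal.ofReal_le_ofReal (Real.exp_le_exp.2 (by linarith))
      _ ≤ ENNReal.ofReal (Real.exp 1 * Real.exp (-M)) + ENNReal.ofReal (Real.exp 1 * Real.exp (-M)) :=
          (measure_union_le _ _).trans (add_le_add (mk 1 (hN' n).1) (mk (-1) (hN' n).2))
      _ = ENNReal.ofReal (2 * Real.exp 1 * Real.exp (-M)) := by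
          rw [← ENNReal.ofReal_add (by positivity) (by positivity)]; congr 1; ring
      _ ≤ ε := hM.le
  refine (Filter.tendsto_iff_ultrafilter _ _ _).2 fun U hU ↦ ?_
  have h_compact : IsCompact (closure (Set.range ν')) :=
    isCompact_closure_of_isTightMeasureSet h_tight
  obtain ⟨μ', -, hμ'⟩ := h_compact.ultrafilter_le_nhds (U.map ν')
    (.trans (by simp) (monotone_principal subset_closure))
  have hμ'' : Tendsto ν' U (𝓝 μ') := hμ'
  have hlimit := mgf_limit U ν' μ' hμ'' (fun t => (hL' t).mono_left hU)
  have heq := mgf_unique μ' hlimit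
  have e : (⟨gaussianReal 0 1, inferInstance⟩ : ProbabilityMeasure ℝ) = μ' := Subtype.ext heq.symm
  rw [e]
  exact hμ''


lemma lintegral_pi_gaussian (m : ℕ) (g : (Fin m → ℝ) → ENNReal) (hg : Measurable g) :
    ∫⁻ x, g x ∂(Measure.pi fun _ : Fin m => gaussianReal 0 1) =
      ∫⁻ x : Fin m → ℝ, (∏ i, gaussianPDF 0 1 (x i)) * g x := by
  induction m with
  | zero =>
    rw [volume_pi]
    rw [Measure.pi_of_empty (fun _ : Fin 0 => gaussianReal 0 1) (fun i => i.elim0),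
      Measure.pi_of_empty (fun _ : Fin 0 => (volume : Measure ℝ)) (fun i => i.elim0)]
    simp
  | succ m ih =>
    rw [volume_pi]
    rw [← ((measurePreserving_piFinSuccAbove (fun _ : Fin (m+1) => gaussianReal 0 1) 0).symm).lintegral_comp_emb
        (MeasurableEquiv.measurableEmbedding _),
      ← ((measurePreserving_piFinSuccAbove (fun _ : Fin (m+1) => (volume : Measure ℝ)) 0).symm).lintegral_comp_emb
        (MeasurableEquiv.measurableEmbedding _)]
    rw [lintegral_prod _ (by fun_prop), lintegral_prod _ (by fun_prop)]
    simp_rw [MeasurableEquiv.piFinSuccAbove_symm_apply, Fin.insertNthEquiv,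
            Fin.prod_univ_succ, Fin.insertNth_zero, Equiv.coe_fn_mk, Fin.cons_succ,
            cast_eq, Fin.cons_zero]
    have hm : Measurable (fun q : ℝ × (Fin m → ℝ) => g (Fin.cons q.1 q.2)) := by
      apply hg.comp
      rw [measurable_pi_iff]
      intro i
      refine Fin.cases ?_ (fun j => ?_) i
      · simp only [Fin.cons_zero]; fun_prop
      · simp only [Fin.cons_succ]; fun_prop
    have h1 : ∀ x : ℝ, ∫⁻ y : Fin m → ℝ, g (Fin.cons x y) ∂(Measure.pi fun _ : Fin m => gaussianReal 0 1)
        = ∫⁻ y : Fin m → ℝ, (∏ i, gaussianPDF 0 1 (y i)) * g (Fin.cons x y) := by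
      intro x
      exact ih _ (hm.comp measurable_prodMk_left)
    have h2 : Measurable (fun x : ℝ => ∫⁻ y : Fin m → ℝ, (∏ i, gaussianPDF 0 1 (y i)) * g (Fin.cons x y)) := by
      apply Measurable.lintegral_prod_right' (f := fun (q : ℝ × (Fin m → ℝ)) => (∏ i, gaussianPDF 0 1 (q.2 i)) * g (Fin.cons q.1 q.2))
      fun_prop
    calc _ = ∫⁻ x : ℝ, (∫⁻ y : Fin m → ℝ, (∏ i, gaussianPDF 0 1 (y i)) * g (Fin.cons x y)) ∂(gaussianReal 0 1) :=
            lintegral_congr fun x => h1 x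
      _ = _ := by
        rw [gaussianReal_of_var_ne_zero _ (by norm_num), lintegral_withDensity_eq_lintegral_mul _ (by fun_prop) h2]
        refine lintegral_congr fun x => ?_
        rw [Pi.mul_apply, ← lintegral_const_mul _ (by fun_prop)]
        simp_rw [mul_assoc]
        rfl

lemma chi_moment (m : ℕ) (hm : 1 ≤ m) (s t : ℝ) (ht : -1 < t) (hs : 0 < (m : ℝ) / 2 + s) :
    ∫⁻ z : Fin m → ℝ, ENNReal.ofReal ((∑ i, z i ^ 2) ^ s * Real.exp (-t / 2 * ∑ i, z i ^ 2))
      ∂(Measure.pi fun _ : Fin m => gaussianReal 0 1) =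
    ENNReal.ofReal ((1 + t) ^ (-((m : ℝ) / 2 + s)) * 2 ^ s *
      (Real.Gamma ((m : ℝ) / 2 + s) / Real.Gamma ((m : ℝ) / 2))) := by
  rw [lintegral_pi_gaussian _ _ (by fun_prop)]
  have : Nonempty (Fin m) := ⟨⟨0, hm⟩⟩
  have hm0 : (0 : ℝ) < m := by exact_mod_cast hm
  set b : ℝ := (1 + t) / 2 with hb
  have hb0 : 0 < b := by rw [hb]; linarith
  set F : ℝ → ℝ := fun r => (√(2 * Real.pi))⁻¹ ^ m * (r ^ (2 * s) * Real.exp (-b * r ^ (2 : ℝ))) with hF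
  have hfun : ∀ x : Fin m → ℝ, (∏ i, gaussianPDF 0 1 (x i)) *
      ENNReal.ofReal ((∑ i, x i ^ 2) ^ s * Real.exp (-t / 2 * ∑ i, x i ^ 2)) =
      ENNReal.ofReal (F ‖WithLp.toLp 2 x‖) := by
    intro x
    have hn : ‖WithLp.toLp 2 x‖ ^ 2 = ∑ i, x i ^ 2 := by
      rw [EuclideanSpace.real_norm_sq_eq]
    have hn0 : 0 ≤ ‖WithLp.toLp 2 x‖ := norm_nonneg _
    simp only [gaussianPDF]
    rw [← ENNReal.ofReal_prod_of_nonneg (fun i _ => gaussianPDFReal_nonneg _ _ _),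
      ← ENNReal.ofReal_mul (Finset.prod_nonneg fun i _ => gaussianPDFReal_nonneg _ _ _)]
    congr 1
    rw [hF]
    simp only [gaussianPDFReal, Finset.prod_mul_distrib, ← Real.exp_sum]
    rw [Real.rpow_mul hn0, Real.rpow_two, hn]
    simp only [Finset.prod_const, Finset.card_univ, Fintype.card_fin, NNReal.coe_one, mul_one, sub_zero,
      ← Finset.sum_div, Finset.sum_neg_distrib]
    rw [mul_assoc]
    congr 1
    rw [mul_left_comm, ← Real.exp_add]
    congr 2
    rw [hb]; ring
  simp_rw [hfun]
  rw [(PiLp.volume_preserving_toLp (Fin m)).lintegral_comp_emb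
    (MeasurableEquiv.toLp 2 (Fin m → ℝ)).measurableEmbedding (f := fun v => ENNReal.ofReal (F ‖v‖))]
  have hdim : Module.finrank ℝ (EuclideanSpace ℝ (Fin m)) = m := by simp
  have hint0 : IntegrableOn (fun r : ℝ => r ^ ((m : ℝ) - 1 + 2 * s) * Real.exp (-b * r ^ (2 : ℝ))) (Set.Ioi 0) volume :=
    integrableOn_rpow_mul_exp_neg_mul_rpow (by linarith) (by norm_num) hb0
  have hcongr : Set.EqOn (fun r : ℝ => r ^ (Module.finrank ℝ (EuclideanSpace ℝ (Fin m)) - 1) • F r)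
      (fun r : ℝ => (√(2 * Real.pi))⁻¹ ^ m * (r ^ ((m : ℝ) - 1 + 2 * s) * Real.exp (-b * r ^ (2 : ℝ)))) (Set.Ioi 0) := by
    intro r hr
    have hr : 0 < r := hr
    simp only [hdim, hF, smul_eq_mul]
    rw [Real.rpow_add hr, show (m : ℝ) - 1 = ((m - 1 : ℕ) : ℝ) by push_cast [hm]; ring, Real.rpow_natCast]
    ring
  have : Nontrivial (EuclideanSpace ℝ (Fin m)) := by
    apply Module.nontrivial_of_finrank_pos (R := ℝ); rw [hdim]; exact hm
  have hint : Integrable (fun v : EuclideanSpace ℝ (Fin m) => F ‖v‖) := by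
    rw [integrable_fun_norm_addHaar]
    exact (IntegrableOn.congr_fun (hint0.const_mul _) hcongr.symm measurableSet_Ioi)
  rw [← ofReal_integral_eq_lintegral_ofReal hint (ae_of_all _ fun v => by rw [hF]; positivity)]
  congr 1
  rw [integral_fun_norm_addHaar, setIntegral_congr_fun measurableSet_Ioi hcongr, hdim, integral_const_mul,
    integral_rpow_mul_exp_neg_mul_rpow (by norm_num) (by linarith) hb0, Measure.real, EuclideanSpace.volume_ball]
  simp only [ENNReal.ofReal_one, one_pow, one_mul, Fintype.card_fin, nsmul_eq_mul, smul_eq_mul]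
  have hG : 0 < Real.Gamma ((m : ℝ) / 2) := Real.Gamma_pos_of_pos (by positivity)
  rw [Real.Gamma_add_one (by positivity), ENNReal.toReal_ofReal (by positivity)]
  rw [show -((m : ℝ) - 1 + 2 * s + 1) / 2 = -((m : ℝ) / 2 + s) by ring,
    show ((m : ℝ) - 1 + 2 * s + 1) / 2 = ((m : ℝ) / 2 + s) by ring]
  rw [hb, Real.div_rpow (by linarith) (by norm_num)]
  have h2 : √(2 * Real.pi) ^ m = 2 ^ ((m : ℝ) / 2) * √Real.pi ^ m := by
    rw [Real.sqrt_mul (by norm_num), mul_pow]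
    congr 1
    rw [Real.sqrt_eq_rpow, ← Real.rpow_natCast, ← Real.rpow_mul (by norm_num)]
    congr 1; ring
  rw [inv_pow, h2, Real.rpow_neg (by norm_num : (0:ℝ) ≤ 2), Real.rpow_add (by norm_num : (0:ℝ) < 2)]
  have hpi : 0 < √Real.pi := Real.sqrt_pos.2 Real.pi_pos
  have h3 : (0 : ℝ) < 2 ^ ((m : ℝ) / 2) := by positivity
  field_simp


lemma exists_adapted_basis {E : Type*} [NormedAddCommGroup E] [InnerProductSpace ℝ E] [FiniteDimensional ℝ E]
    (W : Submodule ℝ E) (k m : ℕ) (hk : Module.finrank ℝ W = k) (hE : Module.finrank ℝ E = k + m) :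
    ∃ b : OrthonormalBasis (Fin k ⊕ Fin m) ℝ E, (∀ i, b (Sum.inl i) ∈ W) ∧ (∀ j, b (Sum.inr j) ∈ Wᗮ) := by
  subst hk
  set bW := stdOrthonormalBasis ℝ W
  obtain ⟨b, hb⟩ := Orthonormal.exists_orthonormalBasis_extension_of_card_eq (𝕜 := ℝ) (E := E)
    (ι := Fin (Module.finrank ℝ W) ⊕ Fin m) (by simp [hE])
    (v := Sum.elim (fun i => (bW i : E)) (fun _ => 0)) (s := Set.range Sum.inl) (by
      have h0 : Orthonormal ℝ (fun i => (bW i : E)) := by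
        have := bW.orthonormal
        rw [orthonormal_iff_ite] at this ⊢
        intro i j
        exact this i j
      rw [orthonormal_iff_ite] at h0 ⊢
      rintro ⟨_, i, rfl⟩ ⟨_, j, rfl⟩
      have := h0 i j
      by_cases hij : i = j
      · subst hij
        simpa [Set.domRestrict] using this
      · rw [if_neg hij] at this
        rw [if_neg (by intro hh; apply hij; simpa using congrArg Subtype.val hh)]
        exact this)
  refine ⟨b, fun i => ?_, fun j => ?_⟩
  · rw [hb _ ⟨i, rfl⟩]; simp
  · rw [Submodule.mem_orthogonal]
    intro w hw
    have hsum := bW.sum_repr ⟨w, hw⟩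
    have hw2 : w = ∑ i, bW.repr ⟨w, hw⟩ i • b (Sum.inl i) := by
      have := congrArg (fun z : W => (z : E)) hsum
      simp only [Submodule.coe_sum, Submodule.coe_smul] at this
      refine this.symm.trans (Finset.sum_congr rfl fun i _ => ?_)
      rw [hb _ ⟨i, rfl⟩]; simp
    rw [hw2, sum_inner]
    refine Finset.sum_eq_zero fun i _ => ?_
    rw [inner_smul_left, b.orthonormal.2 (by simp), mul_zero]

lemma dist_moment {E : Type*} [NormedAddCommGroup E] [InnerProductSpace ℝ E] [FiniteDimensional ℝ E]
    [MeasurableSpace E] [BorelSpace E]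
    (W : Submodule ℝ E) (k m : ℕ) (hk : Module.finrank ℝ W = k) (hE : Module.finrank ℝ E = k + m)
    (Φ : ℝ → ENNReal) (hΦ : Measurable Φ) (t : ℝ) :
    ∫⁻ x, Φ (‖x - W.starProjection x‖ ^ 2) * ENNReal.ofReal (Real.exp (-t / 2 * ‖x‖ ^ 2)) ∂(stdGaussian E) =
      (∫⁻ z : Fin m → ℝ, Φ (∑ i, z i ^ 2) * ENNReal.ofReal (Real.exp (-t / 2 * ∑ i, z i ^ 2))
        ∂(Measure.pi fun _ : Fin m => gaussianReal 0 1)) *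
      (∫⁻ z : Fin k → ℝ, ENNReal.ofReal (Real.exp (-t / 2 * ∑ i, z i ^ 2))
        ∂(Measure.pi fun _ : Fin k => gaussianReal 0 1)) := by
  obtain ⟨b, hb1, hb2⟩ := exists_adapted_basis W k m hk hE
  rw [stdGaussian_eq_map_pi_orthonormalBasis b, lintegral_map (by fun_prop) (by fun_prop)]
  have hnorm : ∀ x : Fin k ⊕ Fin m → ℝ, ‖∑ i, x i • b i‖ ^ 2 = ∑ i, x (Sum.inl i) ^ 2 + ∑ j, x (Sum.inr j) ^ 2 := by
    intro x
    rw [← real_inner_self_eq_norm_sq, b.orthonormal.inner_sum]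
    simp [Fintype.sum_sum_type, sq]
  have hproj : ∀ x : Fin k ⊕ Fin m → ℝ, (∑ i, x i • b i) - W.starProjection (∑ i, x i • b i) =
      ∑ i, (Sum.elim (fun _ => 0) (fun j => x (Sum.inr j)) i : ℝ) • b i := by
    intro x
    rw [Fintype.sum_sum_type, Fintype.sum_sum_type]
    rw [map_add, Submodule.starProjection_eq_self_iff.2 (W.sum_mem fun i _ => W.smul_mem _ (hb1 i)),
      (Submodule.starProjection_apply_eq_zero_iff W).2 (Submodule.sum_mem _ fun i _ => Submodule.smul_mem _ _ (hb2 i))]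
    simp
  simp_rw [hproj, hnorm]
  rw [← (measurePreserving_sumPiEquivProdPi_symm (fun _ : Fin k ⊕ Fin m => gaussianReal 0 1)).lintegral_comp_emb
    (MeasurableEquiv.measurableEmbedding _)]
  simp only [MeasurableEquiv.coe_sumPiEquivProdPi_symm, Equiv.sumPiEquivProdPi_symm_apply, Sum.elim_inl, Sum.elim_inr]
  have hsplit : ∀ a : (Fin k → ℝ) × (Fin m → ℝ),
      Φ (∑ i : Fin k, (0:ℝ) ^ 2 + ∑ j, a.2 j ^ 2) *
        ENNReal.ofReal (Real.exp (-t / 2 * (∑ i, a.1 i ^ 2 + ∑ j, a.2 j ^ 2))) =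
      (ENNReal.ofReal (Real.exp (-t / 2 * ∑ i, a.1 i ^ 2))) *
        (Φ (∑ j, a.2 j ^ 2) * ENNReal.ofReal (Real.exp (-t / 2 * ∑ j, a.2 j ^ 2))) := by
    intro a
    rw [mul_add, Real.exp_add, ENNReal.ofReal_mul (Real.exp_pos _).le]
    simp
    ring
  simp_rw [hsplit]
  rw [lintegral_prod_mul (f := fun y : Fin k → ℝ => ENNReal.ofReal (Real.exp (-t / 2 * ∑ i, y i ^ 2)))
    (g := fun z : Fin m → ℝ => Φ (∑ j, z j ^ 2) * ENNReal.ofReal (Real.exp (-t / 2 * ∑ j, z j ^ 2)))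
    (Measurable.aemeasurable (by fun_prop)) (Measurable.aemeasurable (by fun_prop)), mul_comm]

lemma gram_step {E : Type*} [NormedAddCommGroup E] [InnerProductSpace ℝ E] [FiniteDimensional ℝ E]
    {ι : Type} [Fintype ι] [DecidableEq ι] (u : ι → E) (x : E) :
    (gram ℝ (Sum.elim u (fun _ : Unit => x))).det = (gram ℝ u).det *
      ‖x - (Submodule.span ℝ (Set.range u)).starProjection x‖ ^ 2 := by
  set W := Submodule.span ℝ (Set.range u) with hW
  set w := x - W.starProjection x with hw
  have hmem : W.starProjection x ∈ W := Submodule.starProjection_apply_mem W x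
  obtain ⟨c, hc⟩ := (Submodule.mem_span_range_iff_exists_fun ℝ).1 hmem
  have hx : x = ∑ i, c i • u i + w := by rw [hc, hw]; abel
  have hwW : ∀ i, inner ℝ (u i) w = 0 := by
    intro i
    have : w ∈ Wᗮ := W.sub_starProjection_mem_orthogonal x
    exact (Submodule.mem_orthogonal _ _).1 this _ (Submodule.subset_span ⟨i, rfl⟩)
  have hwW' : ∀ i, inner ℝ w (u i) = 0 := fun i => by rw [real_inner_comm]; exact hwW i
  have hfac : gram ℝ (Sum.elim u (fun _ : Unit => x)) =
      fromBlocks 1 0 (Matrix.of fun _ : Unit => c) 1 * fromBlocks (gram ℝ u) 0 0 (Matrix.of fun _ _ : Unit => ‖w‖ ^ 2)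
        * fromBlocks 1 (Matrix.of fun i (_ : Unit) => c i) 0 1 := by
    rw [fromBlocks_multiply, fromBlocks_multiply]
    ext i j
    have h1 : ∀ i, inner ℝ (u i) x = ∑ j, inner ℝ (u i) (u j) * c j := by
      intro i
      rw [hx, inner_add_right, hwW, inner_sum]
      simp [inner_smul_right, mul_comm]
    have h2 : ∀ i, inner ℝ x (u i) = ∑ j, c j * inner ℝ (u j) (u i) := by
      intro i
      rw [hx, inner_add_left, hwW', sum_inner]
      simp [inner_smul_left]
    have h3 : inner ℝ x x = ∑ j, inner ℝ x (u j) * c j + ‖w‖ ^ 2 := by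
      conv_lhs => rw [hx]
      rw [inner_add_right, inner_sum]
      have : inner ℝ (∑ i, c i • u i + w) w = ‖w‖ ^ 2 := by
        rw [inner_add_left, sum_inner]; simp [inner_smul_left, hwW]
      rw [this, ← hx]
      simp [inner_smul_right, mul_comm]
    rcases i with i | i <;> rcases j with j | j
    · simp [gram_apply]
    · simp [gram_apply, Matrix.mul_apply, h1]
    · simp [gram_apply, Matrix.mul_apply, h2]
    · simp only [gram_apply, Sum.elim_inr, fromBlocks_apply₂₂, Matrix.add_apply, h3, h2]
      simp [Matrix.mul_apply, gram_apply]
  rw [hfac, det_mul, det_mul, det_fromBlocks_zero₁₂, det_fromBlocks_zero₁₂, det_fromBlocks_zero₂₁]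
  simp

/-- one-column factor -/
noncomputable def colFactor (n : ℕ) (Φ : ℝ → ENNReal) (t : ℝ) (k : ℕ) : ENNReal :=
  (∫⁻ z : Fin (n - k) → ℝ, Φ (∑ i, z i ^ 2) * ENNReal.ofReal (Real.exp (-t / 2 * ∑ i, z i ^ 2))
        ∂(Measure.pi fun _ : Fin (n - k) => gaussianReal 0 1)) *
      (∫⁻ z : Fin k → ℝ, ENNReal.ofReal (Real.exp (-t / 2 * ∑ i, z i ^ 2))
        ∂(Measure.pi fun _ : Fin k => gaussianReal 0 1))

lemma measurable_det_gram {n : ℕ} {ι α : Type} [Fintype ι] [DecidableEq ι] [MeasurableSpace α]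
    (f : α → ι → EuclideanSpace ℝ (Fin n)) (hf : ∀ i, Measurable fun a => f a i) :
    Measurable fun a => (gram ℝ (f a)).det := by
  simp only [Matrix.det_apply, gram_apply]
  fun_prop

set_option maxHeartbeats 1000000 in
lemma gram_rec (n : ℕ) (Φ : ℝ → ENNReal) (hΦ : Measurable Φ) (hΦ0 : Φ 0 = 0)
    (hmul : ∀ a b : ℝ, 0 ≤ a → 0 ≤ b → Φ (a * b) = Φ a * Φ b) (t : ℝ) (p : ℕ) :
    ∀ (ι : Type) [Fintype ι] [DecidableEq ι] (u : ι → EuclideanSpace ℝ (Fin n)), Fintype.card ι + p ≤ n →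
    ∫⁻ X : Fin p → EuclideanSpace ℝ (Fin n), Φ ((gram ℝ (Sum.elim u X)).det) *
        ∏ j, ENNReal.ofReal (Real.exp (-t / 2 * ‖X j‖ ^ 2)) ∂(Measure.pi fun _ => stdGaussian _) =
      Φ (gram ℝ u).det * ∏ j ∈ Finset.range p, colFactor n Φ t (Fintype.card ι + j) := by
  induction p with
  | zero =>
    intro ι _ _ u hcard
    rw [Measure.pi_of_empty (fun _ : Fin 0 => stdGaussian (EuclideanSpace ℝ (Fin n))) (fun i => i.elim0)]
    rw [lintegral_dirac]
    have : gram ℝ u = (gram ℝ (Sum.elim u (fun i : Fin 0 => (i.elim0 : EuclideanSpace ℝ (Fin n))))).submatrix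
        (Equiv.sumEmpty ι (Fin 0)).symm (Equiv.sumEmpty ι (Fin 0)).symm := by
      ext i j; simp [gram_apply]
    rw [this, det_submatrix_equiv_self]
    simp
  | succ p ih =>
    intro ι _ _ u hcard
    have hpos : 0 ≤ (gram ℝ u).det := (posSemidef_gram ℝ u).det_nonneg
    rw [← ((measurePreserving_piFinSuccAbove (fun _ : Fin (p+1) => stdGaussian (EuclideanSpace ℝ (Fin n))) 0).symm).lintegral_comp_emb
        (MeasurableEquiv.measurableEmbedding _)]
    simp_rw [MeasurableEquiv.piFinSuccAbove_symm_apply, Fin.insertNthEquiv,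
            Fin.prod_univ_succ, Fin.insertNth_zero, Equiv.coe_fn_mk, Fin.cons_succ,
            cast_eq, Fin.cons_zero]
    let e : (ι ⊕ Unit) ⊕ Fin p ≃ ι ⊕ Fin (p + 1) :=
      { toFun := Sum.elim (Sum.elim Sum.inl (fun _ => Sum.inr 0)) (fun j => Sum.inr j.succ)
        invFun := Sum.elim (fun i => Sum.inl (Sum.inl i)) (Fin.cases (Sum.inl (Sum.inr ())) (fun j => Sum.inr j))
        left_inv := by rintro ((i | i) | j) <;> simp
        right_inv := by
          rintro (i | j)
          · simp
          · refine Fin.cases ?_ (fun j => ?_) j <;> simp }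
    have hre : ∀ (x : EuclideanSpace ℝ (Fin n)) (X : Fin p → EuclideanSpace ℝ (Fin n)),
        (gram ℝ (Sum.elim u (Fin.cons x X : Fin (p+1) → EuclideanSpace ℝ (Fin n)))).det =
        (gram ℝ (Sum.elim (Sum.elim u (fun _ : Unit => x)) X)).det := by
      intro x X
      rw [← det_submatrix_equiv_self e]
      congr 1
      ext i j
      have : ∀ i, (Sum.elim u (Fin.cons x X : Fin (p+1) → EuclideanSpace ℝ (Fin n))) (e i) =
          Sum.elim (Sum.elim u (fun _ : Unit => x)) X i := by
        rintro ((i | i) | j) <;> simp [e]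
      simp only [submatrix_apply, gram_apply, this]
    simp_rw [hre]
    have hmeas : Measurable fun q : EuclideanSpace ℝ (Fin n) × (Fin p → EuclideanSpace ℝ (Fin n)) =>
        Φ ((gram ℝ (Sum.elim (Sum.elim u (fun _ : Unit => q.1)) q.2)).det) := by
      apply hΦ.comp
      apply measurable_det_gram
      rintro ((i | i) | j) <;> simp <;> fun_prop
    have hmeas2 : Measurable fun q : EuclideanSpace ℝ (Fin n) × (Fin p → EuclideanSpace ℝ (Fin n)) =>
        (ENNReal.ofReal (Real.exp (-t / 2 * ‖q.1‖ ^ 2)) *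
            ∏ j, ENNReal.ofReal (Real.exp (-t / 2 * ‖q.2 j‖ ^ 2))) := by fun_prop
    refine (lintegral_prod _ (hmeas.mul hmeas2).aemeasurable).trans ?_
    have hinner : ∀ x : EuclideanSpace ℝ (Fin n),
        ∫⁻ X : Fin p → EuclideanSpace ℝ (Fin n), Φ ((gram ℝ (Sum.elim (Sum.elim u (fun _ : Unit => x)) X)).det) *
          (ENNReal.ofReal (Real.exp (-t / 2 * ‖x‖ ^ 2)) *
            ∏ j, ENNReal.ofReal (Real.exp (-t / 2 * ‖X j‖ ^ 2))) ∂(Measure.pi fun _ => stdGaussian _) =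
        (Φ ((gram ℝ u).det) * ∏ j ∈ Finset.range p, colFactor n Φ t (Fintype.card ι + 1 + j)) *
         (Φ (‖x - (Submodule.span ℝ (Set.range u)).starProjection x‖ ^ 2) *
          ENNReal.ofReal (Real.exp (-t / 2 * ‖x‖ ^ 2))) := by
      intro x
      have h := ih (ι ⊕ Unit) (Sum.elim u (fun _ : Unit => x)) (by simp; omega)
      rw [gram_step, hmul _ _ hpos (by positivity)] at h
      simp_rw [mul_left_comm _ (ENNReal.ofReal (Real.exp (-t / 2 * ‖x‖ ^ 2))) _]
      have hm1 : Measurable fun X : Fin p → EuclideanSpace ℝ (Fin n) =>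
          Φ ((gram ℝ (Sum.elim (Sum.elim u (fun _ : Unit => x)) X)).det) := by
        apply hΦ.comp
        apply measurable_det_gram
        rintro ((i | i) | j) <;> simp <;> fun_prop
      have hm2 : Measurable fun X : Fin p → EuclideanSpace ℝ (Fin n) =>
          ∏ j, ENNReal.ofReal (Real.exp (-t / 2 * ‖X j‖ ^ 2)) := by fun_prop
      have hm3 := hm1.mul hm2
      refine (lintegral_const_mul _ hm3).trans ?_
      refine (congrArg _ h).trans ?_
      simp only [Fintype.card_sum, Fintype.card_unit]
      ring
    refine (lintegral_congr hinner).trans ?_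
    rw [lintegral_const_mul _ (by fun_prop)]
    by_cases hdet : (gram ℝ u).det = 0
    · simp [hdet, hΦ0]
    · have hli := linearIndependent_of_det_gram_ne_zero hdet
      rw [dist_moment _ (Fintype.card ι) (n - Fintype.card ι) (finrank_span_eq_card hli) (by simp; omega) Φ hΦ t]
      rw [Finset.prod_range_succ', mul_assoc]
      congr 2
      refine Finset.prod_congr rfl fun j _ => ?_
      congr 1; ring


lemma transfer_map (n p : ℕ) :
    (Measure.pi fun _ : Fin n × Fin p => gaussianReal 0 1).map
      (fun ω (c : Fin p) => (WithLp.toLp 2 (fun i : Fin n => ω (i, c)) : EuclideanSpace ℝ (Fin n))) =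
    Measure.pi fun _ : Fin p => stdGaussian (EuclideanSpace ℝ (Fin n)) := by
  have h1 := (measurePreserving_piCongrLeft (fun _ : Fin p × Fin n => gaussianReal 0 1)
    (Equiv.prodComm (Fin n) (Fin p))).map_eq
  have h2 := Measure.infinitePi_map_curry (fun (_ : Fin p) (_ : Fin n) => gaussianReal 0 1)
  simp_rw [Measure.infinitePi_eq_pi] at h2
  have h3 := Measure.pi_map_pi (μ := fun _ : Fin p => Measure.pi fun _ : Fin n => gaussianReal 0 1)
    (f := fun _ => (WithLp.toLp 2 : (Fin n → ℝ) → EuclideanSpace ℝ (Fin n)))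
    (hμ := fun i => by rw [map_pi_eq_stdGaussian]; infer_instance) (fun _ => by fun_prop)
  simp_rw [map_pi_eq_stdGaussian] at h3
  rw [← h3, ← h2, ← h1, Measure.map_map (by fun_prop) (by fun_prop), Measure.map_map (by fun_prop) (by fun_prop)]
  congr 1

noncomputable def scatterA (n p : ℕ) (ω : Fin n × Fin p → ℝ) : Matrix (Fin p) (Fin p) ℝ :=
  ∑ i, Matrix.vecMulVec (fun c => ω (i, c) - (∑ i, ω (i, c)) / n) (fun c => ω (i, c) - (∑ i, ω (i, c)) / n)

lemma scatterA_apply (n p : ℕ) (hn : 0 < n) (ω : Fin n × Fin p → ℝ) (c d : Fin p) :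
    scatterA n p ω c d = ∑ i, ω (i, c) * ω (i, d) - (∑ i, ω (i, c)) * (∑ i, ω (i, d)) / n := by
  have hn' : (n : ℝ) ≠ 0 := by positivity
  simp only [scatterA, Matrix.sum_apply, vecMulVec_apply]
  set a := ∑ i, ω (i, c)
  set b := ∑ i, ω (i, d)
  have : ∀ i, (ω (i, c) - a / n) * (ω (i, d) - b / n) =
    ω (i, c) * ω (i, d) - ω (i, c) * (b / n) - (a / n) * ω (i, d) + (a / n) * (b / n) := fun i => by ring
  simp_rw [this, Finset.sum_add_distrib, Finset.sum_sub_distrib, ← Finset.mul_sum, ← Finset.sum_mul]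
  simp
  field_simp
  ring

noncomputable def onesV (n : ℕ) : Unit → EuclideanSpace ℝ (Fin n) := fun _ => WithLp.toLp 2 (fun _ => 1)

lemma gram_ones (n : ℕ) : (gram ℝ (onesV n)).det = n := by
  simp [onesV, gram_apply, EuclideanSpace.norm_sq_eq]

lemma gram_scatter (n p : ℕ) (hn : 0 < n) (ω : Fin n × Fin p → ℝ) :
    (gram ℝ (Sum.elim (onesV n) (fun c : Fin p => (WithLp.toLp 2 (fun i : Fin n => ω (i, c)) : EuclideanSpace ℝ (Fin n))))).det
      = n * (scatterA n p ω).det := by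
  have hn' : (n : ℝ) ≠ 0 := by positivity
  set D : Matrix (Fin p) (Fin p) ℝ := Matrix.of fun c d => ∑ i, ω (i, c) * ω (i, d)
  have hfac : gram ℝ (Sum.elim (onesV n) (fun c : Fin p => (WithLp.toLp 2 (fun i : Fin n => ω (i, c)) : EuclideanSpace ℝ (Fin n))))
    = fromBlocks (Matrix.of fun _ _ : Unit => (n : ℝ)) 0 (Matrix.of fun c (_ : Unit) => ∑ i, ω (i, c)) 1 *
      fromBlocks 1 (Matrix.of fun (_ : Unit) c => (∑ i, ω (i, c)) / n) 0 (scatterA n p ω) := by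
    rw [fromBlocks_multiply]
    ext i j
    rcases i with i | i <;> rcases j with j | j
    · simp [gram_apply, onesV, EuclideanSpace.norm_sq_eq]
    · simp [gram_apply, onesV, PiLp.inner_apply, Matrix.mul_apply]
      field_simp
    · simp [gram_apply, onesV, PiLp.inner_apply, Matrix.mul_apply]
    · simp [gram_apply, PiLp.inner_apply, Matrix.mul_apply, scatterA_apply n p hn]
      ring_nf
      simp [mul_comm]
  rw [hfac, det_mul, det_fromBlocks_zero₁₂, det_fromBlocks_zero₂₁]
  simp

lemma trace_scatter (n p : ℕ) (hn : 0 < n) (ω : Fin n × Fin p → ℝ) :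
    (scatterA n p ω).trace + n * ∑ c, ((∑ i, ω (i, c)) / n) ^ 2 = ∑ c, ∑ i, ω (i, c) ^ 2 := by
  have hn' : (n : ℝ) ≠ 0 := by positivity
  simp only [Matrix.trace, diag_apply, scatterA_apply n p hn]
  rw [Finset.mul_sum, ← Finset.sum_add_distrib]
  refine Finset.sum_congr rfl fun c _ => ?_
  simp_rw [← sq]
  field_simp
  ring

lemma scatter_nonneg (n p : ℕ) (hn : 0 < n) (ω : Fin n × Fin p → ℝ) : 0 ≤ (scatterA n p ω).det := by
  have := (posSemidef_gram ℝ (Sum.elim (onesV n) (fun c : Fin p => (WithLp.toLp 2 (fun i : Fin n => ω (i, c)) : EuclideanSpace ℝ (Fin n))))).det_nonneg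
  rw [gram_scatter n p hn] at this
  exact nonneg_of_mul_nonneg_right this (by positivity)

lemma scatter_moment (n p : ℕ) (hn : 1 + p ≤ n) (Φ : ℝ → ENNReal) (hΦ : Measurable Φ) (hΦ0 : Φ 0 = 0)
    (hmul : ∀ a b : ℝ, 0 ≤ a → 0 ≤ b → Φ (a * b) = Φ a * Φ b) (h0 : Φ n ≠ 0) (h1 : Φ n ≠ ⊤) (t : ℝ) :
    ∫⁻ ω, Φ (scatterA n p ω).det * ENNReal.ofReal (Real.exp (-t / 2 * ∑ c, ∑ i, ω (i, c) ^ 2))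
      ∂(Measure.pi fun _ : Fin n × Fin p => gaussianReal 0 1) =
    ∏ j ∈ Finset.range p, colFactor n Φ t (1 + j) := by
  have hn0 : 0 < n := by omega
  have key := gram_rec n Φ hΦ hΦ0 hmul t p Unit (onesV n) (by simpa using hn)
  have hm1 : Measurable fun X : Fin p → EuclideanSpace ℝ (Fin n) =>
      Φ ((gram ℝ (Sum.elim (onesV n) X)).det) := by
    apply hΦ.comp
    apply measurable_det_gram
    rintro (i | j) <;> simp <;> fun_prop
  have hm2 : Measurable fun X : Fin p → EuclideanSpace ℝ (Fin n) =>
      ∏ j, ENNReal.ofReal (Real.exp (-t / 2 * ‖X j‖ ^ 2)) := by fun_prop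
  rw [← transfer_map] at key
  have key2 := (lintegral_map (hm1.mul hm2) (by fun_prop)).symm.trans key
  simp only [Pi.mul_apply, gram_scatter n p hn0, gram_ones, EuclideanSpace.norm_sq_eq, Fintype.card_unit] at key2
  have hpt : ∀ ω : Fin n × Fin p → ℝ, Φ (n * (scatterA n p ω).det) *
      ∏ c, ENNReal.ofReal (Real.exp (-t / 2 * ∑ i, ‖ω (i, c)‖ ^ 2)) =
      Φ n * (Φ (scatterA n p ω).det * ENNReal.ofReal (Real.exp (-t / 2 * ∑ c, ∑ i, ω (i, c) ^ 2))) := by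
    intro ω
    rw [hmul _ _ (by positivity) (scatter_nonneg n p hn0 ω), ← ENNReal.ofReal_prod_of_nonneg (fun _ _ => (Real.exp_pos _).le),
      ← Real.exp_sum, ← Finset.mul_sum, mul_assoc]
    simp
  simp_rw [hpt] at key2
  rw [lintegral_const_mul' _ _ h1] at key2
  exact (ENNReal.mul_right_inj h0 h1).1 key2

lemma measurable_scatter (n p : ℕ) (hn0 : 0 < n) :
    Measurable fun ω : Fin n × Fin p → ℝ => (scatterA n p ω).det := by
  have := measurable_det_gram (n := n) (fun ω : Fin n × Fin p → ℝ => (Sum.elim (onesV n) (fun c : Fin p => (WithLp.toLp 2 (fun i : Fin n => ω (i, c)) : EuclideanSpace ℝ (Fin n))))) (by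
    rintro (i | j) <;> simp <;> fun_prop)
  simp_rw [gram_scatter n p hn0] at this
  have h2 := this.const_mul ((n : ℝ)⁻¹)
  have hn' : (n : ℝ) ≠ 0 := by positivity
  simpa [← mul_assoc, inv_mul_cancel₀ hn'] using h2

lemma scatter_pos (n p : ℕ) (hn : 1 + p ≤ n) :
    ∀ᵐ ω ∂(Measure.pi fun _ : Fin n × Fin p => gaussianReal 0 1), 0 < (scatterA n p ω).det := by
  have hn0 : 0 < n := by omega
  set Φ : ℝ → ENNReal := Set.indicator (Set.Ioi 0) 1 with hΦdef
  have hval : ∀ x, 0 < x → Φ x = 1 := fun x hx => by simp [hΦdef, hx]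
  have hΦ : Measurable Φ := measurable_one.indicator measurableSet_Ioi
  have key := scatter_moment n p hn Φ hΦ (by simp [hΦdef]) (by
    intro a b ha hb
    rcases ha.eq_or_lt with rfl | ha
    · simp [hΦdef]
    rcases hb.eq_or_lt with rfl | hb
    · simp [hΦdef]
    rw [hval _ ha, hval _ hb, hval _ (by positivity), mul_one]) (by rw [hval _ (by positivity)]; simp)
    (by rw [hval _ (by positivity)]; simp) 0
  have hcol : ∀ j ∈ Finset.range p, colFactor n Φ 0 (1 + j) = 1 := by
    intro j hj
    have hj' := Finset.mem_range.1 hj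
    have hpos : 0 < n - (1 + j) := by omega
    unfold colFactor
    have hae : ∀ᵐ z ∂(Measure.pi fun _ : Fin (n - (1 + j)) => gaussianReal 0 1), Φ (∑ i, z i ^ 2) * ENNReal.ofReal (Real.exp (-0 / 2 * ∑ i, z i ^ 2)) = 1 := by
      have : ∀ᵐ z ∂(Measure.pi fun _ : Fin (n - (1 + j)) => gaussianReal 0 1), z ≠ 0 := by
        have : Nonempty (Fin (n - (1+j))) := ⟨⟨0, hpos⟩⟩
        have : NullSingletonClass (gaussianReal 0 1) := nullSingletonClass_gaussianReal (by simp)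
        exact (measure_eq_zero_iff_ae_notMem.1 (measure_singleton 0))
      filter_upwards [this] with z hz
      rw [hval]
      · simp
      · have : ∃ i, z i ≠ 0 := Function.ne_iff.1 hz
        obtain ⟨i, hi⟩ := this
        exact lt_of_lt_of_le (by positivity) (Finset.single_le_sum (f := fun i => z i ^ 2) (fun _ _ => by positivity) (Finset.mem_univ i))
    rw [lintegral_congr_ae hae]
    simp
  rw [Finset.prod_eq_one hcol] at key
  have hms : MeasurableSet {ω : Fin n × Fin p → ℝ | 0 < (scatterA n p ω).det} := measurableSet_lt measurable_const (measurable_scatter n p hn0)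
  have hind : ∀ ω : Fin n × Fin p → ℝ, Φ (scatterA n p ω).det *
      ENNReal.ofReal (Real.exp (-0 / 2 * ∑ c, ∑ i, ω (i, c) ^ 2)) =
      Set.indicator {ω : Fin n × Fin p → ℝ | 0 < (scatterA n p ω).det} 1 ω := by
    intro ω
    simp [hΦdef, Set.indicator]
  simp_rw [hind] at key
  rw [lintegral_indicator_one hms] at key
  exact (mem_ae_iff_prob_eq_one hms).2 key


lemma logStat_eq (n p : ℕ) (hn : 0 < n) (ω : Fin n × Fin p → ℝ) (hdet : 0 < (scatterA n p ω).det) :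
    logSpecifiedStat n p ω = (n : ℝ) * p / 2 * (1 - Real.log n) + (n : ℝ) / 2 * Real.log (scatterA n p ω).det
      - 1 / 2 * ∑ c, ∑ i, ω (i, c) ^ 2 := by
  have hn' : (0 : ℝ) < n := by positivity
  have h0 : logSpecifiedStat n p ω = Real.log ((Real.exp 1 / n) ^ ((n : ℝ) * p / 2) * (scatterA n p ω).det ^ ((n : ℝ) / 2)
    * Real.exp (-(scatterA n p ω).trace / 2) * Real.exp (-(n : ℝ) * (∑ c, ((∑ i, ω (i, c)) / n) ^ 2) / 2)) := rfl
  have hE : (0 : ℝ) < Real.exp 1 / n := by positivity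
  rw [h0, ← trace_scatter n p hn, Real.log_mul (by positivity) (by positivity), Real.log_mul (by positivity) (by positivity),
    Real.log_mul (by positivity) (by positivity), Real.log_rpow hE, Real.log_rpow hdet, Real.log_exp, Real.log_exp,
    Real.log_div (by positivity) (by positivity), Real.log_exp]
  ring

lemma measurable_logStat (n p : ℕ) (hn : 0 < n) : Measurable (logSpecifiedStat n p) := by
  have h0 : logSpecifiedStat n p = fun ω => Real.log ((Real.exp 1 / n) ^ ((n : ℝ) * p / 2) * (scatterA n p ω).det ^ ((n : ℝ) / 2)
    * Real.exp (-(scatterA n p ω).trace / 2) * Real.exp (-(n : ℝ) * (∑ c, ((∑ i, ω (i, c)) / n) ^ 2) / 2)) := rfl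
  have h1 := measurable_scatter n p hn
  have h2 : Measurable fun ω : Fin n × Fin p → ℝ => (scatterA n p ω).trace := by
    simp only [Matrix.trace, diag_apply, scatterA_apply n p hn]
    fun_prop
  rw [h0]
  fun_prop

lemma stat_mgf (n p : ℕ) (hn : 1 + p ≤ n) (s : ℝ) (hs0 : s ≠ 0) (hs1 : -1 < s)
    (hs2 : ∀ j : ℕ, j < p → 0 < ((n : ℝ) - (1 + j)) / 2 + n * s / 2) :
    ∫⁻ ω, ENNReal.ofReal (Real.exp (s * logSpecifiedStat n p ω))
      ∂(Measure.pi fun _ : Fin n × Fin p => gaussianReal 0 1) =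
    ENNReal.ofReal (Real.exp (s * ((n : ℝ) * p / 2 * (1 - Real.log n))) *
      ∏ j ∈ Finset.range p, ((1 + s) ^ (-((n : ℝ) / 2 + n * s / 2)) * 2 ^ ((n : ℝ) * s / 2) *
        (Real.Gamma (((n : ℝ) - (1 + j)) / 2 + n * s / 2) / Real.Gamma (((n : ℝ) - (1 + j)) / 2)))) := by
  have hn0 : 0 < n := by omega
  have hn' : (0 : ℝ) < n := by positivity
  set h : ℝ := (n : ℝ) * s / 2 with hh
  have hne : h ≠ 0 := by rw [hh]; positivity
  set Φ : ℝ → ENNReal := fun x => ENNReal.ofReal (x ^ h) with hΦ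
  have key := scatter_moment n p hn Φ (by fun_prop) (by simp [hΦ, Real.zero_rpow hne]) (by
    intro a b ha hb
    simp only [hΦ]
    rw [Real.mul_rpow ha hb, ENNReal.ofReal_mul (by positivity)]) (by simp only [hΦ]; simp; positivity)
    (by simp [hΦ]) s
  have hpt : ∀ᵐ ω ∂(Measure.pi fun _ : Fin n × Fin p => gaussianReal 0 1),
      ENNReal.ofReal (Real.exp (s * logSpecifiedStat n p ω)) =
      ENNReal.ofReal (Real.exp (s * ((n : ℝ) * p / 2 * (1 - Real.log n)))) *
       (Φ (scatterA n p ω).det * ENNReal.ofReal (Real.exp (-s / 2 * ∑ c, ∑ i, ω (i, c) ^ 2))) := by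
    filter_upwards [scatter_pos n p hn] with ω hω
    rw [logStat_eq n p hn0 ω hω]
    simp only [hΦ]
    rw [← ENNReal.ofReal_mul (by positivity), ← ENNReal.ofReal_mul (by positivity), Real.rpow_def_of_pos hω,
      ← Real.exp_add, ← Real.exp_add]
    congr 2
    rw [hh]; ring
  rw [lintegral_congr_ae hpt, lintegral_const_mul' _ _ ENNReal.ofReal_ne_top, key]
  have hs1' : 0 < 1 + s := by linarith
  have hGam : ∀ j ∈ Finset.range p, 0 ≤ (1 + s) ^ (-((n : ℝ) / 2 + h)) * 2 ^ h *
        (Real.Gamma (((n : ℝ) - (1 + j)) / 2 + h) / Real.Gamma (((n : ℝ) - (1 + j)) / 2)) := by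
    intro j hj
    have hj' := Finset.mem_range.1 hj
    have h1 := Real.Gamma_pos_of_pos (hs2 j hj')
    have h3 : (1 : ℝ) + j < n := by exact_mod_cast (by omega : 1 + j < n)
    have h2 : 0 < Real.Gamma (((n : ℝ) - (1 + j)) / 2) := Real.Gamma_pos_of_pos (by linarith)
    positivity
  rw [ENNReal.ofReal_mul (by positivity), ENNReal.ofReal_prod_of_nonneg hGam]
  congr 1
  refine Finset.prod_congr rfl fun j hj => ?_
  have hj' := Finset.mem_range.1 hj
  have hcast : ((n - (1 + j) : ℕ) : ℝ) = (n : ℝ) - (1 + j) := by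
    rw [Nat.cast_sub (by omega)]; push_cast; ring
  unfold colFactor
  have c1 := chi_moment (n - (1 + j)) (by omega) h s hs1 (by rw [hcast]; exact hs2 j hj')
  have c2 := chi_moment (1 + j) (by omega) 0 s hs1 (by positivity)
  have e1 : ∀ z : Fin (n - (1 + j)) → ℝ, Φ (∑ i, z i ^ 2) * ENNReal.ofReal (Real.exp (-s / 2 * ∑ i, z i ^ 2)) =
      ENNReal.ofReal ((∑ i, z i^2)^h * Real.exp (-s/2 * ∑ i, z i^2)) := by
    intro z
    simp only [hΦ]
    rw [ENNReal.ofReal_mul (Real.rpow_nonneg (Finset.sum_nonneg fun _ _ => by positivity) _)]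
  simp_rw [e1]
  rw [c1]
  simp only [Real.rpow_zero, one_mul, add_zero, mul_one] at c2
  rw [c2, div_self (Real.Gamma_pos_of_pos (by positivity)).ne', mul_one, hcast]
  rw [mul_comm, ← ENNReal.ofReal_mul (by positivity)]
  congr 1
  rw [← mul_assoc, ← mul_assoc, ← Real.rpow_add hs1']
  congr 3
  push_cast; ring


lemma log_two (x : ℝ) (h1 : -(1/2) ≤ x) (h2 : x ≤ 1) :
    |Real.log (1 + x) - x + x ^ 2 / 2| ≤ 5 * |x| ^ 3 := by
  rcases le_or_gt x (1/2) with h | h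
  · have hx : |x| ≤ 1/2 := abs_le.2 ⟨by linarith, h⟩
    have := Real.abs_log_sub_add_sum_range_le (x := -x) (by rw [abs_neg]; linarith) 2
    rw [abs_neg] at this
    simp only [Finset.sum_range_succ, Finset.sum_range_zero, sub_neg_eq_add] at this
    norm_num at this
    have e : Real.log (1 + x) - x + x ^ 2 / 2 = -x + x ^ 2 / 2 + Real.log (1 + x) := by ring
    rw [e]
    refine this.trans ?_
    rw [div_le_iff₀ (by linarith)]
    have : 0 ≤ |x| ^ 3 := by positivity
    nlinarith
  · have h3 : 0 ≤ Real.log (1 + x) := Real.log_nonneg (by linarith)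
    have h4 : Real.log (1 + x) ≤ x := by have := Real.log_le_sub_one_of_pos (x := 1 + x) (by linarith); linarith
    rw [abs_of_pos (by linarith : 0 < x), abs_le]
    have : x ≤ 4 * x ^ 3 := by nlinarith [mul_nonneg (by linarith : (0:ℝ) ≤ x) (by nlinarith : 0 ≤ 4 * x ^ 2 - 1)]
    constructor <;> nlinarith

lemma log_one' (x : ℝ) (h1 : |x| ≤ 1/2) : |Real.log (1 + x) - x| ≤ 2 * x ^ 2 := by
  have := Real.abs_log_sub_add_sum_range_le (x := -x) (by rw [abs_neg]; linarith) 1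
  rw [abs_neg] at this
  simp at this
  have e : Real.log (1 + x) - x = -x + Real.log (1 + x) := by ring
  rw [e]
  refine this.trans ?_
  rw [div_le_iff₀ (by linarith)]
  nlinarith [sq_nonneg x]

noncomputable def Gd (h a : ℝ) : ℝ :=
  Real.log (Real.Gamma (a + h)) - Real.log (Real.Gamma a) - h * Real.log a - (h ^ 2 - h) / (2 * a)

lemma Gd_step (h a : ℝ) (ha : 1 ≤ a) (hh : |h| ≤ a / 2) :
    |Gd h (a + 1) - Gd h a| ≤ 7 * (|h| + |h| ^ 3) * (2 / a ^ 2 - 2 / (a + 1) ^ 2) := by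
  have ha0 : 0 < a := by linarith
  have hah : 0 < a + h := by have := (abs_le.1 hh).1; linarith
  have e : Gd h (a + 1) - Gd h a = Real.log (1 + h / a) - h * Real.log (1 + 1 / a) + (h ^ 2 - h) / (2 * a * (a + 1)) := by
    unfold Gd
    rw [show a + 1 + h = (a + h) + 1 by ring, Real.Gamma_add_one hah.ne', Real.Gamma_add_one ha0.ne',
      Real.log_mul hah.ne' (Real.Gamma_pos_of_pos hah).ne', Real.log_mul ha0.ne' (Real.Gamma_pos_of_pos ha0).ne',
      show 1 + h / a = (a + h) / a by field_simp, show 1 + 1 / a = (a + 1) / a by field_simp,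
      Real.log_div hah.ne' ha0.ne', Real.log_div (by positivity) ha0.ne']
    field_simp
    ring
  have b1 := log_two (h / a) (by rw [le_div_iff₀ ha0]; have := (abs_le.1 hh).1; linarith) (by
    rw [div_le_one ha0]; have := (abs_le.1 hh).2; linarith)
  have b2 := log_two (1 / a) (by have : 0 < 1 / a := by positivity
                                 linarith) (by rw [div_le_one ha0]; exact ha)
  have b2' : |h * (Real.log (1 + 1 / a) - 1 / a + (1 / a) ^ 2 / 2)| ≤ |h| * (5 * |1 / a| ^ 3) := by
    rw [abs_mul]; gcongr
  have b3 : |(h ^ 2 - h) / (2 * a ^ 2 * (a + 1))| ≤ (|h| + |h| ^ 3) / a ^ 3 := by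
    rw [abs_div, abs_of_pos (by positivity : 0 < 2 * a ^ 2 * (a + 1)), div_le_div_iff₀ (by positivity) (by positivity)]
    have n1 : |h ^ 2 - h| ≤ |h| ^ 2 + |h| := (abs_sub _ _).trans (by rw [abs_pow])
    have n2 : |h| ^ 2 ≤ |h| + |h| ^ 3 := by nlinarith [abs_nonneg h, mul_nonneg (abs_nonneg h) (sq_nonneg (|h| - 1))]
    have n3 : |h ^ 2 - h| ≤ 2 * (|h| + |h| ^ 3) := by have : 0 ≤ |h| ^ 3 := by positivity
                                                      linarith
    calc |h ^ 2 - h| * a ^ 3 ≤ 2 * (|h| + |h| ^ 3) * a ^ 3 := by gcongr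
      _ ≤ (|h| + |h| ^ 3) * (2 * a ^ 2 * (a + 1)) := by
        have : 0 ≤ (|h| + |h| ^ 3) * (2 * a ^ 2) := by positivity
        nlinarith
  have e2 : Gd h (a + 1) - Gd h a = (Real.log (1 + h / a) - h / a + (h / a) ^ 2 / 2)
      - h * (Real.log (1 + 1 / a) - 1 / a + (1 / a) ^ 2 / 2) - (h ^ 2 - h) / (2 * a ^ 2 * (a + 1)) := by
    rw [e]; field_simp; ring
  have hV : 1 / a ^ 3 ≤ 2 / a ^ 2 - 2 / (a + 1) ^ 2 := by
    rw [div_sub_div _ _ (by positivity) (by positivity), div_le_div_iff₀ (by positivity) (by positivity)]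
    have : 0 ≤ a ^ 2 := by positivity
    nlinarith [mul_nonneg this (by nlinarith : 0 ≤ 3 * a ^ 2 - 1)]
  calc |Gd h (a + 1) - Gd h a| ≤ 5 * |h / a| ^ 3 + |h| * (5 * |1 / a| ^ 3) + (|h| + |h| ^ 3) / a ^ 3 := by
        rw [e2]
        exact (abs_sub _ _).trans (add_le_add ((abs_sub _ _).trans (add_le_add b1 b2')) b3)
    _ ≤ 7 * (|h| + |h| ^ 3) * (1 / a ^ 3) := by
        rw [abs_div, abs_div, abs_one, abs_of_pos ha0, div_pow, div_pow, one_pow]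
        have : 0 ≤ (|h| + |h| ^ 3) * (1 / a ^ 3) := by positivity
        have e3 : 5 * (|h| ^ 3 / a ^ 3) + |h| * (5 * (1 / a ^ 3)) + (|h| + |h| ^ 3) / a ^ 3 =
          6 * ((|h| + |h| ^ 3) * (1 / a ^ 3)) := by ring
        rw [e3]; linarith
    _ ≤ _ := by gcongr

lemma Gd_tele (h a : ℝ) (ha : 1 ≤ a) (hh : |h| ≤ a / 2) (N : ℕ) :
    |Gd h (a + N) - Gd h a| ≤ 7 * (|h| + |h| ^ 3) * (2 / a ^ 2 - 2 / (a + N) ^ 2) := by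
  induction N with
  | zero => simp
  | succ N ih =>
    have hN : (0 : ℝ) ≤ N := by positivity
    have := Gd_step h (a + N) (by linarith) (by linarith)
    push_cast
    rw [← add_assoc]
    have h3 := abs_sub_le (Gd h (a + N + 1)) (Gd h (a + N)) (Gd h a)
    linarith

lemma Gd_tendsto (h a : ℝ) (ha : 1 ≤ a) (hh : |h| ≤ a / 2) :
    Tendsto (fun N : ℕ => Gd h (a + (N + 1 : ℕ))) atTop (𝓝 0) := by
  have ha0 : 0 < a := by linarith
  have hah : 0 < a + h := by have := (abs_le.1 hh).1; linarith
  have key : ∀ x : ℝ, 0 < x → ∀ N : ℕ, Real.log (Real.Gamma (x + (N + 1 : ℕ))) =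
      Real.log (Real.Gamma x) + ∑ m ∈ Finset.range (N + 1), Real.log (x + m) := by
    intro x hx N
    induction (N + 1) with
    | zero => simp
    | succ k ih =>
      have : 0 < x + k := by positivity
      rw [Finset.sum_range_succ, ← add_assoc, ← ih]
      push_cast
      rw [← add_assoc, Real.Gamma_add_one this.ne', Real.log_mul this.ne' (Real.Gamma_pos_of_pos this).ne']
      ring
  have t1 := Real.BohrMollerup.tendsto_log_gamma hah
  have t2 := Real.BohrMollerup.tendsto_log_gamma ha0
  have t3 : Tendsto (fun N : ℕ => Real.log (a + (N + 1 : ℕ)) - Real.log N) atTop (𝓝 0) := by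
    have : Tendsto (fun N : ℕ => Real.log (1 + (a + 1) / (N : ℝ))) atTop (𝓝 0) := by
      have h0 : Tendsto (fun N : ℕ => 1 + (a + 1) / (N : ℝ)) atTop (𝓝 (1 + 0)) :=
        (tendsto_const_div_atTop_nhds_zero_nat (a + 1)).const_add 1
      have := (Real.continuousAt_log (by norm_num : (1 + 0 : ℝ) ≠ 0)).tendsto.comp h0
      simpa [Function.comp_def] using this
    refine this.congr' ?_
    filter_upwards [eventually_gt_atTop 0] with N hN
    have : (0 : ℝ) < N := by positivity
    rw [← Real.log_div (by positivity) (by positivity)]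
    congr 1
    push_cast; field_simp; ring
  have t4 : Tendsto (fun N : ℕ => (h ^ 2 - h) / (2 * (a + (N + 1 : ℕ)))) atTop (𝓝 0) := by
    refine Tendsto.const_div_atTop ?_ _
    refine Tendsto.const_mul_atTop (by norm_num) ?_
    refine tendsto_atTop_add_const_left _ _ ?_
    exact tendsto_natCast_atTop_atTop.comp (tendsto_add_atTop_nat 1)
  have tt := (((t2.sub t1).add_const (Real.log (Real.Gamma (a + h)) - Real.log (Real.Gamma a))).sub (t3.const_mul h)).sub t4
  refine (tt.congr fun N => ?_).trans_eq (by congr 1; ring)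
  unfold Gd
  rw [show a + ((N + 1 : ℕ) : ℝ) + h = (a + h) + (N + 1 : ℕ) by ring, key _ hah, key _ ha0]
  unfold Real.BohrMollerup.logGammaSeq
  ring

lemma Gd_bound (h a : ℝ) (ha : 1 ≤ a) (hh : |h| ≤ a / 2) : |Gd h a| ≤ 14 * (|h| + |h| ^ 3) / a ^ 2 := by
  have h1 : Tendsto (fun N : ℕ => |Gd h (a + (N + 1 : ℕ)) - Gd h a|) atTop (𝓝 |0 - Gd h a|) :=
    ((Gd_tendsto h a ha hh).sub_const _).abs
  rw [zero_sub, abs_neg] at h1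
  refine le_of_tendsto' h1 fun N => (Gd_tele h a ha hh _).trans ?_
  have : (0 : ℝ) ≤ 2 / (a + (N + 1 : ℕ)) ^ 2 := by positivity
  have h2 : 0 ≤ 7 * (|h| + |h| ^ 3) := by positivity
  calc _ ≤ 7 * (|h| + |h| ^ 3) * (2 / a ^ 2) := by gcongr; linarith
    _ = _ := by ring


lemma sum_tele (f F : ℕ → ℝ) (c : ℝ) (hc : 0 ≤ c)
    (hf : ∀ k : ℕ, 1 ≤ k → |f (k + 1) - (F (k + 1) - F k)| ≤ c * (1 / (k : ℝ) - 1 / ((k : ℝ) + 1))) (q : ℕ) (hq : 1 ≤ q) (p : ℕ) :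
    |∑ i ∈ Finset.range p, f (q + i + 1) - (F (q + p) - F q)| ≤ c / q := by
  have main : |∑ i ∈ Finset.range p, f (q + i + 1) - (F (q + p) - F q)| ≤ c * (1 / (q : ℝ) - 1 / ((q : ℝ) + p)) := by
    induction p with
    | zero => simp
    | succ p ih =>
      have h1 := hf (q + p) (by omega)
      rw [Finset.sum_range_succ]
      push_cast at h1 ⊢
      rw [← add_assoc] at *
      have e : ∑ i ∈ Finset.range p, f (q + i + 1) + f (q + p + 1) - (F (q + p + 1) - F q) =
        (∑ i ∈ Finset.range p, f (q + i + 1) - (F (q + p) - F q)) + (f (q + p + 1) - (F (q + p + 1) - F (q + p))) := by ring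
      rw [e]
      refine (abs_add_le _ _).trans ((add_le_add ih h1).trans (le_of_eq ?_))
      ring
  refine main.trans ?_
  have : (0 : ℝ) ≤ 1 / ((q : ℝ) + p) := by positivity
  calc _ ≤ c * (1 / (q : ℝ)) := by gcongr; linarith
    _ = _ := by ring

lemma inv_sq_tele (k : ℕ) (hk : 1 ≤ k) : (1 / ((k : ℝ) + 1)) ^ 2 ≤ 1 / (k : ℝ) - 1 / ((k : ℝ) + 1) := by
  have : (1 : ℝ) ≤ k := by exact_mod_cast hk
  rw [div_sub_div _ _ (by positivity) (by positivity), div_pow, div_le_div_iff₀ (by positivity) (by positivity)]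
  nlinarith

lemma log_pred (k : ℕ) (hk : 1 ≤ k) : Real.log (k : ℝ) - Real.log ((k : ℝ) + 1) = Real.log (1 + -(1 / ((k : ℝ) + 1))) := by
  have : (1 : ℝ) ≤ k := by exact_mod_cast hk
  rw [← Real.log_div (by positivity) (by positivity)]
  congr 1; field_simp; ring

lemma sum_inv_bound (q p : ℕ) (hq : 1 ≤ q) :
    |∑ i ∈ Finset.range p, 1 / ((q + i + 1 : ℕ) : ℝ) - (Real.log ((q + p : ℕ) : ℝ) - Real.log (q : ℝ))| ≤ 2 / q := by
  refine sum_tele (fun k => 1 / (k : ℝ)) (fun k => Real.log k) 2 (by norm_num) (fun k hk => ?_) q hq p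
  have hk' : (1 : ℝ) ≤ k := by exact_mod_cast hk
  have hx : 1 / ((k : ℝ) + 1) ≤ 1 / 2 := by gcongr; linarith
  have hx0 : 0 < 1 / ((k : ℝ) + 1) := by positivity
  have h1 := log_one' (-(1 / ((k : ℝ) + 1))) (by rw [abs_neg, abs_of_pos hx0]; exact hx)
  rw [← log_pred k hk] at h1
  have h2 := inv_sq_tele k hk
  push_cast
  have e : 1 / ((k : ℝ) + 1) - (Real.log ((k : ℝ) + 1) - Real.log k) =
    Real.log (k : ℝ) - Real.log ((k : ℝ) + 1) - -(1 / ((k : ℝ) + 1)) := by ring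
  rw [e]
  refine h1.trans ?_
  rw [neg_sq]; linarith

lemma sum_log_bound (q p : ℕ) (hq : 1 ≤ q) :
    |∑ i ∈ Finset.range p, Real.log ((q + i + 1 : ℕ) : ℝ) - (((((q + p : ℕ) : ℝ) + 1/2) * Real.log ((q + p : ℕ) : ℝ) - ((q + p : ℕ) : ℝ))
      - (((q : ℝ) + 1/2) * Real.log (q : ℝ) - (q : ℝ)))| ≤ 6 / q := by
  refine sum_tele (fun k => Real.log (k : ℝ)) (fun k => ((k : ℝ) + 1/2) * Real.log k - k) 6 (by norm_num) (fun k hk => ?_) q hq p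
  have hk' : (1 : ℝ) ≤ k := by exact_mod_cast hk
  have hx : 1 / ((k : ℝ) + 1) ≤ 1 / 2 := by gcongr; linarith
  have hx0 : 0 < 1 / ((k : ℝ) + 1) := by positivity
  have h1 := log_two (-(1 / ((k : ℝ) + 1))) (by linarith) (by linarith)
  rw [← log_pred k hk, abs_neg, abs_of_pos hx0] at h1
  have h2 := inv_sq_tele k hk
  push_cast
  set x := 1 / ((k : ℝ) + 1) with hxdef
  have hkx : ((k : ℝ) + 1) * x = 1 := by rw [hxdef]; field_simp
  set e := Real.log (k : ℝ) - Real.log ((k : ℝ) + 1) - -x + (-x) ^ 2 / 2 with he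
  have id : Real.log ((k : ℝ) + 1) - (((k : ℝ) + 1 + 1 / 2) * Real.log ((k : ℝ) + 1) - ((k : ℝ) + 1) - (((k : ℝ) + 1 / 2) * Real.log k - k))
      = x ^ 2 / 4 + ((k : ℝ) + 1/2) * e := by
    have : (k : ℝ) = 1 / x - 1 := by rw [hxdef]; field_simp; ring
    have hl : Real.log (k : ℝ) = e + Real.log ((k : ℝ) + 1) - x - x ^ 2 / 2 := by rw [he]; ring
    rw [hl]
    generalize Real.log ((k : ℝ) + 1) = l
    rw [this]
    field_simp
    ring
  rw [id]
  have : |((k : ℝ) + 1/2) * e| ≤ ((k : ℝ) + 1) * (5 * x ^ 3) := by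
    rw [abs_mul, abs_of_pos (by positivity)]
    gcongr; norm_num
  have h5 : ((k : ℝ) + 1) * (5 * x ^ 3) = 5 * x ^ 2 := by
    calc _ = (((k : ℝ) + 1) * x) * (5 * x ^ 2) := by ring
      _ = _ := by rw [hkx]; ring
  have h6 := abs_add_le (x ^ 2 / 4) (((k : ℝ) + 1/2) * e)
  rw [abs_of_nonneg (by positivity : 0 ≤ x ^ 2 / 4)] at h6
  nlinarith [sq_nonneg x]

lemma sum_sq_bound (q p : ℕ) (hq : 1 ≤ q) :
    ∑ i ∈ Finset.range p, (1 / ((q + i + 1 : ℕ) : ℝ)) ^ 2 ≤ 1 / (q : ℝ) := by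
  have := sum_tele (fun k => (1 / (k : ℝ)) ^ 2) (fun _ => 0) 1 (by norm_num) (fun k hk => ?_) q hq p
  · have h2 := (abs_le.1 this).2
    simpa using h2
  · have h2 := inv_sq_tele k hk
    push_cast
    rw [sub_zero, sub_zero, abs_of_nonneg (by positivity)]
    linarith

lemma xlogx_bound (s : ℝ) (hs : |s| ≤ 1 / 2) :
    |(1 + s) * Real.log (1 + s) - s - s ^ 2 / 2| ≤ 8 * |s| ^ 3 := by
  have hs' := abs_le.1 hs
  have h1 := log_two s hs'.1 (by linarith)
  set e := Real.log (1 + s) - s + s ^ 2 / 2 with he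
  have id : (1 + s) * Real.log (1 + s) - s - s ^ 2 / 2 = -(s ^ 3) / 2 + (1 + s) * e := by rw [he]; ring
  rw [id]
  refine (abs_add_le _ _).trans ?_
  rw [abs_mul, abs_div, abs_neg, abs_pow, abs_two, abs_of_pos (by linarith : 0 < 1 + s)]
  have h3 : (1 + s) * |e| ≤ (3 / 2) * (5 * |s| ^ 3) := by gcongr; linarith
  linarith

noncomputable def Lfun (q p : ℕ) (h : ℝ) : ℝ :=
  h * p * (1 - Real.log ((q : ℝ) + p + 1)) +
  ∑ i ∈ Finset.range p, (-(((q : ℝ) + p + 1) / 2 + h) * Real.log (1 + 2 * h / ((q : ℝ) + p + 1)) + h * Real.log 2 +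
    (Real.log (Real.Gamma (((q + i + 1 : ℕ) : ℝ) / 2 + h)) - Real.log (Real.Gamma (((q + i + 1 : ℕ) : ℝ) / 2)))) +
  h * (((q : ℝ) - 1 / 2) * (Real.log q - Real.log ((q + p : ℕ) : ℝ)) + p + p / ((q : ℝ) + p + 1))

lemma Lfun_bound (q p : ℕ) (hq : 1 ≤ q) (h : ℝ) (hh : |h| ≤ ((q : ℝ) + 1) / 4) :
    |Lfun q p h - h ^ 2 * (-(Real.log q - Real.log ((q + p : ℕ) : ℝ)) - p / ((q + p : ℕ) : ℝ))| ≤ 101 * (|h| + |h| ^ 3) / q := by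
  have hq' : (1 : ℝ) ≤ q := by exact_mod_cast hq
  have hp' : (0 : ℝ) ≤ p := by positivity
  set n : ℝ := (q : ℝ) + p + 1 with hn
  have hn0 : 0 < n := by rw [hn]; positivity
  set s : ℝ := 2 * h / n with hs
  set H : ℝ := |h| + |h| ^ 3 with hH
  have hH0 : 0 ≤ H := by rw [hH]; positivity
  have hhH : |h| ≤ H := by rw [hH]; have : 0 ≤ |h| ^ 3 := by positivity
                           linarith
  have hh3 : |h| ^ 3 ≤ H := by rw [hH]; have := abs_nonneg h; linarith
  have hh2 : h ^ 2 ≤ H := by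
    rw [hH, ← sq_abs]; nlinarith [abs_nonneg h, mul_nonneg (abs_nonneg h) (sq_nonneg (|h| - 1))]
  have hqn : 1 / n ≤ 1 / (q : ℝ) := by gcongr; rw [hn]; linarith
  have hpn : p / n ≤ 1 := by rw [div_le_one hn0, hn]; linarith
  have hpn0 : 0 ≤ p / n := by positivity
  have hss : |s| ≤ 1 / 2 := by
    rw [hs, abs_div, abs_mul, abs_two, abs_of_pos hn0, div_le_iff₀ hn0, hn]; linarith
  set e1 := ∑ i ∈ Finset.range p, Gd h (((q + i + 1 : ℕ) : ℝ) / 2) with he1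
  set S1 := ∑ i ∈ Finset.range p, Real.log ((q + i + 1 : ℕ) : ℝ) with hS1
  set S2 := ∑ i ∈ Finset.range p, 1 / ((q + i + 1 : ℕ) : ℝ) with hS2
  have b2 := sum_log_bound q p hq
  have b3 := sum_inv_bound q p hq
  have b4 := xlogx_bound s hss
  rw [← hS1] at b2
  rw [← hS2] at b3
  set m : ℝ := ((q + p : ℕ) : ℝ) with hm
  have hmqp : m = (q : ℝ) + p := by rw [hm]; push_cast; ring
  have hm0 : 0 < m := by rw [hmqp]; positivity
  set e2 := S1 - ((m + 1 / 2) * Real.log m - m - (((q : ℝ) + 1 / 2) * Real.log q - q)) with he2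
  set e3 := S2 - (Real.log m - Real.log q) with he3
  set e4 := (1 + s) * Real.log (1 + s) - s - s ^ 2 / 2 with he4
  set e5 := (p : ℝ) * (1 / n - Real.log n + Real.log m) with he5
  set e6 := (p : ℝ) / m - p / n with he6
  have b1 : |e1| ≤ 56 * H / q := by
    calc |e1| ≤ ∑ i ∈ Finset.range p, |Gd h (((q + i + 1 : ℕ) : ℝ) / 2)| := Finset.abs_sum_le_sum_abs _ _
      _ ≤ ∑ i ∈ Finset.range p, 56 * H * (1 / ((q + i + 1 : ℕ) : ℝ)) ^ 2 := by
        refine Finset.sum_le_sum fun i _ => ?_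
        have hk : (q : ℝ) + 1 ≤ ((q + i + 1 : ℕ) : ℝ) := by push_cast; have : (0 : ℝ) ≤ i := by positivity
                                                            linarith
        refine (Gd_bound h _ (by linarith) (by linarith)).trans (le_of_eq ?_)
        have : ((q + i + 1 : ℕ) : ℝ) ≠ 0 := by positivity
        rw [hH]; field_simp; ring
      _ ≤ 56 * H * (1 / q) := by
        rw [← Finset.mul_sum]
        have := sum_sq_bound q p hq
        gcongr
      _ = _ := by ring
  have b5 : |e5| ≤ 2 / q := by
    have hnm : Real.log m - Real.log n = Real.log (1 + -(1 / n)) := by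
      rw [← Real.log_div hm0.ne' hn0.ne']
      congr 1
      have : n = m + 1 := by rw [hn, hmqp]
      field_simp; linarith
    have hn2 : 1 / n ≤ 1 / 2 := by gcongr; rw [hn]; linarith
    have hn3 : 0 < 1 / n := by positivity
    have h1 := log_one' (-(1 / n)) (by rw [abs_neg, abs_of_pos hn3]; exact hn2)
    rw [← hnm] at h1
    rw [he5, abs_mul, abs_of_nonneg hp']
    have e : 1 / n - Real.log n + Real.log m = Real.log m - Real.log n - -(1 / n) := by ring
    rw [e]
    calc _ ≤ (p : ℝ) * (2 * (-(1 / n)) ^ 2) := by gcongr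
      _ = 2 * (p / n) * (1 / n) := by ring
      _ ≤ 2 * 1 * (1 / q) := by gcongr
      _ = _ := by ring
  have b6 : |e6| ≤ 1 / q := by
    have h1 : e6 = (p / m) * (1 / n) := by
      have : n = m + 1 := by rw [hn, hmqp]
      rw [he6]; field_simp; rw [this]; ring
    have : p / m ≤ 1 := by rw [div_le_one hm0, hmqp]; linarith
    rw [h1, abs_of_nonneg (by positivity)]
    calc _ ≤ 1 * (1 / (q : ℝ)) := by gcongr
      _ = _ := by ring
  have b4' : |p * n / 2 * e4| ≤ 32 * H / q := by
    rw [abs_mul, abs_of_nonneg (by positivity)]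
    calc _ ≤ p * n / 2 * (8 * |s| ^ 3) := by gcongr
      _ = 32 * |h| ^ 3 * (p / n) * (1 / n) := by
        rw [hs, abs_div, abs_mul, abs_two, abs_of_pos hn0]; field_simp; ring
      _ ≤ 32 * H * 1 * (1 / q) := by gcongr
      _ = _ := by ring
  have hid : Lfun q p h - h ^ 2 * (-(Real.log q - Real.log m) - p / m) =
      e1 + h * e2 + (h ^ 2 - h) * e3 - p * n / 2 * e4 + h * e5 + h ^ 2 * e6 := by
    have hsum : ∑ i ∈ Finset.range p, (-(n / 2 + h) * Real.log (1 + s) + h * Real.log 2 +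
        (Real.log (Real.Gamma (((q + i + 1 : ℕ) : ℝ) / 2 + h)) - Real.log (Real.Gamma (((q + i + 1 : ℕ) : ℝ) / 2)))) =
        - p * (n / 2 + h) * Real.log (1 + s) + e1 + h * S1 + (h ^ 2 - h) * S2 := by
      have : ∀ i ∈ Finset.range p, (-(n / 2 + h) * Real.log (1 + s) + h * Real.log 2 +
        (Real.log (Real.Gamma (((q + i + 1 : ℕ) : ℝ) / 2 + h)) - Real.log (Real.Gamma (((q + i + 1 : ℕ) : ℝ) / 2)))) =
        -(n / 2 + h) * Real.log (1 + s) + Gd h (((q + i + 1 : ℕ) : ℝ) / 2) + h * Real.log ((q + i + 1 : ℕ) : ℝ)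
          + (h ^ 2 - h) * (1 / ((q + i + 1 : ℕ) : ℝ)) := by
        intro i _
        unfold Gd
        have h0 : ((q + i + 1 : ℕ) : ℝ) ≠ 0 := by positivity
        rw [Real.log_div h0 (by norm_num)]
        field_simp
        ring
      rw [Finset.sum_congr rfl this]
      simp_rw [Finset.sum_add_distrib, ← Finset.mul_sum]
      rw [← he1, ← hS1, ← hS2]
      simp
      ring
    unfold Lfun
    rw [← hm, ← hn, ← hs, hsum, he2, he3, he4, he5, he6]
    have hh' : h = n * s / 2 := by rw [hs]; field_simp
    have hmn : m = n - 1 := by rw [hmqp, hn]; ring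
    have hqn : (q : ℝ) = n - 1 - p := by rw [hn]; ring
    generalize Real.log (1 + s) = l1
    generalize Real.log m = lm
    generalize Real.log n = ln
    generalize Real.log q = lq
    clear_value n m s e1 S1 S2
    have hn1 : n - 1 ≠ 0 := by rw [← hmn]; positivity
    rw [hqn, hmn, hh']
    field_simp
    ring
  rw [hid]
  have c2 : |h * e2| ≤ 6 * H / q := by
    rw [abs_mul]
    calc _ ≤ H * (6 / q) := by gcongr
      _ = _ := by ring
  have c3 : |(h ^ 2 - h) * e3| ≤ 4 * H / q := by
    have : |h ^ 2 - h| ≤ 2 * H := (abs_sub _ _).trans (by rw [abs_of_nonneg (sq_nonneg h)]; linarith)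
    rw [abs_mul]
    calc _ ≤ 2 * H * (2 / q) := by gcongr
      _ = _ := by ring
  have c5 : |h * e5| ≤ 2 * H / q := by
    rw [abs_mul]
    calc _ ≤ H * (2 / q) := by gcongr
      _ = _ := by ring
  have c6 : |h ^ 2 * e6| ≤ H / q := by
    rw [abs_mul, abs_of_nonneg (sq_nonneg h)]
    calc _ ≤ H * (1 / q) := by gcongr
      _ = _ := by ring
  have tri : |e1 + h * e2 + (h ^ 2 - h) * e3 - p * n / 2 * e4 + h * e5 + h ^ 2 * e6| ≤
     |e1| + |h * e2| + |(h ^ 2 - h) * e3| + |p * n / 2 * e4| + |h * e5| + |h ^ 2 * e6| := by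
    refine (abs_add_le _ _).trans (add_le_add ?_ le_rfl)
    refine (abs_add_le _ _).trans (add_le_add ?_ le_rfl)
    refine (abs_sub _ _).trans (add_le_add ?_ le_rfl)
    refine (abs_add_le _ _).trans (add_le_add ?_ le_rfl)
    exact abs_add_le _ _
  refine tri.trans ?_
  have e : 101 * H / q = 56 * H / q + 6 * H / q + 4 * H / q + 32 * H / q + 2 * H / q + H / q := by ring
  rw [e]
  linarith


lemma log_lower (x : ℝ) (h0 : 0 < x) (h1 : x < 1) : x ^ 2 / 2 ≤ -(x + Real.log (1 - x)) := by
  have h := Real.hasSum_pow_div_log_of_abs_lt_one (x := x) (by rw [abs_of_pos h0]; exact h1)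
  have := sum_le_hasSum (Finset.range 2) (fun i _ => by positivity) h
  norm_num [Finset.sum_range_succ] at this
  linarith

lemma prod_eq (q p : ℕ) (hq : 1 ≤ q) (h n s : ℝ) (hn : n = (q : ℝ) + p + 1) (hs : s = 2 * h / n)
    (hh : |h| ≤ ((q : ℝ) + 1) / 4) :
    ∏ j ∈ Finset.range p, ((1 + s) ^ (-(n / 2 + n * s / 2)) * 2 ^ (n * s / 2) *
        (Real.Gamma ((n - (1 + j)) / 2 + n * s / 2) / Real.Gamma ((n - (1 + j)) / 2))) =
    Real.exp (∑ i ∈ Finset.range p, (-(n / 2 + h) * Real.log (1 + 2 * h / n) + h * Real.log 2 +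
    (Real.log (Real.Gamma (((q + i + 1 : ℕ) : ℝ) / 2 + h)) - Real.log (Real.Gamma (((q + i + 1 : ℕ) : ℝ) / 2))))) := by
  have hq' : (1 : ℝ) ≤ q := by exact_mod_cast hq
  have hn0 : 0 < n := by rw [hn]; positivity
  have hns : n * s / 2 = h := by rw [hs]; field_simp
  have h1 : 0 < 1 + s := by
    have : -1 < s := by
      rw [hs, lt_div_iff₀ hn0]
      have := (abs_le.1 hh).1
      have : (0 : ℝ) ≤ p := by positivity
      rw [hn]; linarith
    linarith
  rw [Real.exp_sum, ← Finset.prod_range_reflect]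
  refine Finset.prod_congr rfl fun i hi => ?_
  have hi' := Finset.mem_range.1 hi
  have hk : n - (1 + ((p - 1 - i : ℕ) : ℝ)) = ((q + i + 1 : ℕ) : ℝ) := by
    rw [Nat.sub_sub, Nat.cast_sub (by omega), hn]; push_cast; ring
  have hk0 : (q : ℝ) + 1 ≤ ((q + i + 1 : ℕ) : ℝ) := by
    push_cast; have : (0 : ℝ) ≤ i := by positivity
    linarith
  have g1 : 0 < Real.Gamma (((q + i + 1 : ℕ) : ℝ) / 2 + h) :=
    Real.Gamma_pos_of_pos (by have := (abs_le.1 hh).1; linarith)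
  have g2 : 0 < Real.Gamma (((q + i + 1 : ℕ) : ℝ) / 2) := Real.Gamma_pos_of_pos (by linarith)
  rw [hk, hns, ← hs, Real.exp_add, Real.exp_add, Real.exp_sub, Real.exp_log g1, Real.exp_log g2,
    Real.rpow_def_of_pos h1, Real.rpow_def_of_pos (by norm_num : (0 : ℝ) < 2)]
  congr 3 <;> ring_nf

lemma stat_mgf_L (n p q : ℕ) (hq : 1 ≤ q) (hnq : n = q + p + 1) (t μ σ : ℝ) (hσ : 0 < σ) (ht : t ≠ 0)
    (hμ : μ = -(1 / 4) * ((n : ℝ) * (2 * (n : ℝ) - 2 * p - 3) * (Real.log q - Real.log ((q + p : ℕ) : ℝ))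
        + 2 * ((n : ℝ) + 1) * p)) (hh : |t / (2 * σ)| ≤ ((q : ℝ) + 1) / 4) :
    ∫⁻ ω, ENNReal.ofReal (Real.exp (t * ((logSpecifiedStat n p ω - μ) / ((n : ℝ) * σ))))
      ∂(Measure.pi fun _ : Fin n × Fin p => gaussianReal 0 1) =
    ENNReal.ofReal (Real.exp (Lfun q p (t / (2 * σ)))) := by
  have hq' : (1 : ℝ) ≤ q := by exact_mod_cast hq
  have hp' : (0 : ℝ) ≤ p := by positivity
  have hn : (n : ℝ) = (q : ℝ) + p + 1 := by rw [hnq]; push_cast; ring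
  have hn0 : (0 : ℝ) < n := by rw [hn]; positivity
  set h := t / (2 * σ) with hdef
  set s : ℝ := 2 * h / n with hs
  have hns : (n : ℝ) * s / 2 = h := by rw [hs]; field_simp
  have hsne : s ≠ 0 := by rw [hs, hdef]; positivity
  have hlow := (abs_le.1 hh).1
  have hs1 : -1 < s := by
    rw [hs, lt_div_iff₀ hn0, hn]; linarith
  have hpt : ∀ ω, ENNReal.ofReal (Real.exp (t * ((logSpecifiedStat n p ω - μ) / ((n : ℝ) * σ)))) =
      ENNReal.ofReal (Real.exp (-s * μ)) * ENNReal.ofReal (Real.exp (s * logSpecifiedStat n p ω)) := by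
    intro ω
    rw [← ENNReal.ofReal_mul (Real.exp_pos _).le, ← Real.exp_add]
    congr 2
    rw [hs, hdef]; field_simp; ring
  simp_rw [hpt]
  rw [lintegral_const_mul' _ _ ENNReal.ofReal_ne_top, stat_mgf n p (by omega) s hsne hs1 ?_,
    prod_eq q p hq h n s hn hs hh, ← ENNReal.ofReal_mul (Real.exp_pos _).le, ← Real.exp_add, ← Real.exp_add]
  · congr 2
    unfold Lfun
    rw [← hn, hμ, show (q : ℝ) = n - p - 1 by rw [hn]; ring, hs]
    generalize ∑ i ∈ Finset.range p, (_ : ℝ) = S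
    field_simp
    ring
  · intro j hj
    have hj' : (j : ℝ) + 1 ≤ p := by exact_mod_cast hj
    rw [hns, hn]; linarith

lemma sig_facts (p q : ℕ → ℕ) (hq : ∀ n, 3 ≤ n → 1 ≤ q n ∧ n = q n + p n + 1) (hp : ∀ n, 3 ≤ n → 0 < p n)
    (y : ℝ) (hy : 0 < y) (hlim : Tendsto (fun n => (p n : ℝ) / n) atTop (𝓝 y)) (σsq : ℕ → ℝ)
    (hσ : ∀ n, 3 ≤ n → σsq n = -(1 / 2) *
      ((p n : ℝ) / ((n : ℝ) - 1) + Real.log (1 - (p n : ℝ) / ((n : ℝ) - 1))))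
    (hσ2 : ∀ n, 3 ≤ n → σsq n = 1 / 2 * (-(Real.log (q n) - Real.log ((q n + p n : ℕ) : ℝ)) - p n / ((q n + p n : ℕ) : ℝ))) :
    (∀ n, 3 ≤ n → 0 < σsq n) ∧ (∀ᶠ n in atTop, y ^ 2 / 16 ≤ σsq n) ∧
      Tendsto (fun n => Real.sqrt (σsq n) * q n) atTop atTop := by
  have low : ∀ n, 3 ≤ n → 0 < (p n : ℝ) / ((n : ℝ) - 1) ∧ ((p n : ℝ) / ((n : ℝ) - 1)) ^ 2 / 4 ≤ σsq n := by
    intro n hn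
    obtain ⟨h1, h2⟩ := hq n hn
    have h3 := hp n hn
    have e : (n : ℝ) - 1 = (q n : ℝ) + p n := by
      have : (n : ℝ) = (q n : ℝ) + p n + 1 := by exact_mod_cast h2
      linarith
    have h1' : (1 : ℝ) ≤ q n := by exact_mod_cast h1
    have h3' : (0 : ℝ) < p n := by exact_mod_cast h3
    have hpos : 0 < (p n : ℝ) / ((n : ℝ) - 1) := by rw [e]; positivity
    refine ⟨hpos, ?_⟩
    rw [hσ n hn]
    have := log_lower _ hpos (by rw [e, div_lt_one (by positivity)]; linarith)
    linarith
  have hb : ∀ᶠ n in atTop, y ^ 2 / 16 ≤ σsq n := by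
    filter_upwards [hlim.eventually (lt_mem_nhds (by linarith : y / 2 < y)), eventually_ge_atTop 3] with n h1 hn
    have h2 := (low n hn).2
    have hn' : (3 : ℝ) ≤ n := by exact_mod_cast hn
    have h3 : (p n : ℝ) / n ≤ (p n : ℝ) / ((n : ℝ) - 1) := by
      apply div_le_div_of_nonneg_left (by positivity) (by linarith) (by linarith)
    have h4 : (y / 2) ^ 2 ≤ ((p n : ℝ) / ((n : ℝ) - 1)) ^ 2 := by
      apply pow_le_pow_left₀ (by positivity); linarith
    linarith
  refine ⟨fun n hn => lt_of_lt_of_le (by have := (low n hn).1; positivity) (low n hn).2, hb, ?_⟩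
  rw [tendsto_atTop]
  intro b
  set K := max b 1 with hK
  have hK1 : 1 ≤ K := le_max_right _ _
  set B := K / (y / 4) with hB
  have hB0 : 0 < B := by rw [hB]; positivity
  have hlogm : Tendsto (fun n : ℕ => Real.log ((n : ℝ) - 1)) atTop atTop :=
    Real.tendsto_log_atTop.comp (tendsto_atTop_add_const_right _ _ tendsto_natCast_atTop_atTop)
  filter_upwards [hb, eventually_ge_atTop 3, hlogm.eventually_ge_atTop (2 * K ^ 2 + 1 + Real.log B)] with n h1 hn h2
  refine (le_max_left b 1).trans ?_
  rw [← hK]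
  obtain ⟨hq1, hnq⟩ := hq n hn
  have hq1' : (1 : ℝ) ≤ q n := by exact_mod_cast hq1
  rcases le_or_gt B (q n) with hc | hc
  · have : y / 4 ≤ Real.sqrt (σsq n) := Real.le_sqrt_of_sq_le (by linarith)
    calc K = y / 4 * B := by rw [hB]; field_simp
      _ ≤ _ := by gcongr
  · have hm : ((q n + p n : ℕ) : ℝ) = (n : ℝ) - 1 := by
      have : (n : ℝ) = (q n : ℝ) + p n + 1 := by exact_mod_cast hnq
      push_cast; linarith
    have hl : Real.log (q n) ≤ Real.log B := Real.log_le_log (by linarith) hc.le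
    have hp1 : (p n : ℝ) / ((q n + p n : ℕ) : ℝ) ≤ 1 := by
      apply div_le_one_of_le₀ _ (by positivity)
      push_cast; linarith
    have : K ^ 2 ≤ σsq n := by
      rw [hσ2 n hn, hm]
      rw [hm] at hp1
      linarith
    have h5 : K ≤ Real.sqrt (σsq n) := Real.le_sqrt_of_sq_le this
    calc K = K * 1 := by ring
      _ ≤ _ := by gcongr

lemma L_tendsto (p q : ℕ → ℕ) (hq : ∀ n, 3 ≤ n → 1 ≤ q n)
    (σsq : ℕ → ℝ) (c : ℝ) (hc : 0 < c) (hσ0 : ∀ n, 3 ≤ n → 0 < σsq n) (hb : ∀ᶠ n in atTop, c ≤ σsq n)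
    (hσ2 : ∀ n, 3 ≤ n → σsq n = 1 / 2 * (-(Real.log (q n) - Real.log ((q n + p n : ℕ) : ℝ)) - p n / ((q n + p n : ℕ) : ℝ)))
    (ht : Tendsto (fun n => Real.sqrt (σsq n) * q n) atTop atTop) (t : ℝ) :
    (∀ᶠ n in atTop, |t / (2 * Real.sqrt (σsq n))| ≤ ((q n : ℝ) + 1) / 4) ∧
    Tendsto (fun n => Lfun (q n) (p n) (t / (2 * Real.sqrt (σsq n)))) atTop (𝓝 (t ^ 2 / 2)) := by
  have hz : Tendsto (fun n => |t| / 2 / (Real.sqrt (σsq n) * q n)) atTop (𝓝 0) := ht.const_div_atTop _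
  have habs : ∀ n, 3 ≤ n → |t / (2 * Real.sqrt (σsq n))| / q n = |t| / 2 / (Real.sqrt (σsq n) * q n) := by
    intro n hn
    have h1 : (1 : ℝ) ≤ q n := by exact_mod_cast hq n hn
    have h2 := Real.sqrt_pos.2 (hσ0 n hn)
    rw [abs_div, abs_of_pos (by positivity : 0 < 2 * Real.sqrt (σsq n))]
    field_simp
  have hev : ∀ᶠ n in atTop, |t / (2 * Real.sqrt (σsq n))| ≤ ((q n : ℝ) + 1) / 4 := by
    filter_upwards [hz.eventually (gt_mem_nhds (by norm_num : (0 : ℝ) < 1 / 4)), eventually_ge_atTop 3] with n h1 hn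
    have hq1 : (1 : ℝ) ≤ q n := by exact_mod_cast hq n hn
    rw [← habs n hn, div_lt_iff₀ (by linarith)] at h1
    linarith
  refine ⟨hev, ?_⟩
  have hbd : Tendsto (fun n => 101 * (1 + t ^ 2 / (4 * c)) * (|t| / 2 / (Real.sqrt (σsq n) * q n))) atTop (𝓝 0) := by
    simpa using hz.const_mul (101 * (1 + t ^ 2 / (4 * c)))
  rw [tendsto_iff_norm_sub_tendsto_zero]
  refine squeeze_zero' (Eventually.of_forall fun _ => norm_nonneg _) ?_ hbd
  filter_upwards [hev, hb, eventually_ge_atTop 3] with n h1 h2 hn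
  have hq1 : (1 : ℝ) ≤ q n := by exact_mod_cast hq n hn
  have hs := Real.sqrt_pos.2 (hσ0 n hn)
  have hsq := Real.sq_sqrt (hσ0 n hn).le
  have hL := Lfun_bound (q n) (p n) (hq n hn) _ h1
  have e2 : -(Real.log (q n) - Real.log ((q n + p n : ℕ) : ℝ)) - p n / ((q n + p n : ℕ) : ℝ) = 2 * σsq n := by
    rw [hσ2 n hn]; ring
  rw [e2] at hL
  have hh2 : (t / (2 * Real.sqrt (σsq n))) ^ 2 = t ^ 2 / (4 * σsq n) := by
    rw [div_pow, mul_pow, hsq]; norm_num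
  have e3 : (t / (2 * Real.sqrt (σsq n))) ^ 2 * (2 * σsq n) = t ^ 2 / 2 := by
    rw [hh2]; have := (hσ0 n hn).ne'
    field_simp; norm_num
  rw [e3] at hL
  rw [Real.norm_eq_abs]
  refine hL.trans ?_
  rw [← habs n hn]
  set h := t / (2 * Real.sqrt (σsq n)) with hdef
  have h6 : |h| ^ 2 ≤ t ^ 2 / (4 * c) := by
    rw [sq_abs, hh2]; gcongr
  calc 101 * (|h| + |h| ^ 3) / q n = 101 * (1 + |h| ^ 2) * (|h| / q n) := by ring
    _ ≤ _ := by gcongr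

/-- Jiang–Yang, Theorem 5: CLT for the log likelihood ratio statistic for testing
specified values of the mean vector and covariance matrix, when `p/n → y ∈ (0,1]`.
Under the null the observations are i.i.d. `N_p(0, I_p)`, the variance parameter
`σ_n²` is strictly positive, and `(log Λ_n − μ_n)/(n σ_n) ⇒ N(0,1)`. -/
theorem stmt_10 (p : ℕ → ℕ)
    (hp : ∀ n : ℕ, 3 ≤ n → 0 < p n ∧ p n + 1 < n)
    (y : ℝ) (hy : y ∈ Set.Ioc (0 : ℝ) 1)
    (hlim : Tendsto (fun n => (p n : ℝ) / n) atTop (𝓝 y))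
    (μn σsq : ℕ → ℝ)
    (hμ : ∀ n : ℕ, μn n = -(1 / 4) *
      ((n : ℝ) * (2 * (n : ℝ) - 2 * p n - 3) * Real.log (1 - (p n : ℝ) / ((n : ℝ) - 1))
        + 2 * ((n : ℝ) + 1) * p n))
    (hσ : ∀ n : ℕ, σsq n = -(1 / 2) *
      ((p n : ℝ) / ((n : ℝ) - 1) + Real.log (1 - (p n : ℝ) / ((n : ℝ) - 1)))) :
    (∀ n : ℕ, 3 ≤ n → 0 < σsq n) ∧
    ∀ f : BoundedContinuousFunction ℝ ℝ,
      Tendsto (fun n : ℕ =>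
          ∫ ω : Fin n × Fin (p n) → ℝ,
            f ((logSpecifiedStat n (p n) ω - μn n) / ((n : ℝ) * Real.sqrt (σsq n)))
            ∂(Measure.pi fun _ => gaussianReal 0 1))
        atTop (𝓝 (∫ x, f x ∂(gaussianReal 0 1))) := by
  set q : ℕ → ℕ := fun n => n - 1 - p n with hqdef
  have hq : ∀ n, 3 ≤ n → 1 ≤ q n ∧ n = q n + p n + 1 := by
    intro n hn
    have := hp n hn
    simp only [hqdef]
    omega
  have hlog : ∀ n, 3 ≤ n → Real.log (1 - (p n : ℝ) / ((n : ℝ) - 1)) = Real.log (q n) - Real.log ((q n + p n : ℕ) : ℝ) ∧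
      (n : ℝ) - 1 = ((q n + p n : ℕ) : ℝ) := by
    intro n hn
    obtain ⟨h1, h2⟩ := hq n hn
    have h1' : (1 : ℝ) ≤ q n := by exact_mod_cast h1
    have e : (n : ℝ) - 1 = ((q n + p n : ℕ) : ℝ) := by
      have : (n : ℝ) = (q n : ℝ) + p n + 1 := by exact_mod_cast h2
      push_cast; linarith
    have hpos : (0 : ℝ) < ((q n + p n : ℕ) : ℝ) := by push_cast; positivity
    refine ⟨?_, e⟩
    rw [e, ← Real.log_div (by positivity) hpos.ne']
    congr 1
    field_simp
    push_cast; ring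
  have hσ2 : ∀ n, 3 ≤ n → σsq n = 1 / 2 * (-(Real.log (q n) - Real.log ((q n + p n : ℕ) : ℝ)) - p n / ((q n + p n : ℕ) : ℝ)) := by
    intro n hn
    rw [hσ n, (hlog n hn).1, (hlog n hn).2]
    ring
  obtain ⟨hσ0, hb, ht⟩ := sig_facts p q hq (fun n hn => (hp n hn).1) y hy.1 hlim σsq (fun n _ => hσ n) hσ2
  refine ⟨hσ0, ?_⟩
  set Z : ∀ n : ℕ, (Fin n × Fin (p n) → ℝ) → ℝ := fun n ω =>
    (logSpecifiedStat n (p n) ω - μn n) / ((n : ℝ) * Real.sqrt (σsq n)) with hZ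
  have hZm : ∀ n, 3 ≤ n → Measurable (Z n) := by
    intro n hn
    have := measurable_logStat n (p n) (by omega)
    simp only [hZ]
    fun_prop
  let ν : ℕ → ProbabilityMeasure ℝ := fun n =>
    if hn : 3 ≤ n then ⟨(Measure.pi fun _ : Fin n × Fin (p n) => gaussianReal 0 1).map (Z n),
      Measure.isProbabilityMeasure_map (hZm n hn).aemeasurable⟩ else ⟨gaussianReal 0 1, inferInstance⟩
  have hν : ∀ n, 3 ≤ n → (ν n : Measure ℝ) = (Measure.pi fun _ : Fin n × Fin (p n) => gaussianReal 0 1).map (Z n) := by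
    intro n hn
    have h1 : ν n = ⟨(Measure.pi fun _ : Fin n × Fin (p n) => gaussianReal 0 1).map (Z n),
      Measure.isProbabilityMeasure_map (hZm n hn).aemeasurable⟩ := dif_pos hn
    rw [h1]
    rfl
  have hweak := weak_of_mgf ν (by
    intro t
    by_cases ht0 : t = 0
    · subst ht0
      simp
    obtain ⟨hev, hL⟩ := L_tendsto p q (fun n hn => (hq n hn).1) σsq (y ^ 2 / 16) (by have := hy.1; positivity) hσ0 hb hσ2 ht t
    have hlim2 := ENNReal.tendsto_ofReal ((Real.continuous_exp.tendsto _).comp hL)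
    refine hlim2.congr' ?_
    filter_upwards [hev, eventually_ge_atTop 3] with n h1 hn
    rw [hν n hn, lintegral_map (by fun_prop) (hZm n hn)]
    refine (stat_mgf_L n (p n) (q n) (hq n hn).1 (hq n hn).2 t (μn n) (Real.sqrt (σsq n)) (Real.sqrt_pos.2 (hσ0 n hn)) ht0 ?_ h1).symm
    rw [hμ n, (hlog n hn).1])
  intro f
  have h1 := (ProbabilityMeasure.tendsto_iff_forall_integral_tendsto.1 hweak) f
  refine h1.congr' ?_
  filter_upwards [eventually_ge_atTop 3] with n hn
  rw [hν n hn, integral_map (hZm n hn).aemeasurable f.continuous.aestronglyMeasurable]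
end

section
/- Let p = p_n be a sequence of positive integers with n ≥ p_n + 5 and p_n/n → y ∈ (0, 1] as n → ∞. For each n, let (x_{ij})_{1 ≤ i ≤ n, 1 ≤ j ≤ p} be independent real random variables such that for each j, the variables x_{1j}, …, x_{nj} are i.i.d. normal N(μ_j, σ_j²) with σ_j > 0 (i.e., the rows x_1, …, x_n are i.i.d. N_p(μ, Σ) with diagonal covariance Σ, so the population correlation matrix is I_p). Let R_n = (r_{ij})_{p×p} be the sample correlation matrix whose (i,j) entry is the Pearson correlation coefficient of the i-th and j-th columns of the data matrix. Define μ_n = (p − n + 3/2)·log(1 − p/(n−1)) − (n−2)p/(n−1) and σ_n² = −2[ p/(n−1) + log(1 − p/(n−1)) ], which is strictly positive. Then (log det(R_n) − μ_n)/σ_n converges in distribution to the standard normal distribution N(0,1) as n → ∞. -/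
open Filter Topology MeasureTheory Matrix ProbabilityTheory
open scoped NNReal

/-- The Pearson correlation coefficient of two vectors `x, y ∈ ℝⁿ`. -/
noncomputable def pearsonCorr (n : ℕ) (x y : Fin n → ℝ) : ℝ :=
  (∑ i, (x i - (∑ j, x j) / n) * (y i - (∑ j, y j) / n)) /
    Real.sqrt ((∑ i, (x i - (∑ j, x j) / n) ^ 2) * (∑ i, (y i - (∑ j, y j) / n) ^ 2))

namespace JY

lemma sum_inv_cube (a : ℝ) (ha : 2 ≤ a) (M : ℕ) :
    ∑ m ∈ Finset.range M, 1 / (a + m) ^ 3 ≤ 1 / (a - 1) ^ 2 - 1 / (a + M - 1) ^ 2 := by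
  induction M with
  | zero => simp
  | succ M ih =>
    rw [Finset.sum_range_succ]
    have hx : 2 ≤ a + M := by have : (0:ℝ) ≤ M := Nat.cast_nonneg M; linarith
    have key : ∀ x : ℝ, 2 ≤ x → 1 / x ^ 3 ≤ 1 / (x - 1) ^ 2 - 1 / x ^ 2 := by
      intro x hx
      have h1 : 0 < x - 1 := by linarith
      have h2 : 0 < x := by linarith
      rw [div_sub_div _ _ (by positivity) (by positivity), div_le_div_iff₀ (by positivity) (by positivity)]
      have : x ^ 2 * (x ^ 2 - 1) ≥ 0 := by
        apply mul_nonneg (by positivity); nlinarith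
      nlinarith [mul_nonneg this h2.le, sq_nonneg x]
    have := key _ hx
    push_cast
    have e : a + ((M:ℝ) + 1) - 1 = a + M := by ring
    rw [e]
    linarith

/-- main term -/
noncomputable def hterm (a t : ℝ) : ℂ :=
  Complex.I * t * ((Real.log a - 1 / (2 * a) : ℝ) : ℂ) - ((t ^ 2 / (2 * a) : ℝ) : ℂ)

noncomputable def delta (a t : ℝ) : ℂ :=
  Complex.log (1 + Complex.I * t / a) - (hterm (a + 1) t - hterm a t)

lemma log_taylor2 (z : ℂ) (hz : ‖z‖ ≤ 1 / 2) :
    ‖Complex.log (1 + z) - (z - z ^ 2 / 2)‖ ≤ 2 / 3 * ‖z‖ ^ 3 := by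
  have h := Complex.norm_log_sub_logTaylor_le 2 (z := z) (by linarith)
  have e : Complex.logTaylor (2 + 1) z = z - z ^ 2 / 2 := by
    simp [Complex.logTaylor, Finset.sum_range_succ]; ring
  rw [e] at h
  refine h.trans ?_
  have h3 : (1 - ‖z‖)⁻¹ ≤ 2 := by
    rw [inv_le_comm₀ (by linarith) (by norm_num)]; linarith
  have h4 : 0 ≤ ‖z‖ ^ 3 := by positivity
  norm_num
  nlinarith [mul_le_mul_of_nonneg_left h3 h4]

lemma delta_bound (a t : ℝ) (ha : 2 ≤ a) (ht : |t| ≤ a / 2) :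
    ‖delta a t‖ ≤ 2 * (|t| + |t| ^ 3) * (1 / a ^ 3) := by
  have ha0 : 0 < a := by linarith
  set z : ℂ := Complex.I * t / a with hz
  have hzn : ‖z‖ = |t| / a := by
    simp [hz, abs_of_pos ha0]
  have h1 := log_taylor2 z (by rw [hzn, div_le_iff₀ ha0]; linarith)
  have h2 := log_taylor2 ((1 / a : ℝ) : ℂ) (by
    rw [Complex.norm_real, Real.norm_of_nonneg (by positivity)]
    rw [div_le_div_iff₀ ha0 (by norm_num)]; linarith)
  have e2 : Complex.log (1 + ((1 / a : ℝ) : ℂ)) = ((Real.log (a + 1) - Real.log a : ℝ) : ℂ) := by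
    rw [← Real.log_div (by linarith) (by linarith), Complex.ofReal_log (by positivity)]
    congr 1; push_cast
    have : (a : ℂ) ≠ 0 := by exact_mod_cast ha0.ne'
    field_simp
  rw [e2, Complex.norm_real, Real.norm_of_nonneg (show (0:ℝ) ≤ 1 / a by positivity)] at h2
  set u : ℂ := ((Real.log (a + 1) - Real.log a : ℝ) : ℂ) - (((1 / a : ℝ) : ℂ) - ((1 / a : ℝ) : ℂ) ^ 2 / 2) with hu
  have ed : delta a t = (Complex.log (1 + z) - (z - z ^ 2 / 2)) - Complex.I * t * u
      + (Complex.I * t * ((1 / (2 * a ^ 2 * (a + 1)) : ℝ) : ℂ)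
        + ((t ^ 2 / (2 * a ^ 2 * (a + 1)) : ℝ) : ℂ)) := by
    have hac : (a : ℂ) ≠ 0 := by exact_mod_cast ha0.ne'
    have hac1 : (a : ℂ) + 1 ≠ 0 := by
      have : a + 1 ≠ 0 := by linarith
      exact_mod_cast this
    rw [delta, hterm, hterm, hu, ← hz]
    have hI : Complex.I ^ 2 = -1 := Complex.I_sq
    rw [hz]
    push_cast
    field_simp
    ring_nf
    rw [hI]
    ring
  have n2 : ‖Complex.I * t * u‖ ≤ |t| * (2 / 3 * (1 / a) ^ 3) := by
    rw [norm_mul, norm_mul, Complex.norm_I, Complex.norm_real, Real.norm_eq_abs, one_mul]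
    gcongr
  have hle : 1 / (2 * a ^ 2 * (a + 1)) ≤ 1 / 2 * (1 / a ^ 3) := by
    rw [div_mul_div_comm, div_le_div_iff₀ (by positivity) (by positivity)]
    nlinarith [sq_nonneg a]
  have n3 : ‖Complex.I * t * ((1 / (2 * a ^ 2 * (a + 1)) : ℝ) : ℂ)‖ ≤ |t| * (1 / 2 * (1 / a ^ 3)) := by
    rw [norm_mul, norm_mul, Complex.norm_I, Complex.norm_real, Complex.norm_real, Real.norm_eq_abs,
      one_mul, Real.norm_of_nonneg (by positivity)]
    gcongr
  have n4 : ‖((t ^ 2 / (2 * a ^ 2 * (a + 1)) : ℝ) : ℂ)‖ ≤ |t| ^ 2 * (1 / 2 * (1 / a ^ 3)) := by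
    rw [Complex.norm_real, Real.norm_of_nonneg (by positivity), div_eq_mul_one_div, sq_abs]
    gcongr
  rw [ed]
  have n1 : ‖Complex.log (1 + z) - (z - z ^ 2 / 2)‖ ≤ 2 / 3 * |t| ^ 3 * (1 / a ^ 3) := by
    rw [hzn] at h1
    refine h1.trans (le_of_eq ?_)
    rw [div_pow]; ring
  refine (norm_add_le _ _).trans ?_
  have := (norm_sub_le (Complex.log (1 + z) - (z - z ^ 2 / 2)) (Complex.I * t * u))
  have := norm_add_le (Complex.I * t * ((1 / (2 * a ^ 2 * (a + 1)) : ℝ) : ℂ)) ((t ^ 2 / (2 * a ^ 2 * (a + 1)) : ℝ) : ℂ)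
  rw [_root_.one_div_pow] at n2
  have hA : 0 ≤ 1 / a ^ 3 := by positivity
  have ht0 := abs_nonneg t
  have hq : |t| ^ 2 ≤ (|t| + |t| ^ 3) / 2 := by nlinarith [mul_nonneg ht0 (sq_nonneg (|t| - 1))]
  have hq2 := mul_le_mul_of_nonneg_right hq hA
  have hq3 : 0 ≤ |t| * (1 / a ^ 3) := by positivity
  have hq4 : 0 ≤ |t| ^ 3 * (1 / a ^ 3) := by positivity
  linarith

lemma hterm_tendsto (a t : ℝ) (ha : 0 < a) :
    Tendsto (fun n : ℕ => Complex.I * t * ((Real.log n : ℝ) : ℂ) - hterm (a + (n + 1 : ℕ)) t)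
      atTop (𝓝 0) := by
  have h1 : Tendsto (fun n : ℕ => (a + (n + 1 : ℕ) : ℝ)) atTop atTop :=
    tendsto_atTop_add_const_left _ _ (tendsto_natCast_atTop_atTop.comp (tendsto_add_atTop_nat 1))
  have hinv : Tendsto (fun n : ℕ => (1 / (a + (n + 1 : ℕ)) : ℝ)) atTop (𝓝 0) := by
    simp only [one_div]
    exact h1.inv_tendsto_atTop
  have hlog : Tendsto (fun n : ℕ => Real.log n - Real.log (a + (n + 1 : ℕ))) atTop (𝓝 0) := by
    have : Tendsto (fun n : ℕ => (n : ℝ) / (a + (n + 1 : ℕ))) atTop (𝓝 1) := by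
      have : Tendsto (fun n : ℕ => 1 - (a + 1) * (1 / (a + (n + 1 : ℕ)) : ℝ)) atTop (𝓝 (1 - (a+1) * 0)) :=
        tendsto_const_nhds.sub (hinv.const_mul _)
      simp only [mul_zero, sub_zero] at this
      refine this.congr fun n => ?_
      have : (0:ℝ) < a + (n + 1 : ℕ) := by positivity
      field_simp; push_cast; ring
    have h2 := (Real.continuousAt_log one_ne_zero).tendsto.comp this
    rw [Real.log_one] at h2
    refine h2.congr' ?_
    filter_upwards [eventually_gt_atTop 0] with n hn
    have : (0:ℝ) < n := by exact_mod_cast hn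
    simp only [Function.comp]
    rw [Real.log_div (by positivity) (by positivity)]
  have hR : Tendsto (fun n : ℕ => Complex.I * t * (((Real.log n - Real.log (a + (n + 1 : ℕ))) + 1/2 * (1 / (a + (n + 1 : ℕ))) : ℝ) : ℂ)
      + ((t ^ 2 / 2 * (1 / (a + (n + 1 : ℕ))) : ℝ) : ℂ)) atTop (𝓝 (Complex.I * t * ((0 + 1/2 * 0 : ℝ) : ℂ) + ((t^2/2 * 0 : ℝ) : ℂ))) := by
    refine Tendsto.add (Tendsto.const_mul _ ?_) ?_
    · exact (Complex.continuous_ofReal.tendsto _).comp (hlog.add (hinv.const_mul _))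
    · exact (Complex.continuous_ofReal.tendsto _).comp (hinv.const_mul _)
  simp only [mul_zero, add_zero, Complex.ofReal_zero] at hR
  refine hR.congr fun n => ?_
  rw [hterm]
  have : ((a:ℂ) + (n + 1 : ℕ)) ≠ 0 := by
    have : a + (n + 1 : ℕ) ≠ 0 := by positivity
    exact_mod_cast this
  push_cast at this ⊢
  field_simp
  ring

lemma Gamma_ratio (a t : ℝ) (ha : 2 ≤ a) (ht : |t| ≤ a / 2) :
    ∃ ε : ℂ, ‖ε‖ ≤ 8 * (|t| + |t| ^ 3) * (1 / a ^ 2) ∧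
      Complex.Gamma (a + Complex.I * t) = Complex.Gamma a * Complex.exp (hterm a t + ε) := by
  have ha0 : 0 < a := by linarith
  have hb : ∀ m : ℕ, ‖delta (a + m) t‖ ≤ 2 * (|t| + |t| ^ 3) * (1 / (a + m) ^ 3) := fun m =>
    delta_bound _ _ (by have : (0:ℝ) ≤ m := Nat.cast_nonneg m; linarith)
      (by have : (0:ℝ) ≤ m := Nat.cast_nonneg m; linarith)
  have hps : ∀ M, ∑ m ∈ Finset.range M, 2 * (|t| + |t| ^ 3) * (1 / (a + m) ^ 3) ≤
      8 * (|t| + |t| ^ 3) * (1 / a ^ 2) := by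
    intro M
    rw [← Finset.mul_sum]
    have h1 := sum_inv_cube a ha M
    have h2 : 0 ≤ 1 / (a + M - 1) ^ 2 := by positivity
    have h3 : 1 / (a - 1) ^ 2 ≤ 4 * (1 / a ^ 2) := by
      have : 0 < a - 1 := by linarith
      rw [mul_one_div, div_le_div_iff₀ (by positivity) (by positivity)]
      nlinarith
    have h4 : 0 ≤ 2 * (|t| + |t| ^ 3) := by positivity
    have := mul_le_mul_of_nonneg_left (h1.trans (show _ ≤ 4 * (1 / a ^ 2) by linarith)) h4
    refine this.trans (le_of_eq (by ring))
  have hsum : Summable (fun m : ℕ => 2 * (|t| + |t| ^ 3) * (1 / (a + m) ^ 3)) :=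
    summable_of_sum_range_le (fun n => by positivity) hps
  have hs : Summable (fun m : ℕ => delta (a + m) t) := Summable.of_norm_bounded hsum hb
  refine ⟨-∑' m : ℕ, delta (a + m) t, ?_, ?_⟩
  · rw [norm_neg]
    exact (tsum_of_norm_bounded hsum.hasSum hb).trans (hsum.tsum_le_of_sum_range_le hps)
  have hG0 : Complex.Gamma a ≠ 0 := Complex.Gamma_ne_zero_of_re_pos (by simpa using ha0)
  have l1 := (Complex.GammaSeq_tendsto_Gamma (a + Complex.I * t)).div
    (Complex.GammaSeq_tendsto_Gamma a) hG0
  have l2 : Tendsto (fun n : ℕ => Complex.exp ((Complex.I * t * ((Real.log n : ℝ) : ℂ) - hterm (a + (n + 1 : ℕ)) t)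
      + hterm a t - ∑ m ∈ Finset.range (n + 1), delta (a + m) t)) atTop
      (𝓝 (Complex.exp (0 + hterm a t - ∑' m : ℕ, delta (a + m) t))) := by
    refine (Complex.continuous_exp.tendsto _).comp ?_
    refine ((hterm_tendsto a t ha0).add_const _).sub ?_
    exact (hs.hasSum.tendsto_sum_nat).comp (tendsto_add_atTop_nat 1)
  have heq := tendsto_nhds_unique (l1.congr' ?_) l2
  · rw [div_eq_iff hG0] at heq
    rw [heq, mul_comm, zero_add, sub_eq_add_neg]
  filter_upwards [eventually_gt_atTop 0] with n hn
  have hnz : (n : ℂ) ≠ 0 := by exact_mod_cast hn.ne'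
  have hj : ∀ j : ℕ, (a : ℂ) + j ≠ 0 := by
    intro j
    have : a + j ≠ 0 := by positivity
    exact_mod_cast this
  have hj2 : ∀ j : ℕ, (a : ℂ) + Complex.I * t + j ≠ 0 := by
    intro j h
    have := congrArg Complex.re h
    simp at this
    have : a + j ≠ 0 := by positivity
    contradiction
  have hlog : ∀ j : ℕ, Complex.exp (Complex.log (1 + Complex.I * t / ((a + j : ℝ) : ℂ))) =
      ((a : ℂ) + Complex.I * t + j) / (a + j) := by
    intro j
    have e : 1 + Complex.I * t / ((a + j : ℝ) : ℂ) = ((a : ℂ) + Complex.I * t + j) / (a + j) := by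
      have := hj j
      push_cast
      field_simp
      ring
    rw [e, Complex.exp_log (div_ne_zero (hj2 j) (hj j))]
  have hsumd : ∑ m ∈ Finset.range (n + 1), delta (a + m) t =
      ∑ m ∈ Finset.range (n + 1), Complex.log (1 + Complex.I * t / ((a + m : ℝ) : ℂ))
        - (hterm (a + (n + 1 : ℕ)) t - hterm a t) := by
    have := Finset.sum_range_sub (fun m : ℕ => hterm (a + m) t) (n + 1)
    simp only [Nat.cast_zero, add_zero] at this
    rw [← this, ← Finset.sum_sub_distrib]
    refine Finset.sum_congr rfl fun m _ => ?_
    rw [delta]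
    have e5 : a + m + 1 = a + ((m + 1 : ℕ) : ℝ) := by push_cast; ring
    rw [e5]
  rw [hsumd]
  have e3 : (Complex.I * t * ((Real.log n : ℝ) : ℂ) - hterm (a + (n + 1 : ℕ)) t)
      + hterm a t - (∑ m ∈ Finset.range (n + 1), Complex.log (1 + Complex.I * t / ((a + m : ℝ) : ℂ))
        - (hterm (a + (n + 1 : ℕ)) t - hterm a t)) = Complex.I * t * ((Real.log n : ℝ) : ℂ) -
        ∑ m ∈ Finset.range (n + 1), Complex.log (1 + Complex.I * t / ((a + m : ℝ) : ℂ)) := by ring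
  rw [e3, Complex.exp_sub, Complex.exp_sum]
  simp_rw [hlog]
  rw [Finset.prod_div_distrib]
  simp only [Complex.GammaSeq, Pi.div_apply]
  rw [Complex.cpow_add _ _ hnz]
  have e4 : (n : ℂ) ^ (Complex.I * t) = Complex.exp (Complex.I * t * ((Real.log n : ℝ) : ℂ)) := by
    rw [Complex.cpow_def_of_ne_zero hnz, Complex.ofReal_log (Nat.cast_nonneg n), mul_comm]
    simp
  rw [e4]
  have p1 : ∏ x ∈ Finset.range (n + 1), ((a : ℂ) + x) ≠ 0 := Finset.prod_ne_zero_iff.2 fun j _ => hj j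
  have p2 : ∏ x ∈ Finset.range (n + 1), ((a : ℂ) + Complex.I * t + x) ≠ 0 :=
    Finset.prod_ne_zero_iff.2 fun j _ => hj2 j
  have p3 : (n : ℂ) ^ (a : ℂ) ≠ 0 := by
    rw [Complex.cpow_def_of_ne_zero hnz]; exact Complex.exp_ne_zero _
  have p4 : ((n.factorial : ℕ) : ℂ) ≠ 0 := by exact_mod_cast n.factorial_ne_zero
  field_simp

end JY

namespace JY

lemma Ioc_tele (f : ℕ → ℝ) {m N : ℕ} (h : m ≤ N) :
    ∑ k ∈ Finset.Ioc m N, (f k - f (k - 1)) = f N - f m := by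
  induction N, h using Nat.le_induction with
  | base => simp
  | succ N h ih =>
    rw [Finset.sum_Ioc_succ_top (by omega), ih]
    simp

lemma sum_inv_sq {m N : ℕ} (hm : 1 ≤ m) (h : m ≤ N) :
    ∑ k ∈ Finset.Ioc m N, 1 / (k : ℝ) ^ 2 ≤ 1 / (m : ℝ) := by
  have h1 : ∑ k ∈ Finset.Ioc m N, 1 / (k : ℝ) ^ 2 ≤
      ∑ k ∈ Finset.Ioc m N, ((fun k : ℕ => - (1 / (k : ℝ))) k - (fun k : ℕ => - (1 / (k : ℝ))) (k - 1)) := by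
    refine Finset.sum_le_sum fun k hk => ?_
    rw [Finset.mem_Ioc] at hk
    have hk1 : 2 ≤ k := by omega
    have hk2 : (2:ℝ) ≤ k := by exact_mod_cast hk1
    have e : ((k - 1 : ℕ) : ℝ) = k - 1 := by push_cast [Nat.cast_sub (show 1 ≤ k by omega)]; ring
    simp only [e]
    have : (0:ℝ) < k - 1 := by linarith
    rw [neg_sub_neg, div_sub_div _ _ (by positivity) (by positivity),
      div_le_div_iff₀ (by positivity) (by positivity)]
    nlinarith
  rw [Ioc_tele _ h] at h1
  have : 0 ≤ 1 / (N : ℝ) := by positivity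
  linarith

noncomputable def Fst (x : ℝ) : ℝ := x * Real.log x - x + 1 / 2 * Real.log x

lemma term_inv (k : ℕ) (hk : 2 ≤ k) :
    |1 / (k : ℝ) - (Real.log k - Real.log ((k - 1 : ℕ) : ℝ))| ≤ 2 * (1 / (k : ℝ) ^ 2) := by
  have hk2 : (2:ℝ) ≤ k := by exact_mod_cast hk
  have e : ((k - 1 : ℕ) : ℝ) = k - 1 := by push_cast [Nat.cast_sub (show 1 ≤ k by omega)]; ring
  rw [e]
  have h0 : (0:ℝ) < 1 / k := by positivity
  have h0' : (1:ℝ) / k ≤ 1 / 2 := by rw [div_le_div_iff₀ (by linarith) (by norm_num)]; linarith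
  have h := Real.abs_log_sub_add_sum_range_le (x := 1 / (k : ℝ)) (by rw [abs_of_pos h0]; linarith) 1
  rw [abs_of_pos h0] at h
  have e2 : Real.log (1 - 1 / (k:ℝ)) = Real.log (k - 1) - Real.log k := by
    rw [← Real.log_div (by linarith) (by linarith)]
    congr 1; field_simp
  rw [e2] at h
  simp at h
  have e3 : 1 / (k : ℝ) - (Real.log k - Real.log (k - 1)) = (k:ℝ)⁻¹ + (Real.log (k-1) - Real.log k) := by
    rw [one_div]; ring
  rw [e3]
  refine h.trans ?_
  rw [div_le_iff₀ (by rw [one_div] at h0'; linarith)]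
  rw [one_div] at h0 h0'
  have : 0 ≤ ((k:ℝ)^2)⁻¹ := by positivity
  rw [one_div]
  nlinarith

lemma term_log (k : ℕ) (hk : 2 ≤ k) :
    |Real.log k - (Fst k - Fst ((k - 1 : ℕ) : ℝ))| ≤ 3 * (1 / (k : ℝ) ^ 2) := by
  have hk2 : (2:ℝ) ≤ k := by exact_mod_cast hk
  have e : ((k - 1 : ℕ) : ℝ) = k - 1 := by push_cast [Nat.cast_sub (show 1 ≤ k by omega)]; ring
  rw [e]
  have h0 : (0:ℝ) < 1 / k := by positivity
  have h0' : (1:ℝ) / k ≤ 1 / 2 := by rw [div_le_div_iff₀ (by linarith) (by norm_num)]; linarith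
  have h := Real.abs_log_sub_add_sum_range_le (x := 1 / (k : ℝ)) (by rw [abs_of_pos h0]; linarith) 2
  rw [abs_of_pos h0] at h
  have e2 : Real.log (1 - 1 / (k:ℝ)) = Real.log (k - 1) - Real.log k := by
    rw [← Real.log_div (by linarith) (by linarith)]
    congr 1; field_simp
  rw [e2] at h
  simp only [Finset.sum_range_succ, Finset.sum_range_zero] at h
  norm_num at h
  rw [← one_div] at h
  set x : ℝ := 1 / k with hx
  have hkx : (k : ℝ) = 1 / x := by rw [hx]; field_simp
  set l : ℝ := Real.log (k - 1) - Real.log k with hl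
  have hxp : ((k:ℝ) ^ 2)⁻¹ = x ^ 2 := by rw [hx]; field_simp
  have hxp3 : ((k:ℝ) ^ 3)⁻¹ = x ^ 3 := by rw [hx]; field_simp
  have e4 : Real.log k - (Fst k - Fst (k - 1)) = (k - 1/2) * (x + x ^ 2 / 2 + l) + x ^ 2 / 4 := by
    have h1 : (k : ℝ) * x = 1 := by rw [hx]; field_simp
    have h2 : (k : ℝ) * x ^ 2 = x := by rw [pow_two, ← mul_assoc, h1, one_mul]
    simp only [Fst, hl]
    linear_combination (-1) * h1 - (1/2) * h2
  rw [e4]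
  have h5 : x ^ 3 / (1 - x) ≤ 2 * x ^ 3 := by
    rw [div_le_iff₀ (by linarith)]
    have : 0 ≤ x ^ 3 := by positivity
    nlinarith
  rw [hxp3] at h
  rw [hxp] at h
  have h' := h.trans h5
  have h6 : |(k - 1/2) * (x + x ^ 2 / 2 + l)| ≤ (k : ℝ) * (2 * x ^ 3) := by
    rw [abs_mul, abs_of_pos (by linarith)]
    apply mul_le_mul (by linarith) h' (abs_nonneg _) (by linarith)
  have h7 : (k : ℝ) * (2 * x ^ 3) = 2 * x ^ 2 := by rw [hx]; field_simp
  have h8 : 1 / (k:ℝ) ^ 2 = x ^ 2 := by rw [one_div, hxp]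
  rw [h8]
  refine (abs_add_le _ _).trans ?_
  rw [abs_of_nonneg (show 0 ≤ x ^ 2 / 4 by positivity)]
  have : 0 ≤ x ^ 2 := by positivity
  linarith

lemma sum_inv {m N : ℕ} (hm : 1 ≤ m) (h : m ≤ N) :
    |∑ k ∈ Finset.Ioc m N, 1 / (k : ℝ) - (Real.log N - Real.log m)| ≤ 2 / m := by
  have := Ioc_tele (fun k => Real.log k) h
  rw [← this, ← Finset.sum_sub_distrib]
  refine (Finset.abs_sum_le_sum_abs _ _).trans ?_
  refine (Finset.sum_le_sum (fun k hk => term_inv k (by rw [Finset.mem_Ioc] at hk; omega))).trans ?_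
  rw [← Finset.mul_sum]
  have := sum_inv_sq hm h
  rw [show (2:ℝ) / m = 2 * (1 / m) by ring]
  linarith

lemma sum_log {m N : ℕ} (hm : 1 ≤ m) (h : m ≤ N) :
    |∑ k ∈ Finset.Ioc m N, Real.log (k : ℝ) - (Fst N - Fst m)| ≤ 3 / m := by
  have := Ioc_tele (fun k => Fst k) h
  rw [← this, ← Finset.sum_sub_distrib]
  refine (Finset.abs_sum_le_sum_abs _ _).trans ?_
  refine (Finset.sum_le_sum (fun k hk => term_log k (by rw [Finset.mem_Ioc] at hk; omega))).trans ?_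
  rw [← Finset.mul_sum]
  have := sum_inv_sq hm h
  rw [show (3:ℝ) / m = 3 * (1 / m) by ring]
  linarith

/-- `Γ(k/2+it)/Γ(k/2)` -/
noncomputable def Gr (k : ℕ) (t : ℝ) : ℂ :=
  Complex.Gamma (((k / 2 : ℝ) : ℂ) + Complex.I * t) / Complex.Gamma ((k / 2 : ℝ) : ℂ)

lemma Gr_ne_zero (k : ℕ) (hk : 0 < k) (t : ℝ) : Gr k t ≠ 0 := by
  have : (0:ℝ) < k / 2 := by positivity
  refine div_ne_zero (Complex.Gamma_ne_zero_of_re_pos ?_) (Complex.Gamma_ne_zero_of_re_pos ?_)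
  · simpa using hk
  · rw [Complex.ofReal_re]; exact this

lemma Gr_eq (k : ℕ) (t : ℝ) (hk : 4 ≤ k) (ht : |t| ≤ k / 4) :
    ∃ ε : ℂ, ‖ε‖ ≤ 32 * (|t| + |t| ^ 3) * (1 / (k : ℝ) ^ 2) ∧
      Gr k t = Complex.exp (hterm (k / 2) t + ε) := by
  have hk' : (4:ℝ) ≤ k := by exact_mod_cast hk
  obtain ⟨ε, h1, h2⟩ := Gamma_ratio (k / 2) t (by linarith) (by linarith)
  refine ⟨ε, h1.trans (le_of_eq ?_), ?_⟩
  · field_simp; ring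
  · rw [Gr, h2, mul_div_cancel_left₀]
    exact Complex.Gamma_ne_zero_of_re_pos (by rw [Complex.ofReal_re]; linarith)

lemma prod_Gr (m N : ℕ) (t : ℝ) (hm : 4 ≤ m) (h : m ≤ N) (ht : |t| ≤ m / 4) :
    ∃ ε : ℂ, ‖ε‖ ≤ 100 * (|t| + |t| ^ 3) / m ∧
      ∏ k ∈ Finset.Ioc m N, (Gr k t / Gr N t) =
        Complex.exp (Complex.I * t * (((1 / 2 - m) * (Real.log m - Real.log N) - (N - m) + (N - m) / N : ℝ) : ℂ)
          - ((t ^ 2 * (Real.log N - Real.log m - (N - m) / N) : ℝ) : ℂ) + ε) := by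
  have hmR : (4:ℝ) ≤ m := by exact_mod_cast hm
  have hNR : (m:ℝ) ≤ N := by exact_mod_cast h
  have hex : ∀ k : ℕ, ∃ ε : ℂ, m ≤ k → ‖ε‖ ≤ 32 * (|t| + |t| ^ 3) * (1 / (k : ℝ) ^ 2) ∧
      Gr k t = Complex.exp (hterm (k / 2) t + ε) := by
    intro k
    by_cases hk : m ≤ k
    · have hkR : (m:ℝ) ≤ k := by exact_mod_cast hk
      obtain ⟨ε, h1⟩ := Gr_eq k t (by omega) (by linarith)
      exact ⟨ε, fun _ => h1⟩
    · exact ⟨0, fun h => absurd h hk⟩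
  choose e he using hex
  have hQ : 0 ≤ |t| + |t| ^ 3 := by positivity
  set Q := |t| + |t| ^ 3 with hQd
  set A : ℝ := ∑ k ∈ Finset.Ioc m N, Real.log (k : ℝ) - (Fst N - Fst m) with hA
  set B : ℝ := ∑ k ∈ Finset.Ioc m N, 1 / (k : ℝ) - (Real.log N - Real.log m) with hB
  have hAb : |A| ≤ 3 / m := sum_log (by omega) h
  have hBb : |B| ≤ 2 / m := sum_inv (by omega) h
  refine ⟨Complex.I * t * ((A - B : ℝ) : ℂ) - ((t ^ 2 * B : ℝ) : ℂ) + ∑ k ∈ Finset.Ioc m N, (e k - e N), ?_, ?_⟩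
  · have n1 : ‖Complex.I * t * ((A - B : ℝ) : ℂ)‖ ≤ |t| * (5 / m) := by
      rw [norm_mul, norm_mul, Complex.norm_I, Complex.norm_real, Complex.norm_real, Real.norm_eq_abs,
        Real.norm_eq_abs, one_mul]
      gcongr
      refine (abs_sub _ _).trans ?_
      rw [show (5:ℝ) / m = 3 / m + 2 / m by ring]
      linarith
    have n2 : ‖((t ^ 2 * B : ℝ) : ℂ)‖ ≤ |t| ^ 2 * (2 / m) := by
      rw [Complex.norm_real, norm_mul, Real.norm_eq_abs, Real.norm_eq_abs, abs_pow]
      gcongr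
    have n3 : ‖∑ k ∈ Finset.Ioc m N, (e k - e N)‖ ≤ 64 * Q * (1 / m) := by
      have : ∀ k ∈ Finset.Ioc m N, ‖e k - e N‖ ≤ 32 * Q * (1 / (k:ℝ)^2) + 32 * Q * (1 / (k:ℝ)^2) := by
        intro k hk
        rw [Finset.mem_Ioc] at hk
        refine (norm_sub_le _ _).trans (add_le_add (he k (by omega)).1 ?_)
        refine (he N h).1.trans ?_
        have : (0:ℝ) < k := by exact_mod_cast (by omega : 0 < k)
        have : (k:ℝ) ≤ N := by exact_mod_cast hk.2
        gcongr
      refine (norm_sum_le _ _).trans ((Finset.sum_le_sum this).trans ?_)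
      rw [Finset.sum_add_distrib, ← Finset.mul_sum]
      have := mul_le_mul_of_nonneg_left (sum_inv_sq (show 1 ≤ m by omega) h) (show 0 ≤ 32 * Q by positivity)
      linarith
    refine (norm_add_le _ _).trans ?_
    have n4 := norm_sub_le (Complex.I * t * ((A - B : ℝ) : ℂ)) ((t ^ 2 * B : ℝ) : ℂ)
    have ht0 := abs_nonneg t
    have hq : |t| ^ 2 ≤ Q / 2 := by rw [hQd]; nlinarith [mul_nonneg ht0 (sq_nonneg (|t| - 1))]
    have hq1 : |t| ≤ Q := by rw [hQd]; linarith [pow_nonneg ht0 3]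
    have hm0 : 0 ≤ 1 / (m:ℝ) := by positivity
    have a1 := mul_le_mul_of_nonneg_right hq hm0
    have a2 := mul_le_mul_of_nonneg_right hq1 hm0
    have a3 := mul_nonneg hQ hm0
    rw [show 100 * Q / (m:ℝ) = 100 * (Q * (1 / m)) by ring]
    rw [show |t| * (5 / (m:ℝ)) = 5 * (|t| * (1 / m)) by ring] at n1
    rw [show |t| ^ 2 * (2 / (m:ℝ)) = 2 * (|t| ^ 2 * (1 / m)) by ring] at n2
    linarith
  · have hN0 : (N : ℝ) ≠ 0 := by linarith
    have step : ∀ k ∈ Finset.Ioc m N, Gr k t / Gr N t =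
        Complex.exp ((Complex.I * t * ((Real.log k - Real.log N - 1 / k + 1 / N : ℝ) : ℂ)
          - ((t ^ 2 * (1 / k - 1 / N) : ℝ) : ℂ)) + (e k - e N)) := by
      intro k hk
      rw [Finset.mem_Ioc] at hk
      have hk0 : (k : ℝ) ≠ 0 := by
        have : k ≠ 0 := by omega
        exact_mod_cast this
      rw [(he k (by omega)).2, (he N h).2, ← Complex.exp_sub]
      congr 1
      rw [hterm, hterm, Real.log_div hk0 (by norm_num), Real.log_div hN0 (by norm_num)]
      have : (N : ℂ) ≠ 0 := by exact_mod_cast hN0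
      have : (k : ℂ) ≠ 0 := by exact_mod_cast hk0
      push_cast
      field_simp
      ring
    rw [Finset.prod_congr rfl step, ← Complex.exp_sum]
    congr 1
    rw [Finset.sum_add_distrib, ← add_assoc]
    congr 1
    rw [Finset.sum_sub_distrib, ← Finset.mul_sum, ← Complex.ofReal_sum, ← Complex.ofReal_sum, ← Finset.mul_sum]
    have hc : ((Finset.Ioc m N).card : ℝ) = N - m := by rw [Nat.card_Ioc, Nat.cast_sub h]
    have s1 : ∑ k ∈ Finset.Ioc m N, (Real.log k - Real.log N - 1 / k + 1 / N) =
        (1 / 2 - m) * (Real.log m - Real.log N) - (N - m) + (N - m) / N + (A - B) := by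
      simp only [Finset.sum_sub_distrib, Finset.sum_add_distrib, Finset.sum_const, nsmul_eq_mul, hc]
      rw [hA, hB, Fst, Fst]
      ring
    have s2 : ∑ k ∈ Finset.Ioc m N, (1 / (k:ℝ) - 1 / N) = Real.log N - Real.log m - (N - m) / N + B := by
      simp only [Finset.sum_sub_distrib, Finset.sum_const, nsmul_eq_mul, hc]
      rw [hB]
      ring
    rw [s1, s2]
    push_cast
    ring

end JY

namespace JY

section gauss
variable {E : Type*} [NormedAddCommGroup E] [InnerProductSpace ℝ E] [FiniteDimensional ℝ E]
  [MeasurableSpace E] [BorelSpace E]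

lemma std_density : ∃ c : ℝ, 0 < c ∧ stdGaussian E =
    (volume : Measure E).withDensity (fun x => ENNReal.ofReal (c * Real.exp (-(1/2) * ‖x‖ ^ 2))) := by
  have hI : ∫ v : E, Real.exp (-(1/2) * ‖v‖ ^ 2) = (Real.pi / (1/2)) ^ (Module.finrank ℝ E / 2 : ℝ) :=
    GaussianFourier.integral_rexp_neg_mul_sq_norm (by norm_num)
  have hIpos : 0 < ∫ v : E, Real.exp (-(1/2) * ‖v‖ ^ 2) := by
    rw [hI]; have := Real.pi_pos; positivity
  set J := ∫ v : E, Real.exp (-(1/2) * ‖v‖ ^ 2) with hJ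
  have hint : Integrable (fun v : E => Real.exp (-(1/2) * ‖v‖ ^ 2)) := by
    by_contra h
    rw [hJ, integral_undef h] at hIpos
    exact lt_irrefl _ hIpos
  refine ⟨J⁻¹, by positivity, ?_⟩
  have : IsFiniteMeasure ((volume : Measure E).withDensity (fun x => ENNReal.ofReal (J⁻¹ * Real.exp (-(1/2) * ‖x‖ ^ 2)))) :=
    isFiniteMeasure_withDensity_ofReal (hint.const_mul _).2
  apply Measure.ext_of_charFun
  ext t
  rw [charFun_stdGaussian, charFun_apply, integral_withDensity_eq_integral_toReal_smul (by fun_prop) (by simp)]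
  have e : ∀ x : E, (ENNReal.ofReal (J⁻¹ * Real.exp (-(1/2) * ‖x‖ ^ 2))).toReal •
      Complex.exp (((inner ℝ x t : ℝ) : ℂ) * Complex.I) =
      ((J⁻¹ : ℝ) : ℂ) * Complex.exp (-((1/2 : ℝ) : ℂ) * ‖x‖ ^ 2 + Complex.I * ((inner ℝ t x : ℝ) : ℂ)) := by
    intro x
    rw [ENNReal.toReal_ofReal (by positivity), Complex.real_smul, real_inner_comm, Complex.exp_add]
    push_cast
    ring_nf
  simp_rw [e]
  rw [integral_const_mul, GaussianFourier.integral_cexp_neg_mul_sq_norm_add (by norm_num)]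
  have e2 : ((J : ℝ) : ℂ) = (Real.pi / ((1/2 : ℝ) : ℂ)) ^ (Module.finrank ℝ E / 2 : ℂ) := by
    rw [hI, Complex.ofReal_cpow (by have := Real.pi_pos; positivity)]
    push_cast; rfl
  rw [← e2, ← mul_assoc, ← Complex.ofReal_mul, inv_mul_cancel₀ hIpos.ne', Complex.ofReal_one, one_mul]
  congr 1
  rw [Complex.I_sq]
  push_cast
  ring

lemma std_map_proj (K : Submodule ℝ E) :
    (stdGaussian E).map K.orthogonalProjectionOnto = stdGaussian K := by
  have hm : Measurable K.orthogonalProjectionOnto := K.orthogonalProjectionOnto.continuous.measurable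
  have : IsProbabilityMeasure ((stdGaussian E).map K.orthogonalProjectionOnto) :=
    Measure.isProbabilityMeasure_map hm.aemeasurable
  apply Measure.ext_of_charFun
  ext t
  rw [charFun_stdGaussian, charFun_apply, integral_map hm.aemeasurable (by fun_prop)]
  have e : ∀ x : E, inner ℝ (K.orthogonalProjectionOnto x) t = inner ℝ x (t : E) := fun x => by
    simp
  simp_rw [e]
  rw [← charFun_apply, charFun_stdGaussian]
  simp

lemma std_ac : stdGaussian E ≪ (volume : Measure E) := by
  obtain ⟨c, _, h⟩ := std_density (E := E)
  rw [h]
  exact withDensity_absolutelyContinuous _ _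

lemma std_submodule_null (K : Submodule ℝ E) (hK : K ≠ ⊤) : stdGaussian E (K : Set E) = 0 :=
  std_ac (Measure.addHaar_submodule _ K hK)

/-- polar factorization -/
lemma polar [Nontrivial E] (g : E → ℂ) (h : ℝ → ℂ) (hg : ∀ (x : E) (r : ℝ), 0 < r → g (r • x) = g x) :
    ∫ x, g x * h ‖x‖ ∂(stdGaussian E) = (∫ x, g x ∂(stdGaussian E)) * ∫ x, h ‖x‖ ∂(stdGaussian E) := by
  obtain ⟨c, hc, hd⟩ := std_density (E := E)
  set T : (ℝ → ℂ) → ℂ := fun h => ∫ r : Set.Ioi (0:ℝ), h r * ((c * Real.exp (-(1/2) * r.1 ^ 2) : ℝ) : ℂ)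
    ∂(Measure.volumeIoiPow (Module.finrank ℝ E - 1)) with hT
  have main : ∀ (g : E → ℂ) (h : ℝ → ℂ), (∀ (x : E) (r : ℝ), 0 < r → g (r • x) = g x) →
      ∫ x, g x * h ‖x‖ ∂(stdGaussian E) =
        (∫ u : Metric.sphere (0:E) 1, g u ∂((volume : Measure E).toSphere)) * T h := by
    intro g h hg
    rw [hd, integral_withDensity_eq_integral_toReal_smul (by fun_prop) (by simp)]
    set F : E → ℂ := fun x => g x * (h ‖x‖ * ((c * Real.exp (-(1/2) * ‖x‖ ^ 2) : ℝ) : ℂ)) with hF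
    have e1 : ∀ x : E, (ENNReal.ofReal (c * Real.exp (-(1/2) * ‖x‖ ^ 2))).toReal • (g x * h ‖x‖) = F x := by
      intro x
      rw [ENNReal.toReal_ofReal (by positivity), Complex.real_smul, hF]
      ring
    simp_rw [e1]
    calc ∫ x, F x = ∫ x : ({(0:E)}ᶜ : Set E), F x.1 ∂((volume : Measure E).comap (↑)) := by
          rw [integral_subtype_comap (measurableSet_singleton _).compl fun x ↦ F x,
            restrict_compl_singleton]
      _ = ∫ x, g x.1 * (h x.2 * ((c * Real.exp (-(1/2) * x.2.1 ^ 2) : ℝ) : ℂ))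
            ∂(volume : Measure E).toSphere.prod (.volumeIoiPow (Module.finrank ℝ E - 1)) := by
          rw [← (volume : Measure E).measurePreserving_homeomorphUnitSphereProd.integral_comp
            (Homeomorph.measurableEmbedding _)]
          refine integral_congr_ae (ae_of_all _ fun x => ?_)
          have hx : (x : E) ≠ 0 := x.2
          simp only [hF, homeomorphUnitSphereProd_apply_snd_coe, homeomorphUnitSphereProd_apply_fst_coe]
          rw [hg _ _ (by positivity)]
      _ = _ := by
          rw [integral_prod_mul (fun u : Metric.sphere (0:E) 1 => g u)
            (fun r : Set.Ioi (0:ℝ) => h r * ((c * Real.exp (-(1/2) * r.1 ^ 2) : ℝ) : ℂ))]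
  have m1 := main (fun _ => 1) (fun _ => 1) (fun _ _ _ => rfl)
  have m2 := main g (fun _ => 1) hg
  have m3 := main (fun _ => 1) h (fun _ _ _ => rfl)
  have m4 := main g h hg
  simp only [one_mul, mul_one] at m1 m2 m3
  rw [m4, m2, m3]
  simp only [integral_const, probReal_univ, one_smul] at m1
  simp only [integral_const]
  linear_combination (-(∫ u : Metric.sphere (0:E) 1, g u ∂((volume : Measure E).toSphere)) * T h) * (-1) * m1

lemma radial_int (d : ℕ) (hd : 0 < d) (t : ℝ) :
    ∫ y in Set.Ioi (0:ℝ), y ^ (d - 1) • (Complex.exp (Complex.I * t * ((Real.log (y ^ 2) : ℝ) : ℂ)) *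
      ((Real.exp (-(1/2) * y ^ 2) : ℝ) : ℂ)) =
    (1/2) * (2 : ℂ) ^ (((d / 2 : ℝ) : ℂ) + Complex.I * t) * Complex.Gamma (((d / 2 : ℝ) : ℂ) + Complex.I * t) := by
  have hre : 0 < (((d / 2 : ℝ) : ℂ) + Complex.I * t).re := by simp; exact hd
  have h := Complex.integral_cpow_mul_exp_neg_mul_Ioi hre (show (0:ℝ) < 1/2 by norm_num)
  rw [← integral_comp_rpow_Ioi_of_pos (p := 2) (by norm_num)] at h
  have e0 : (1 / ((1/2 : ℝ) : ℂ)) = 2 := by push_cast; norm_num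
  rw [e0] at h
  rw [mul_assoc, ← h, ← integral_const_mul]
  refine setIntegral_congr_fun measurableSet_Ioi fun y hy => ?_
  have hy : 0 < y := hy
  have hy2 : (((y ^ (2:ℝ) : ℝ)) : ℂ) ≠ 0 := by
    have : y ^ (2:ℝ) ≠ 0 := by positivity
    exact_mod_cast this
  simp only [Complex.real_smul]
  rw [Complex.cpow_def_of_ne_zero hy2, ← Complex.ofReal_log (by positivity)]
  have el : Real.log (y ^ (2:ℝ)) = 2 * Real.log y := Real.log_rpow hy _
  have el2 : Real.log (y ^ 2) = 2 * Real.log y := by rw [Real.log_pow]; push_cast; ring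
  have ed : ((y ^ (d - 1) : ℝ) : ℂ) = Complex.exp (((d : ℂ) - 1) * ((Real.log y : ℝ) : ℂ)) := by
    rw [show ((d:ℂ) - 1) = ((d - 1 : ℕ) : ℂ) by rw [Nat.cast_sub hd]; simp]
    rw [Complex.exp_nat_mul, ← Complex.ofReal_exp, Real.exp_log hy]; push_cast; rfl
  have ey : ((2 * y ^ ((2:ℝ) - 1) : ℝ) : ℂ) = 2 * Complex.exp ((Real.log y : ℝ) : ℂ) := by
    rw [← Complex.ofReal_exp, Real.exp_log hy]; norm_num
  have e2 : y ^ (2:ℝ) = y ^ 2 := Real.rpow_two y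
  rw [el, el2, ed, ey, e2]
  push_cast
  rw [show ∀ a b c : ℂ, 1 / 2 * (2 * a * (b * c)) = a * (b * c) from fun a b c => by ring]
  rw [← Complex.exp_add, ← Complex.exp_add, ← Complex.exp_add, ← Complex.exp_add]
  congr 1
  ring

lemma norm_moment [Nontrivial E] (t : ℝ) :
    ∫ x, Complex.exp (Complex.I * t * ((Real.log (‖x‖ ^ 2) : ℝ) : ℂ)) ∂(stdGaussian E) =
      (2 : ℂ) ^ (Complex.I * t) * Gr (Module.finrank ℝ E) t := by
  obtain ⟨c, hc, hd⟩ := std_density (E := E)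
  have hpos : 0 < Module.finrank ℝ E := Module.finrank_pos
  have main : ∀ t : ℝ, ∫ x, Complex.exp (Complex.I * t * ((Real.log (‖x‖ ^ 2) : ℝ) : ℂ)) ∂(stdGaussian E) =
      (c * (Module.finrank ℝ E * (volume : Measure E).real (Metric.ball 0 1))) *
      ((1/2) * (2 : ℂ) ^ (((Module.finrank ℝ E / 2 : ℝ) : ℂ) + Complex.I * t) *
        Complex.Gamma (((Module.finrank ℝ E / 2 : ℝ) : ℂ) + Complex.I * t)) := by
    intro t
    rw [hd, integral_withDensity_eq_integral_toReal_smul (by fun_prop) (by simp)]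
    have e1 : ∀ x : E, (ENNReal.ofReal (c * Real.exp (-(1/2) * ‖x‖ ^ 2))).toReal •
        Complex.exp (Complex.I * t * ((Real.log (‖x‖ ^ 2) : ℝ) : ℂ)) =
        (c : ℂ) * (fun y : ℝ => (Complex.exp (Complex.I * t * ((Real.log (y ^ 2) : ℝ) : ℂ)) *
      ((Real.exp (-(1/2) * y ^ 2) : ℝ) : ℂ))) ‖x‖ := by
      intro x
      rw [ENNReal.toReal_ofReal (by positivity), Complex.real_smul]
      push_cast
      ring
    simp_rw [e1]
    rw [integral_const_mul, integral_fun_norm_addHaar (volume : Measure E) (fun y : ℝ => (Complex.exp (Complex.I * t * ((Real.log (y ^ 2) : ℝ) : ℂ)) *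
      ((Real.exp (-(1/2) * y ^ 2) : ℝ) : ℂ))), radial_int _ hpos]
    simp only [nsmul_eq_mul, Complex.real_smul]
    ring
  have m0 := main 0
  have mt := main t
  simp only [Complex.ofReal_zero, mul_zero, zero_mul, Complex.exp_zero, integral_const, probReal_univ,
    one_smul, add_zero] at m0
  rw [mt, Gr]
  have hG : Complex.Gamma ((Module.finrank ℝ E / 2 : ℝ) : ℂ) ≠ 0 :=
    Complex.Gamma_ne_zero_of_re_pos (by rw [Complex.ofReal_re]; positivity)
  rw [Complex.cpow_add _ _ (by norm_num)]
  rw [← mul_div_assoc, eq_div_iff hG]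
  linear_combination (-(2 : ℂ) ^ (Complex.I * t) * Complex.Gamma (((Module.finrank ℝ E / 2 : ℝ) : ℂ) + Complex.I * t)) * m0

lemma col_moment (K : Submodule ℝ E) [Nontrivial K] (t : ℝ) :
    ∫ x, Complex.exp (Complex.I * t * ((Real.log (‖K.orthogonalProjectionOnto x‖ ^ 2 / ‖x‖ ^ 2) : ℝ) : ℂ))
      ∂(stdGaussian E) = Gr (Module.finrank ℝ K) t / Gr (Module.finrank ℝ E) t := by
  have : Nontrivial E := Function.Injective.nontrivial (Subtype.val_injective (p := fun x => x ∈ K))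
  have h1 := polar (E := E) (fun x => Complex.exp (Complex.I * t *
      ((Real.log (‖K.orthogonalProjectionOnto x‖ ^ 2 / ‖x‖ ^ 2) : ℝ) : ℂ)))
    (fun r => Complex.exp (Complex.I * t * ((Real.log (r ^ 2) : ℝ) : ℂ))) (by
      intro x r hr
      have : ‖K.orthogonalProjectionOnto (r • x)‖ ^ 2 / ‖r • x‖ ^ 2 =
          ‖K.orthogonalProjectionOnto x‖ ^ 2 / ‖x‖ ^ 2 := by
        rw [map_smul, norm_smul, norm_smul, mul_pow, mul_pow, mul_div_mul_left]
        have : ‖r‖ ≠ 0 := by simpa using hr.ne'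
        positivity
      simp only [this])
  rw [norm_moment] at h1
  have hm : Measurable K.orthogonalProjectionOnto := K.orthogonalProjectionOnto.continuous.measurable
  have h2 : ∫ x, Complex.exp (Complex.I * t *
      ((Real.log (‖K.orthogonalProjectionOnto x‖ ^ 2 / ‖x‖ ^ 2) : ℝ) : ℂ)) *
      Complex.exp (Complex.I * t * ((Real.log (‖x‖ ^ 2) : ℝ) : ℂ)) ∂(stdGaussian E) =
      (2 : ℂ) ^ (Complex.I * t) * Gr (Module.finrank ℝ K) t := by
    rw [← norm_moment (E := K), ← std_map_proj, integral_map hm.aemeasurable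
      (Measurable.aestronglyMeasurable (by fun_prop))]
    have hKne : Kᗮ ≠ ⊤ := by
      intro h
      rw [Submodule.orthogonal_eq_top_iff] at h
      subst h
      exact not_nontrivial _ ‹Nontrivial (⊥ : Submodule ℝ E)›
    have hae : ∀ᵐ x ∂(stdGaussian E), x ∉ (Kᗮ : Set E) := by
      rw [ae_iff]
      simpa using std_submodule_null Kᗮ hKne
    refine integral_congr_ae ?_
    filter_upwards [hae] with x hx
    have hp : K.orthogonalProjectionOnto x ≠ 0 := by
      rw [Ne, Submodule.orthogonalProjectionOnto_eq_zero_iff]; exact hx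
    have hx0 : x ≠ 0 := by rintro rfl; simp at hp
    rw [← Complex.exp_add, ← mul_add, ← Complex.ofReal_add, Real.log_div (by positivity) (by positivity)]
    congr 4
    ring
  rw [h2] at h1
  have hG := Gr_ne_zero (Module.finrank ℝ E) Module.finrank_pos t
  have h20 : (2 : ℂ) ^ (Complex.I * t) ≠ 0 := by
    rw [Complex.cpow_def_of_ne_zero (by norm_num)]; exact Complex.exp_ne_zero _
  rw [eq_div_iff hG]
  apply mul_left_cancel₀ h20
  rw [h1]; ring

end gauss
end JY

namespace JY

section gram
variable {W : Type*} [NormedAddCommGroup W] [InnerProductSpace ℝ W] [FiniteDimensional ℝ W]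

lemma det_gram_orth {p : ℕ} (u : W) (w : Fin p → W) (h : ∀ i, inner ℝ u (w i) = 0) :
    (gram ℝ (Fin.cons u w : Fin (p+1) → W)).det = ‖u‖ ^ 2 * (gram ℝ w).det := by
  rw [det_succ_row_zero, Fin.sum_univ_succ, Finset.sum_eq_zero]
  · simp [gram_apply]
    left
    congr 1
  · intro i _
    simp [gram_apply, h]

lemma det_gram_add {p : ℕ} (u : W) (w : Fin p → W) (c : Fin p → ℝ) :
    (gram ℝ (Fin.cons (u + ∑ i, c i • w i) w : Fin (p+1) → W)).det =
      (gram ℝ (Fin.cons u w : Fin (p+1) → W)).det := by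
  set T : Matrix (Fin (p+1)) (Fin (p+1)) ℝ :=
    Matrix.of (Fin.cons (Fin.cons 1 c) (fun i => Fin.cons 0 (Pi.single i 1))) with hT
  have hdet : T.det = 1 := by
    rw [det_succ_column_zero, Fin.sum_univ_succ, Finset.sum_eq_zero]
    · simp [hT]
      have : (T.submatrix Fin.succ Fin.succ) = 1 := by
        ext i j
        simp [hT, Matrix.one_apply, Pi.single_apply, eq_comm]
      simpa [hT] using congrArg Matrix.det this
    · intro i _
      simp [hT]
  have hvec : ∀ i, (Fin.cons (u + ∑ i, c i • w i) w : Fin (p+1) → W) i =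
      ∑ k, T i k • (Fin.cons u w : Fin (p+1) → W) k := by
    intro i
    refine Fin.cases ?_ (fun i => ?_) i
    · simp [hT, Fin.sum_univ_succ]
    · simp [hT, Fin.sum_univ_succ, Pi.single_apply]
  have : gram ℝ (Fin.cons (u + ∑ i, c i • w i) w : Fin (p+1) → W) =
      T * gram ℝ (Fin.cons u w : Fin (p+1) → W) * Tᵀ := by
    ext i j
    rw [gram_apply, hvec, hvec, sum_inner]
    simp only [inner_sum, Matrix.mul_apply, gram_apply, inner_smul_left, inner_smul_right, transpose_apply, Finset.sum_mul]
    rw [Finset.sum_comm]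
    refine Finset.sum_congr rfl fun a _ => Finset.sum_congr rfl fun b _ => ?_
    simp; ring
  rw [this]; simp [hdet]

lemma det_gram_cons {p : ℕ} (z : W) (w : Fin p → W) :
    (gram ℝ (Fin.cons z w : Fin (p+1) → W)).det =
      ‖(Submodule.span ℝ (Set.range w))ᗮ.orthogonalProjectionOnto z‖ ^ 2 * (gram ℝ w).det := by
  set V := Submodule.span ℝ (Set.range w) with hV
  have h1 : z = (Vᗮ.orthogonalProjectionOnto z : W) + V.orthogonalProjectionOnto z := by
    have := V.starProjection_add_starProjection_orthogonal z
    simp only [Submodule.starProjection_apply] at this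
    rw [add_comm]; exact this.symm
  have h2 : (V.orthogonalProjectionOnto z : W) ∈ V := Subtype.mem _
  obtain ⟨c, hc⟩ := (Submodule.mem_span_range_iff_exists_fun ℝ).1 h2
  conv_lhs => rw [h1, ← hc]
  rw [det_gram_add, det_gram_orth]
  · simp
  · intro i
    exact Submodule.inner_left_of_mem_orthogonal (K := V) (Submodule.subset_span ⟨i, rfl⟩) (Subtype.mem _)

/-- correlation matrix of vectors -/
noncomputable def cor {p : ℕ} (w : Fin p → W) : Matrix (Fin p) (Fin p) ℝ :=
  Matrix.of fun i j => inner ℝ (w i) (w j) / Real.sqrt (‖w i‖ ^ 2 * ‖w j‖ ^ 2)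

lemma det_cor {p : ℕ} (w : Fin p → W) :
    (cor w).det = (gram ℝ w).det * ∏ i, (1 / ‖w i‖ ^ 2) := by
  have : cor w = Matrix.diagonal (fun i => (‖w i‖)⁻¹) * gram ℝ w * Matrix.diagonal (fun i => (‖w i‖)⁻¹) := by
    ext i j
    simp [cor, Matrix.mul_apply, Matrix.diagonal_apply, gram_apply, div_eq_mul_inv]
    ring
  rw [this, det_mul, det_mul, det_diagonal]
  have : ∏ i, (1 / ‖w i‖ ^ 2) = (∏ i, ‖w i‖⁻¹) * ∏ i, ‖w i‖⁻¹ := by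
    rw [← Finset.prod_mul_distrib]
    refine Finset.prod_congr rfl fun i _ => ?_
    rw [one_div, sq, mul_inv]
  rw [this]; ring

lemma det_cor_cons {p : ℕ} (z : W) (w : Fin p → W) :
    (cor (Fin.cons z w : Fin (p+1) → W)).det =
      (‖(Submodule.span ℝ (Set.range w))ᗮ.orthogonalProjectionOnto z‖ ^ 2 / ‖z‖ ^ 2) * (cor w).det := by
  rw [det_cor, det_cor, det_gram_cons, Fin.prod_univ_succ]
  simp only [Fin.cons_zero, Fin.cons_succ]
  ring

end gram

section ind
variable {W : Type*} [NormedAddCommGroup W] [InnerProductSpace ℝ W] [FiniteDimensional ℝ W]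
  [MeasurableSpace W] [BorelSpace W]

lemma measurable_det_cor (p : ℕ) : Measurable fun w : Fin p → W => (cor w).det := by
  have : SecondCountableTopology W := inferInstance
  unfold cor
  simp only [det_apply, Matrix.of_apply]
  refine Finset.measurable_sum _ fun s _ => ?_
  refine Measurable.const_smul (Finset.measurable_prod _ fun i _ => ?_) _
  fun_prop

lemma pi_succ (p : ℕ) : MeasurePreserving (fun q : (Fin p → W) × W => (Fin.cons q.2 q.1 : Fin (p+1) → W))
    ((Measure.pi fun _ : Fin p => stdGaussian W).prod (stdGaussian W))
    (Measure.pi fun _ : Fin (p+1) => stdGaussian W) := by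
  have mp := (measurePreserving_piFinSuccAbove (fun _ : Fin (p+1) => stdGaussian W) 0).symm
  have := mp.comp (Measure.measurePreserving_swap (μ := Measure.pi fun _ : Fin p => stdGaussian W) (ν := stdGaussian W))
  convert this using 1
  ext q
  simp [MeasurableEquiv.piFinSuccAbove]

lemma perp_ne {p : ℕ} (h : p < Module.finrank ℝ W) (w : Fin p → W) :
    Submodule.span ℝ (Set.range w) ≠ ⊤ := by
  intro hh
  have := finrank_range_le_card (R := ℝ) w
  rw [Set.finrank, hh, finrank_top] at this
  simp at this; omega

lemma ratio_ne (V : Submodule ℝ W) (z : W) (hz : z ∉ V) :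
    ‖Vᗮ.orthogonalProjectionOnto z‖ ^ 2 / ‖z‖ ^ 2 ≠ 0 := by
  have hz0 : z ≠ 0 := by rintro rfl; exact hz (zero_mem _)
  refine div_ne_zero ?_ (by simpa using hz0)
  simp only [ne_eq, OfNat.ofNat_ne_zero, not_false_eq_true, pow_eq_zero_iff, norm_eq_zero]
  intro h
  rw [Submodule.orthogonalProjectionOnto_eq_zero_iff, Submodule.orthogonal_orthogonal] at h
  exact hz h

lemma ae_cor (p : ℕ) (h : p ≤ Module.finrank ℝ W) :
    ∀ᵐ w ∂(Measure.pi fun _ : Fin p => stdGaussian W), (cor w).det ≠ 0 := by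
  induction p with
  | zero => simp
  | succ p ih =>
    specialize ih (by omega)
    have hm0 : MeasurableSet {w : Fin (p+1) → W | (cor w).det ≠ 0} :=
      (measurableSet_eq_fun (measurable_det_cor _) measurable_const).compl
    rw [← (pi_succ p).map_eq, ae_map_iff (pi_succ p).measurable.aemeasurable hm0]
    refine (Measure.ae_prod_iff_ae_ae ((pi_succ p).measurable hm0)).2 ?_
    filter_upwards [ih] with w hw
    have h0 : ∀ᵐ z ∂(stdGaussian W), z ∉ Submodule.span ℝ (Set.range w) := by
      rw [ae_iff]; simpa using std_submodule_null _ (perp_ne (by omega) w)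
    filter_upwards [h0] with z hz
    simp only [det_cor_cons]
    exact mul_ne_zero (ratio_ne _ z hz) hw

lemma cor_moment (p : ℕ) (h : p ≤ Module.finrank ℝ W) (t : ℝ) :
    ∫ w, Complex.exp (Complex.I * t * ((Real.log (cor w).det : ℝ) : ℂ))
      ∂(Measure.pi fun _ : Fin p => stdGaussian W) =
    ∏ k ∈ Finset.Ioc (Module.finrank ℝ W - p) (Module.finrank ℝ W), (Gr k t / Gr (Module.finrank ℝ W) t) := by
  induction p with
  | zero => simp
  | succ p ih =>
    specialize ih (by omega)
    have hmeas : ∀ p, Measurable fun w : Fin p → W =>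
        Complex.exp (Complex.I * t * ((Real.log (cor w).det : ℝ) : ℂ)) := by
      intro p
      have := measurable_det_cor (W := W) p
      fun_prop
    rw [← (pi_succ p).map_eq, integral_map (pi_succ p).measurable.aemeasurable (hmeas _).aestronglyMeasurable]
    rw [integral_prod]
    swap
    · refine Integrable.of_bound (C := 1) ((hmeas _).comp (pi_succ p).measurable).aestronglyMeasurable ?_
      refine Eventually.of_forall fun q => ?_
      rw [mul_assoc, mul_comm, ← Complex.ofReal_mul, Complex.norm_exp_ofReal_mul_I]
    have e : ∀ᵐ w ∂(Measure.pi fun _ : Fin p => stdGaussian W),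
        ∫ z, Complex.exp (Complex.I * t * ((Real.log (cor (Fin.cons z w : Fin (p+1) → W)).det : ℝ) : ℂ)) ∂(stdGaussian W)
        = (Gr (Module.finrank ℝ W - p) t / Gr (Module.finrank ℝ W) t) *
          Complex.exp (Complex.I * t * ((Real.log (cor w).det : ℝ) : ℂ)) := by
      filter_upwards [ae_cor p (by omega)] with w hw
      have hli : LinearIndependent ℝ w := by
        rw [det_cor] at hw
        exact det_gram_ne_zero_iff_linearIndependent.1 (left_ne_zero_of_mul hw)
      set V := Submodule.span ℝ (Set.range w) with hV
      have h0 : ∀ᵐ z ∂(stdGaussian W), z ∉ V := by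
        rw [ae_iff]; simpa using std_submodule_null _ (perp_ne (by omega) w)
      have hfr : Module.finrank ℝ V = p := by
        rw [hV, finrank_span_eq_card hli]; simp
      have hfr2 : Module.finrank ℝ Vᗮ = Module.finrank ℝ W - p := by
        have := V.finrank_add_finrank_orthogonal
        omega
      have : Nontrivial Vᗮ := Module.nontrivial_of_finrank_pos (R := ℝ) (by omega)
      rw [← hfr2, ← col_moment Vᗮ t, ← integral_mul_const]
      refine integral_congr_ae ?_
      filter_upwards [h0] with z hz
      rw [← Complex.exp_add, det_cor_cons, Real.log_mul (ratio_ne _ z hz) hw]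
      congr 1; push_cast; ring
    rw [integral_congr_ae e, integral_const_mul, ih]
    have : Finset.Ioc (Module.finrank ℝ W - (p+1)) (Module.finrank ℝ W) =
        insert (Module.finrank ℝ W - p) (Finset.Ioc (Module.finrank ℝ W - p) (Module.finrank ℝ W)) := by
      ext a; simp only [Finset.mem_Ioc, Finset.mem_insert]; omega
    rw [this, Finset.prod_insert (by simp)]

end ind
end JY

namespace JY

/-- the constant-one vector -/
noncomputable def onev (n : ℕ) : EuclideanSpace ℝ (Fin n) := WithLp.toLp 2 (fun _ => 1)

/-- orthogonal complement of constants -/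
noncomputable abbrev WW (n : ℕ) : Submodule ℝ (EuclideanSpace ℝ (Fin n)) := (Submodule.span ℝ {onev n})ᗮ

lemma finrank_WW (n : ℕ) (hn : 1 ≤ n) : Module.finrank ℝ (WW n) = n - 1 := by
  have h0 : onev n ≠ 0 := by
    intro h
    have := congrArg (fun v : EuclideanSpace ℝ (Fin n) => v ⟨0, hn⟩) h
    simp [onev] at this
  have h1 := (Submodule.span ℝ {onev n}).finrank_add_finrank_orthogonal
  rw [finrank_span_singleton h0, finrank_euclideanSpace_fin] at h1
  show Module.finrank ℝ (Submodule.span ℝ {onev n})ᗮ = n - 1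
  exact Nat.eq_sub_of_add_eq' h1

/-- centered and scaled column -/
noncomputable def colmap (n : ℕ) (s : ℝ) (x : Fin n → ℝ) : WW n :=
  s⁻¹ • (WW n).orthogonalProjectionOnto (WithLp.toLp 2 x)

lemma measurable_colmap (n : ℕ) (s : ℝ) : Measurable (colmap n s) := by
  unfold colmap
  have : Continuous fun x : Fin n → ℝ => (WW n).orthogonalProjectionOnto (WithLp.toLp 2 x) := by fun_prop
  exact (this.const_smul (s⁻¹ : ℝ)).measurable

lemma colmap_affine (n : ℕ) (s m : ℝ) (hs : s ≠ 0) (x : Fin n → ℝ) :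
    colmap n s (fun i => s * x i + m) = (WW n).orthogonalProjectionOnto (WithLp.toLp 2 x) := by
  have : (WithLp.toLp 2 (fun i => s * x i + m) : EuclideanSpace ℝ (Fin n)) = s • WithLp.toLp 2 x + m • onev n := by
    ext i; simp [onev]
  have h2 : (WW n).orthogonalProjectionOnto (onev n) = 0 := by
    rw [Submodule.orthogonalProjectionOnto_eq_zero_iff, Submodule.orthogonal_orthogonal]
    exact Submodule.mem_span_singleton_self _
  unfold colmap
  rw [this, map_add, map_smul, map_smul, h2, smul_zero, add_zero, smul_smul, inv_mul_cancel₀ hs, one_smul]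

lemma map_colmap (n : ℕ) (m : ℝ) (s : ℝ≥0) (hs : 0 < s) :
    (Measure.pi fun _ : Fin n => gaussianReal m (s ^ 2)).map (colmap n s) = stdGaussian (WW n) := by
  have h1 : gaussianReal m (s ^ 2) = (gaussianReal 0 1).map (fun x => (s : ℝ) * x + m) := by
    have := (gaussianReal_map_const_mul (μ := 0) (v := 1) (s : ℝ))
    have h2 := gaussianReal_map_add_const (μ := (s : ℝ) * 0) (v := NNReal.mk ((s : ℝ) ^ 2) (sq_nonneg _) * 1) m
    rw [← this, Measure.map_map (by fun_prop) (by fun_prop)] at h2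
    have e : (NNReal.mk ((s : ℝ) ^ 2) (sq_nonneg _) * 1 : ℝ≥0) = s ^ 2 := by ext; simp
    rw [e] at h2
    simpa [Function.comp_def] using h2.symm
  have h3 : (Measure.pi fun _ : Fin n => gaussianReal m (s ^ 2)) =
      (Measure.pi fun _ : Fin n => gaussianReal 0 1).map (fun x i => (s : ℝ) * x i + m) := by
    have : ∀ i : Fin n, SigmaFinite ((gaussianReal 0 1).map (fun x => (s : ℝ) * x + m)) := by
      intro i; rw [← h1]; infer_instance
    rw [Measure.pi_map_pi (μ := fun _ : Fin n => gaussianReal 0 1) (f := fun _ x => (s : ℝ) * x + m) (fun i => by fun_prop)]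
    simp_rw [h1]
  rw [h3, Measure.map_map (measurable_colmap _ _) (by fun_prop)]
  have : colmap n s ∘ (fun (x : Fin n → ℝ) i => (s : ℝ) * x i + m) =
      (WW n).orthogonalProjectionOnto ∘ (WithLp.toLp 2) := by
    ext1 x
    exact colmap_affine n s m (by exact_mod_cast hs.ne') x
  rw [this, ← Measure.map_map (by fun_prop) (by fun_prop), map_pi_eq_stdGaussian, std_map_proj]

lemma pi_swap (n p : ℕ) (ν : Fin p → Measure ℝ) [∀ j, IsProbabilityMeasure (ν j)] :
    (Measure.pi fun j : Fin p => Measure.pi fun _ : Fin n => ν j).map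
      (fun (u : Fin p → Fin n → ℝ) (q : Fin n × Fin p) => u q.2 q.1) =
    Measure.pi fun q : Fin n × Fin p => ν q.2 := by
  symm
  apply Measure.pi_eq
  intro s hs
  rw [Measure.map_apply (by fun_prop) (MeasurableSet.univ_pi hs)]
  have : (fun (u : Fin p → Fin n → ℝ) (q : Fin n × Fin p) => u q.2 q.1) ⁻¹' (Set.univ.pi s) =
      Set.univ.pi fun j => Set.univ.pi fun a => s (a, j) := by
    ext u; simp only [Set.mem_preimage, Set.mem_pi, Set.mem_univ, true_imp_iff, Prod.forall]
    exact forall_comm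
  rw [this, Measure.pi_pi]
  simp_rw [Measure.pi_pi]
  rw [Fintype.prod_prod_type, Finset.prod_comm]

/-- the whole map -/
noncomputable def Phi (n p : ℕ) (s : Fin p → ℝ≥0) (ω : Fin n × Fin p → ℝ) : Fin p → WW n :=
  fun j => colmap n (s j) (fun a => ω (a, j))

lemma measurable_Phi (n p : ℕ) (s : Fin p → ℝ≥0) : Measurable (Phi n p s) := by
  refine measurable_pi_lambda _ fun j => ?_
  exact (measurable_colmap n (s j)).comp (by fun_prop)

lemma map_Phi (n p : ℕ) (m : Fin p → ℝ) (s : Fin p → ℝ≥0) (hs : ∀ j, 0 < s j) :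
    (Measure.pi fun q : Fin n × Fin p => gaussianReal (m q.2) ((s q.2) ^ 2)).map (Phi n p s) =
      Measure.pi fun _ : Fin p => stdGaussian (WW n) := by
  rw [← pi_swap n p (fun j => gaussianReal (m j) ((s j)^2)), Measure.map_map (measurable_Phi _ _ _) (by fun_prop)]
  have h := Measure.pi_map_pi (μ := fun j : Fin p => Measure.pi fun _ : Fin n => gaussianReal (m j) ((s j)^2))
    (f := fun j => colmap n (s j)) (hμ := fun j => by rw [map_colmap n _ _ (hs j)]; infer_instance)
    (fun j => (measurable_colmap n (s j)).aemeasurable)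
  simp_rw [map_colmap n _ _ (hs _)] at h
  exact h

lemma proj_apply (n : ℕ) (x : Fin n → ℝ) (i : Fin n) :
    ((WW n).orthogonalProjectionOnto (WithLp.toLp 2 x) : EuclideanSpace ℝ (Fin n)) i = x i - (∑ j, x j) / n := by
  have h1 := (Submodule.span ℝ {onev n}).starProjection_add_starProjection_orthogonal (WithLp.toLp 2 x)
  have h2 : (Submodule.span ℝ {onev n}).starProjection (WithLp.toLp 2 x) = ((∑ j, x j) / n) • onev n := by
    rw [Submodule.starProjection_singleton]
    congr 1
    rw [EuclideanSpace.norm_sq_eq]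
    simp [onev, PiLp.inner_apply]
  rw [h2] at h1
  have := congrArg (fun v : EuclideanSpace ℝ (Fin n) => v i) h1
  simp only [Submodule.coe_orthogonalProjectionOnto_apply]
  simp only [PiLp.add_apply, PiLp.smul_apply, onev, smul_eq_mul, mul_one] at this
  rw [eq_sub_iff_add_eq, add_comm]
  exact this

lemma inner_colmap (n : ℕ) (s r : ℝ) (x y : Fin n → ℝ) :
    inner ℝ (colmap n s x) (colmap n r y) = s⁻¹ * r⁻¹ * ∑ i, (x i - (∑ j, x j) / n) * (y i - (∑ j, y j) / n) := by
  unfold colmap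
  rw [inner_smul_left, inner_smul_right, Submodule.coe_inner, PiLp.inner_apply]
  simp only [proj_apply]
  simp [mul_comm, mul_assoc]

lemma cor_Phi (n p : ℕ) (s : Fin p → ℝ≥0) (hs : ∀ j, 0 < s j) (ω : Fin n × Fin p → ℝ) (i j : Fin p) :
    cor (Phi n p s ω) i j =
    (∑ a, (ω (a, i) - (∑ b, ω (b, i)) / n) * (ω (a, j) - (∑ b, ω (b, j)) / n)) /
    Real.sqrt ((∑ a, (ω (a, i) - (∑ b, ω (b, i)) / n) ^ 2) * (∑ a, (ω (a, j) - (∑ b, ω (b, j)) / n) ^ 2)) := by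
  simp only [cor, Matrix.of_apply, Phi, ← real_inner_self_eq_norm_sq, inner_colmap]
  simp only [← sq]
  set A := ∑ a, (ω (a, i) - (∑ b, ω (b, i)) / n) ^ 2
  set B := ∑ a, (ω (a, j) - (∑ b, ω (b, j)) / n) ^ 2
  have hi : (0:ℝ) < s i := hs i
  have hj : (0:ℝ) < s j := hs j
  have : (s i : ℝ)⁻¹ ^ 2 * A * ((s j : ℝ)⁻¹ ^ 2 * B) = ((s i : ℝ)⁻¹ * (s j : ℝ)⁻¹) ^ 2 * (A * B) := by ring
  rw [this, Real.sqrt_mul (by positivity), Real.sqrt_sq (by positivity)]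
  rw [mul_div_mul_left _ _ (by positivity)]

end JY

namespace JY

lemma sig_pos (n p : ℕ) (hp : 0 < p) (h : p + 5 ≤ n) :
    0 < -2 * ((p : ℝ) / ((n : ℝ) - 1) + Real.log (1 - (p : ℝ) / ((n : ℝ) - 1))) := by
  have hp' : (0:ℝ) < p := by exact_mod_cast hp
  have h' : (p:ℝ) + 5 ≤ n := by exact_mod_cast h
  have hx : (p:ℝ) / ((n : ℝ) - 1) < 1 := by rw [div_lt_one (by linarith)]; linarith
  have hx0 : 0 < (p:ℝ) / ((n : ℝ) - 1) := div_pos hp' (by linarith)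
  have := Real.log_lt_sub_one_of_pos (x := 1 - (p:ℝ) / ((n : ℝ) - 1)) (by linarith) (by linarith)
  linarith

/-- log det of sample correlation -/
noncomputable def ld (n p : ℕ) (ω : Fin n × Fin p → ℝ) : ℝ :=
  Real.log (Matrix.det (Matrix.of fun i j : Fin p =>
    pearsonCorr n (fun a => ω (a, i)) (fun a => ω (a, j))))

lemma ld_eq (n p : ℕ) (s : Fin p → ℝ≥0) (hs : ∀ j, 0 < s j) (ω : Fin n × Fin p → ℝ) :
    ld n p ω = Real.log (cor (Phi n p s ω)).det := by
  unfold ld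
  congr 2
  ext i j
  rw [cor_Phi n p s hs]
  rfl

lemma measurable_ld (n p : ℕ) : Measurable (ld n p) := by
  have : ld n p = fun ω => Real.log (cor (Phi n p (fun _ => 1) ω)).det := by
    ext ω; exact ld_eq n p _ (fun _ => one_pos) ω
  rw [this]
  exact ((measurable_det_cor p).comp (measurable_Phi n p _)).log

lemma char_n (n p : ℕ) (hp : 0 < p) (h : p + 5 ≤ n) (mm : Fin p → ℝ) (sd : Fin p → ℝ≥0) (hs : ∀ j, 0 < sd j)
    (μn σsq : ℝ) (hμ : μn = ((p : ℝ) - n + 3 / 2) * Real.log (1 - (p : ℝ) / ((n : ℝ) - 1))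
        - ((n : ℝ) - 2) / ((n : ℝ) - 1) * p)
    (hσ : σsq = -2 * ((p : ℝ) / ((n : ℝ) - 1) + Real.log (1 - (p : ℝ) / ((n : ℝ) - 1))))
    (s : ℝ) (ht : |s / Real.sqrt σsq| ≤ ((n - 1 - p : ℕ) : ℝ) / 4) :
    ∃ ε : ℂ, ‖ε‖ ≤ 100 * (|s / Real.sqrt σsq| + |s / Real.sqrt σsq| ^ 3) / ((n - 1 - p : ℕ) : ℝ) ∧
      charFun ((Measure.pi fun q : Fin n × Fin p => gaussianReal (mm q.2) ((sd q.2) ^ 2)).map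
        (fun ω => (ld n p ω - μn) / Real.sqrt σsq)) s = Complex.exp (-(s ^ 2 / 2 : ℝ) + ε) := by
  have hpos : 0 < σsq := hσ ▸ sig_pos n p hp h
  have hsq : Real.sqrt σsq ^ 2 = σsq := Real.sq_sqrt hpos.le
  set t := s / Real.sqrt σsq with htdef
  have hst : s ^ 2 / 2 = t ^ 2 * (σsq / 2) := by
    rw [htdef, div_pow, hsq]; field_simp
  obtain ⟨ε, hε, hprod⟩ := prod_Gr (n - 1 - p) (n - 1) t (by omega) (by omega) ht
  refine ⟨ε, hε, ?_⟩
  rw [charFun_apply_real, integral_map (((measurable_ld n p).sub_const _).div_const _).aemeasurable (by fun_prop)]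
  have e1 : ∀ ω : Fin n × Fin p → ℝ, Complex.exp (s * (((ld n p ω - μn) / Real.sqrt σsq : ℝ) : ℂ) * Complex.I) =
      Complex.exp (-(Complex.I * t * μn)) *
        Complex.exp (Complex.I * t * ((Real.log (cor (Phi n p sd ω)).det : ℝ) : ℂ)) := by
    intro ω
    rw [← Complex.exp_add, ← ld_eq n p sd hs, htdef]
    congr 1; push_cast; ring
  simp_rw [e1]
  rw [integral_const_mul]
  have hm : Measurable fun w : Fin p → WW n => Complex.exp (Complex.I * t * ((Real.log (cor w).det : ℝ) : ℂ)) := by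
    have := measurable_det_cor (W := WW n) p
    fun_prop
  have e2 := integral_map (μ := Measure.pi fun q : Fin n × Fin p => gaussianReal (mm q.2) ((sd q.2) ^ 2))
    (measurable_Phi n p sd).aemeasurable hm.aestronglyMeasurable
  rw [← e2, map_Phi n p mm sd hs, cor_moment p (by rw [finrank_WW n (by omega)]; omega), finrank_WW n (by omega), hprod,
    ← Complex.exp_add]
  have hN : ((n - 1 : ℕ) : ℝ) = (n : ℝ) - 1 := by push_cast [Nat.cast_sub (show 1 ≤ n by omega)]; ring
  have hM : ((n - 1 - p : ℕ) : ℝ) = (n : ℝ) - 1 - p := by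
    rw [Nat.cast_sub (show p ≤ n - 1 by omega), hN]
  have h' : (p:ℝ) + 5 ≤ n := by exact_mod_cast h
  have hp' : (0:ℝ) < p := by exact_mod_cast hp
  have hlog : Real.log (1 - (p : ℝ) / ((n : ℝ) - 1)) = Real.log ((n:ℝ) - 1 - p) - Real.log ((n:ℝ)-1) := by
    rw [← Real.log_div (by linarith) (by linarith)]
    congr 1
    have : (n:ℝ) - 1 ≠ 0 := by linarith
    field_simp
  rw [hN, hM]
  have c1 : μn = (1 / 2 - ((n:ℝ) - 1 - p)) * (Real.log ((n:ℝ) - 1 - p) - Real.log ((n:ℝ)-1)) - (((n:ℝ)-1) - ((n:ℝ) - 1 - p))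
      + (((n:ℝ)-1) - ((n:ℝ) - 1 - p)) / ((n:ℝ)-1) := by
    rw [hμ, hlog]
    have : (n:ℝ) - 1 ≠ 0 := by linarith
    field_simp
    ring
  have c2 : s ^ 2 / 2 = t ^ 2 * (Real.log ((n:ℝ)-1) - Real.log ((n:ℝ) - 1 - p) - (((n:ℝ)-1) - ((n:ℝ) - 1 - p)) / ((n:ℝ)-1)) := by
    rw [hst, hσ, hlog]; ring
  rw [← c1, ← c2]
  congr 1; ring

lemma lim_eps (p : ℕ → ℕ) (hp : ∀ n, 0 < p n) (hpn : ∀ n : ℕ, 6 ≤ n → p n + 5 ≤ n)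
    (y : ℝ) (hy : y ∈ Set.Ioc (0 : ℝ) 1)
    (hlim : Tendsto (fun n => (p n : ℝ) / n) atTop (𝓝 y)) (σsq : ℕ → ℝ)
    (hσ : ∀ n : ℕ, σsq n =
      -2 * ((p n : ℝ) / ((n : ℝ) - 1) + Real.log (1 - (p n : ℝ) / ((n : ℝ) - 1)))) (s : ℝ) :
    (∀ᶠ n in atTop, |s / Real.sqrt (σsq n)| ≤ ((n - 1 - p n : ℕ) : ℝ) / 4) ∧
    Tendsto (fun n => 100 * (|s / Real.sqrt (σsq n)| + |s / Real.sqrt (σsq n)| ^ 3) / ((n - 1 - p n : ℕ) : ℝ))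
      atTop (𝓝 0) := by
  have hn : Tendsto (fun n : ℕ => (n : ℝ) - 1) atTop atTop :=
    tendsto_atTop_add_const_right _ _ tendsto_natCast_atTop_atTop
  have hx : Tendsto (fun n => (p n : ℝ) / ((n:ℝ) - 1)) atTop (𝓝 y) := by
    have h1 : Tendsto (fun n : ℕ => 1 + ((n:ℝ) - 1)⁻¹) atTop (𝓝 (1 + 0)) :=
      hn.inv_tendsto_atTop.const_add 1
    have := hlim.mul h1
    rw [add_zero, mul_one] at this
    refine this.congr' ?_
    filter_upwards [eventually_ge_atTop 6] with n h6
    have : (6:ℝ) ≤ n := by exact_mod_cast h6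
    have a : (n:ℝ) - 1 ≠ 0 := by linarith
    have b : (n:ℝ) ≠ 0 := by linarith
    field_simp
    ring
  have hM : ∀ n : ℕ, 6 ≤ n → ((n - 1 - p n : ℕ) : ℝ) = (n : ℝ) - 1 - p n := by
    intro n h6
    have := hpn n h6
    rw [Nat.cast_sub (show p n ≤ n - 1 by omega), Nat.cast_sub (show 1 ≤ n by omega)]; simp
  have hM4 : ∀ n : ℕ, 6 ≤ n → (4:ℝ) ≤ ((n - 1 - p n : ℕ) : ℝ) := by
    intro n h6
    have := hpn n h6
    exact_mod_cast (by omega : 4 ≤ n - 1 - p n)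
  rcases lt_or_eq_of_le hy.2 with hlt | rfl
  · have hmt : Tendsto (fun n => ((n - 1 - p n : ℕ) : ℝ)) atTop atTop := by
      have h1 : Tendsto (fun n : ℕ => ((n:ℝ) - 1) * (1 - (p n : ℝ) / ((n:ℝ) - 1))) atTop atTop :=
        hn.atTop_mul_pos (by linarith : 0 < 1 - y) (hx.const_sub 1)
      refine h1.congr' ?_
      filter_upwards [eventually_ge_atTop 6] with n h6
      rw [hM n h6]
      have : (6:ℝ) ≤ n := by exact_mod_cast h6
      have a : (n:ℝ) - 1 ≠ 0 := by linarith
      field_simp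
    have hs : Tendsto σsq atTop (𝓝 (-2 * (y + Real.log (1 - y)))) := by
      have : σsq = fun n => -2 * ((p n : ℝ) / ((n : ℝ) - 1) + Real.log (1 - (p n : ℝ) / ((n : ℝ) - 1))) := funext hσ
      rw [this]
      exact (hx.add ((hx.const_sub 1).log (by linarith))).const_mul _
    have hpos : 0 < -2 * (y + Real.log (1 - y)) := by
      have := Real.log_lt_sub_one_of_pos (x := 1 - y) (by linarith) (by linarith [hy.1])
      linarith
    have ht : Tendsto (fun n => |s / Real.sqrt (σsq n)|) atTop (𝓝 |s / Real.sqrt (-2 * (y + Real.log (1 - y)))|) :=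
      ((tendsto_const_nhds (x := s)).div hs.sqrt (Real.sqrt_pos.2 hpos).ne').abs
    constructor
    · filter_upwards [ht.eventually (gt_mem_nhds (lt_add_one _)),
        hmt.eventually_ge_atTop (4 * (|s / Real.sqrt (-2 * (y + Real.log (1 - y)))| + 1))] with n h1 h2
      linarith
    · exact ((ht.add (ht.pow 3)).const_mul 100).div_atTop hmt
  · have hs : Tendsto σsq atTop atTop := by
      have : σsq = fun n => -2 * ((p n : ℝ) / ((n : ℝ) - 1) + Real.log (1 - (p n : ℝ) / ((n : ℝ) - 1))) := funext hσ
      rw [this]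
      have h0 : Tendsto (fun n => 1 - (p n : ℝ) / ((n : ℝ) - 1)) atTop (𝓝[>] 0) := by
        refine tendsto_nhdsWithin_iff.2 ⟨by simpa using hx.const_sub 1, ?_⟩
        filter_upwards [eventually_ge_atTop 6] with n h6
        have h5 : (p n : ℝ) + 5 ≤ n := by exact_mod_cast hpn n h6
        have : (6:ℝ) ≤ n := by exact_mod_cast h6
        simp only [Set.mem_Ioi, sub_pos]
        rw [div_lt_one (by linarith)]; linarith
      have h1 := Real.tendsto_log_nhdsGT_zero.comp h0
      exact (hx.add_atBot h1).const_mul_atBot_of_neg (by norm_num)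
    have ht : Tendsto (fun n => |s / Real.sqrt (σsq n)|) atTop (𝓝 0) := by
      have : Tendsto (fun n => s / Real.sqrt (σsq n)) atTop (𝓝 0) :=
        (tendsto_const_nhds (x := s)).div_atTop (Real.tendsto_sqrt_atTop.comp hs)
      simpa using this.abs
    constructor
    · filter_upwards [ht.eventually (gt_mem_nhds one_pos), eventually_ge_atTop 6] with n h1 h6
      linarith [hM4 n h6]
    · have := (ht.add (ht.pow 3)).const_mul 100
      simp only [ne_eq, OfNat.ofNat_ne_zero, not_false_eq_true, zero_pow, add_zero, mul_zero] at this
      refine squeeze_zero' (Eventually.of_forall fun n => by positivity) ?_ this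
      filter_upwards [eventually_ge_atTop 6] with n h6
      exact div_le_self (by positivity) (by linarith [hM4 n h6])

end JY

/-- Jiang–Yang, Corollary 1: CLT for `log det R_n`, `R_n` the sample correlation
matrix of `n` i.i.d. `p`-variate normal observations with diagonal covariance
(entries `x_{ij}` independent, column `j` i.i.d. `N(μ_j, σ_j²)` with `σ_j > 0`),
when `n ≥ p + 5` and `p/n → y ∈ (0,1]`: the variance parameter `σ_n²` is strictly
positive and `(log det R_n − μ_n)/σ_n ⇒ N(0,1)`. -/
theorem stmt_12 (p : ℕ → ℕ) (hp : ∀ n, 0 < p n) (hpn : ∀ n : ℕ, 6 ≤ n → p n + 5 ≤ n)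
    (y : ℝ) (hy : y ∈ Set.Ioc (0 : ℝ) 1)
    (hlim : Tendsto (fun n => (p n : ℝ) / n) atTop (𝓝 y))
    (μmean : (n : ℕ) → Fin (p n) → ℝ) (σdev : (n : ℕ) → Fin (p n) → ℝ≥0)
    (hσdev : ∀ n j, 0 < σdev n j)
    (μn σsq : ℕ → ℝ)
    (hμ : ∀ n : ℕ, μn n =
      ((p n : ℝ) - n + 3 / 2) * Real.log (1 - (p n : ℝ) / ((n : ℝ) - 1))
        - ((n : ℝ) - 2) / ((n : ℝ) - 1) * p n)
    (hσ : ∀ n : ℕ, σsq n =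
      -2 * ((p n : ℝ) / ((n : ℝ) - 1) + Real.log (1 - (p n : ℝ) / ((n : ℝ) - 1)))) :
    (∀ n : ℕ, 6 ≤ n → 0 < σsq n) ∧
    ∀ f : BoundedContinuousFunction ℝ ℝ,
      Tendsto (fun n : ℕ =>
          ∫ ω : Fin n × Fin (p n) → ℝ,
            f ((Real.log (Matrix.det
                (Matrix.of fun i j : Fin (p n) =>
                  pearsonCorr n (fun a => ω (a, i)) (fun a => ω (a, j)))) - μn n)
              / Real.sqrt (σsq n))
            ∂(Measure.pi fun q : Fin n × Fin (p n) =>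
                gaussianReal (μmean n q.2) ((σdev n q.2) ^ 2)))
        atTop (𝓝 (∫ x, f x ∂(gaussianReal 0 1))) := by
  refine ⟨fun n h6 => hσ n ▸ JY.sig_pos n (p n) (hp n) (hpn n h6), fun f => ?_⟩
  have hmeas : ∀ n, Measurable fun ω : Fin n × Fin (p n) → ℝ => (JY.ld n (p n) ω - μn n) / Real.sqrt (σsq n) :=
    fun n => ((JY.measurable_ld n (p n)).sub_const _).div_const _
  let ν : ℕ → ProbabilityMeasure ℝ := fun n =>
    ⟨(Measure.pi fun q : Fin n × Fin (p n) => gaussianReal (μmean n q.2) ((σdev n q.2) ^ 2)).map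
        (fun ω => (JY.ld n (p n) ω - μn n) / Real.sqrt (σsq n)),
      Measure.isProbabilityMeasure_map (hmeas n).aemeasurable⟩
  let ν₀ : ProbabilityMeasure ℝ := ⟨gaussianReal 0 1, inferInstance⟩
  have key : Tendsto ν atTop (𝓝 ν₀) := by
    refine ProbabilityMeasure.tendsto_of_tendsto_charFun fun s => ?_
    obtain ⟨h1, h2⟩ := JY.lim_eps p hp hpn y hy hlim σsq hσ s
    have hex : ∀ᶠ n in atTop, ∃ ε : ℂ, ‖ε‖ ≤ 100 * (|s / Real.sqrt (σsq n)| + |s / Real.sqrt (σsq n)| ^ 3) / ((n - 1 - p n : ℕ) : ℝ) ∧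
      charFun (ν n : Measure ℝ) s = Complex.exp (-(s ^ 2 / 2 : ℝ) + ε) := by
      filter_upwards [h1, eventually_ge_atTop 6] with n ht h6
      exact JY.char_n n (p n) (hp n) (hpn n h6) (μmean n) (σdev n) (hσdev n) (μn n) (σsq n) (hμ n) (hσ n) s ht
    have hex2 : ∀ n, ∃ ε : ℂ, (∃ ε : ℂ, ‖ε‖ ≤ 100 * (|s / Real.sqrt (σsq n)| + |s / Real.sqrt (σsq n)| ^ 3) / ((n - 1 - p n : ℕ) : ℝ) ∧
      charFun (ν n : Measure ℝ) s = Complex.exp (-(s ^ 2 / 2 : ℝ) + ε)) →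
      (‖ε‖ ≤ 100 * (|s / Real.sqrt (σsq n)| + |s / Real.sqrt (σsq n)| ^ 3) / ((n - 1 - p n : ℕ) : ℝ) ∧
      charFun (ν n : Measure ℝ) s = Complex.exp (-(s ^ 2 / 2 : ℝ) + ε)) := by
      intro n
      by_cases h : ∃ ε : ℂ, ‖ε‖ ≤ 100 * (|s / Real.sqrt (σsq n)| + |s / Real.sqrt (σsq n)| ^ 3) / ((n - 1 - p n : ℕ) : ℝ) ∧
        charFun (ν n : Measure ℝ) s = Complex.exp (-(s ^ 2 / 2 : ℝ) + ε)
      · obtain ⟨ε, hε⟩ := h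
        exact ⟨ε, fun _ => hε⟩
      · exact ⟨0, fun h' => absurd h' h⟩
    choose ε hε using hex2
    have hε0 : Tendsto ε atTop (𝓝 0) := by
      refine squeeze_zero_norm' ?_ h2
      filter_upwards [hex] with n hn
      exact (hε n hn).1
    have hlimc : Tendsto (fun n => Complex.exp (-(s ^ 2 / 2 : ℝ) + ε n)) atTop (𝓝 (charFun (ν₀ : Measure ℝ) s)) := by
      have e : charFun (ν₀ : Measure ℝ) s = Complex.exp (-(s ^ 2 / 2 : ℝ) + 0) := by
        show charFun (gaussianReal 0 1) s = _
        rw [charFun_gaussianReal]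
        congr 1; push_cast; ring
      rw [e]
      exact (Complex.continuous_exp.tendsto _).comp (hε0.const_add _)
    refine hlimc.congr' ?_
    filter_upwards [hex] with n hn
    exact (hε n hn).2.symm
  have := (ProbabilityMeasure.tendsto_iff_forall_integral_tendsto.1 key) f
  refine this.congr fun n => ?_
  show ∫ x, f x ∂((Measure.pi fun q : Fin n × Fin (p n) => gaussianReal (μmean n q.2) ((σdev n q.2) ^ 2)).map
        (fun ω => (JY.ld n (p n) ω - μn n) / Real.sqrt (σsq n))) = _
  rw [integral_map (hmeas n).aemeasurable f.continuous.aestronglyMeasurable]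
  rfl
end

section
/- Let k ≥ 2 and p ≥ 1 be integers, and let n_1, …, n_k be integers with n_i ≥ p + 2 for each 1 ≤ i ≤ k. Set n = n_1 + ⋯ + n_k. Then Σ_{i=1}^k (n_i/n)² · ( −log(1 − p/(n_i − 1)) ) > −log(1 − p/n). -/
/-- Jiang–Yang, positivity of the variance parameter in Theorem 3 (testing that
several normal distributions are identical): for `k ≥ 2`, `p ≥ 1` and
`n_i ≥ p + 2`, with `n = n_1 + ⋯ + n_k`,
`Σ_i (n_i/n)² · (−log(1 − p/(n_i − 1))) > −log(1 − p/n)`. -/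
theorem stmt_15 (k p : ℕ) (hk : 2 ≤ k) (hp : 1 ≤ p) (nn : Fin k → ℕ)
    (hnn : ∀ i, p + 2 ≤ nn i) :
    -Real.log (1 - (p : ℝ) / ((∑ i, nn i : ℕ) : ℝ)) <
      ∑ i, ((nn i : ℝ) / ((∑ j, nn j : ℕ) : ℝ)) ^ 2
        * (-Real.log (1 - (p : ℝ) / ((nn i : ℝ) - 1))) := by
  have hN : 0 < ((∑ j, nn j : ℕ) : ℝ) := by
    have h1 := Finset.single_le_sum (f := nn) (s := Finset.univ) (fun i _ => Nat.zero_le _)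
      (Finset.mem_univ (⟨0, by omega⟩ : Fin k))
    have h2 := hnn ⟨0, by omega⟩
    exact_mod_cast (by omega : 0 < ∑ j, nn j)
  have hle : ∀ i, (nn i : ℝ) ≤ ((∑ j, nn j : ℕ) : ℝ) := fun i => by
    exact_mod_cast Finset.single_le_sum (f := nn) (s := Finset.univ) (fun i _ => Nat.zero_le _)
      (Finset.mem_univ i)
  have hsum : ∑ i, (nn i : ℝ) / ((∑ j, nn j : ℕ) : ℝ) = 1 := by
    rw [← Finset.sum_div, ← Nat.cast_sum, div_self hN.ne']
  generalize ((∑ j, nn j : ℕ) : ℝ) = N at *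
  have hp' : (1 : ℝ) ≤ p := by exact_mod_cast hp
  have key : ∀ i, (nn i : ℝ) / N * (-Real.log (1 - (p : ℝ) / N)) <
      ((nn i : ℝ) / N) ^ 2 * (-Real.log (1 - (p : ℝ) / ((nn i : ℝ) - 1))) := by
    intro i
    have hi : (p : ℝ) + 2 ≤ nn i := by exact_mod_cast hnn i
    have hl := hle i
    generalize (nn i : ℝ) = m at *
    have hm : 0 < m := by linarith
    have hm1 : 0 < m - 1 := by linarith
    have ht : 0 < m / N := by positivity
    have ht1 : m / N ≤ 1 := (div_le_one hN).2 hl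
    have hx : (p : ℝ) / (m - 1) < 1 := (div_lt_one hm1).2 (by linarith)
    have hxm : (p : ℝ) / m < p / (m - 1) :=
      div_lt_div_of_pos_left (by linarith) hm1 (by linarith)
    have hlog : Real.log (1 - (p : ℝ) / (m - 1)) < Real.log (1 - p / m) :=
      Real.log_lt_log (by linarith) (by linarith)
    have hc := strictConcaveOn_log_Ioi.concaveOn.2 (x := 1 - (p : ℝ) / m) (y := 1)
      (Set.mem_Ioi.2 (by linarith)) (Set.mem_Ioi.2 one_pos) ht.le (sub_nonneg.2 ht1) (by ring)
    simp only [smul_eq_mul, Real.log_one, mul_zero, add_zero] at hc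
    have he : m / N * (1 - p / m) + (1 - m / N) * 1 = 1 - p / N := by
      field_simp
      ring
    rw [he] at hc
    have h3 := mul_lt_mul_of_pos_left hlog ht
    have h4 := mul_lt_mul_of_pos_left (lt_of_lt_of_le h3 hc) ht
    linarith [h4]
  calc -Real.log (1 - (p : ℝ) / N) = ∑ i, (nn i : ℝ) / N * (-Real.log (1 - (p : ℝ) / N)) := by
        rw [← Finset.sum_mul, hsum, one_mul]
    _ < _ := Finset.sum_lt_sum_of_nonempty ⟨⟨0, by omega⟩, Finset.mem_univ _⟩ (fun i _ => key i)
end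

section
/- Let k ≥ 2 and p ≥ 1 be integers, and let n_1, …, n_k be integers with n_i ≥ p + 2 for each 1 ≤ i ≤ k. Set n = n_1 + ⋯ + n_k. Then −Σ_{i=1}^k ((n_i − 1)/(n − k))² · log(1 − p/(n_i − 1)) > −log(1 − p/(n − k)). -/
/-- Jiang–Yang, positivity of the variance parameter in Theorem 4 (testing
equality of several covariance matrices): for `k ≥ 2`, `p ≥ 1` and
`n_i ≥ p + 2`, with `n = n_1 + ⋯ + n_k`,
`−Σ_i ((n_i − 1)/(n − k))² · log(1 − p/(n_i − 1)) > −log(1 − p/(n − k))`. -/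
theorem stmt_16 (k p : ℕ) (hk : 2 ≤ k) (hp : 1 ≤ p) (nn : Fin k → ℕ)
    (hnn : ∀ i, p + 2 ≤ nn i) :
    -Real.log (1 - (p : ℝ) / (((∑ i, nn i : ℕ) : ℝ) - k)) <
      -∑ i, (((nn i : ℝ) - 1) / (((∑ j, nn j : ℕ) : ℝ) - k)) ^ 2
        * Real.log (1 - (p : ℝ) / ((nn i : ℝ) - 1)) := by
  have hN : (((∑ i, nn i : ℕ) : ℝ) - k) = ∑ i, ((nn i : ℝ) - 1) := by
    simp [Finset.sum_sub_distrib]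
  rw [hN]
  set N : ℝ := ∑ i, ((nn i : ℝ) - 1) with hNdef
  have hp' : (1 : ℝ) ≤ p := by exact_mod_cast hp
  have hm : ∀ i, (p : ℝ) + 1 ≤ (nn i : ℝ) - 1 := by
    intro i
    have h : ((p + 2 : ℕ) : ℝ) ≤ (nn i : ℝ) := by exact_mod_cast hnn i
    push_cast at h
    linarith
  have hlt : ∀ i, (nn i : ℝ) - 1 < N := by
    intro i
    have hnt : Nontrivial (Fin k) := Fin.nontrivial_iff_two_le.mpr hk
    obtain ⟨j, hj⟩ := exists_ne i
    exact Finset.single_lt_sum (f := fun i => (nn i : ℝ) - 1) hj (Finset.mem_univ i)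
      (Finset.mem_univ j) (by have := hm j; linarith)
      (fun l _ _ => by have := hm l; linarith)
  have key : ∀ i, (((nn i : ℝ) - 1) / N) ^ 2 * Real.log (1 - (p : ℝ) / ((nn i : ℝ) - 1))
      < (((nn i : ℝ) - 1) / N) * Real.log (1 - (p : ℝ) / N) := by
    intro i
    have h1 := hm i
    have h2 := hlt i
    generalize (nn i : ℝ) - 1 = m at h1 h2
    have m0 : 0 < m := by linarith
    have N0 : 0 < N := by linarith
    have t0 : 0 < m / N := by positivity
    have t1 : m / N < 1 := (div_lt_one N0).mpr h2
    have x0 : 0 < (p : ℝ) / m := by positivity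
    have x1 : (p : ℝ) / m < 1 := (div_lt_one m0).mpr (by linarith)
    have h := strictConcaveOn_log_Ioi.2 (x := 1 - (p : ℝ) / m) (y := 1)
      (Set.mem_Ioi.mpr (by linarith)) (Set.mem_Ioi.mpr one_pos) (by linarith) t0
      (sub_pos.mpr t1) (by ring)
    simp only [smul_eq_mul, Real.log_one, mul_zero, add_zero] at h
    have e : m / N * (1 - (p : ℝ) / m) + (1 - m / N) * 1 = 1 - (p : ℝ) / N := by
      field_simp
      ring
    rw [e] at h
    rw [sq, mul_assoc]
    exact mul_lt_mul_of_pos_left h t0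
  have i0 : Fin k := ⟨0, by omega⟩
  have N0 : 0 < N := by have := hm i0; have := hlt i0; linarith
  apply neg_lt_neg
  calc _ < ∑ i, (((nn i : ℝ) - 1) / N) * Real.log (1 - (p : ℝ) / N) :=
        Finset.sum_lt_sum_of_nonempty ⟨i0, Finset.mem_univ _⟩ (fun i _ => key i)
    _ = Real.log (1 - (p : ℝ) / N) := by
        rw [← Finset.sum_mul, ← Finset.sum_div, ← hNdef, div_self N0.ne', one_mul]
end
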